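/- Let X be a complex Banach space, p > 0, and let (I,‖·‖_I) be an l_p-ideal in B(X) with eigenvalue constant γ_p and quasi-triangle constant q_I, and let Γ_p > 0 be a constant such that |det_p(I−F)| ≤ exp(Γ_p ∑_j |λ_j(F)|^p) for every finite rank operator F on X. Then there exists a unique function det_{p,I}(I−·) : I → ℂ that is continuous with respect to ‖·‖_I and satisfies det_{p,I}(I−F) = det_p(I−F) for all F ∈ F(X). Moreover, for all K, L ∈ I: |det_{p,I}(I−L)| ≤ exp(γ_p^p Γ_p ‖L‖_I^p) and |det_{p,I}(I−K) − det_{p,I}(I−L)| ≤ ‖K−L‖_I · exp(q_I^{2p} γ_p^p Γ_p (‖K‖_I + ‖L‖_I + 1)^p). -/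

import Mathlib

open scoped ENNReal

variable {X : Type*} [NormedAddCommGroup X] [NormedSpace ℂ X] [CompleteSpace X]

/-- A continuous linear operator has finite rank. -/
def IsFiniteRank (F : X →L[ℂ] X) : Prop :=
  FiniteDimensional ℂ (LinearMap.range (F : X →ₗ[ℂ] X))

/-- `det(I - F)`, defined as the determinant of the restriction of `I - F` to the
(finite-dimensional) range of `F`. -/
noncomputable def detOneSub (F : X →L[ℂ] X) : ℂ :=
  LinearMap.det
    ((LinearMap.id : LinearMap.range (F : X →ₗ[ℂ] X) →ₗ[ℂ] LinearMap.range (F : X →ₗ[ℂ] X)) -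
      (F : X →ₗ[ℂ] X).restrict fun x _ => LinearMap.mem_range_self _ x)

/-- `tr F`, the trace of the restriction of `F` to its range. -/
noncomputable def trOn (F : X →L[ℂ] X) : ℂ :=
  LinearMap.trace ℂ (LinearMap.range (F : X →ₗ[ℂ] X))
    ((F : X →ₗ[ℂ] X).restrict fun x _ => LinearMap.mem_range_self _ x)

/-- The `p`-regularized determinant `det_p(I-F)` of a finite rank operator. -/
noncomputable def detp (p : ℝ) (F : X →L[ℂ] X) : ℂ :=
  detOneSub F * Complex.exp (∑ k ∈ Finset.Icc 1 (⌈p⌉₊ - 1), trOn (F ^ k) / (k : ℂ))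

open scoped ENNReal

variable {X : Type*} [NormedAddCommGroup X] [NormedSpace ℂ X] [CompleteSpace X]

/-- The Riesz projection of `T` at `μ`, computed with the circle of radius `r` around `μ`. -/
noncomputable def rieszProjection (T : X →L[ℂ] X) (μ : ℂ) (r : ℝ) : X →L[ℂ] X :=
  (2 * Real.pi * Complex.I)⁻¹ • ∮ z in C(μ, r), resolvent T z

/-- `μ` is a discrete eigenvalue of `T`: an isolated point of the spectrum whose
Riesz projection has finite-dimensional range. -/
def IsDiscreteEigenvalue (T : X →L[ℂ] X) (μ : ℂ) : Prop :=
  μ ∈ spectrum ℂ T ∧ ∃ r, 0 < r ∧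
    (∀ z ∈ Metric.closedBall μ r, z ≠ μ → z ∉ spectrum ℂ T) ∧
    FiniteDimensional ℂ (LinearMap.range ((rieszProjection T μ r : X →L[ℂ] X) : X →ₗ[ℂ] X))

open scoped Classical in
/-- The algebraic multiplicity of `μ`: the dimension of the range of the Riesz projection
computed with a radius isolating `μ` from the rest of the spectrum. -/
noncomputable def algebraicMultiplicity (T : X →L[ℂ] X) (μ : ℂ) : ℕ :=
  if h : ∃ r, 0 < r ∧ ∀ z ∈ Metric.closedBall μ r, z ≠ μ → z ∉ spectrum ℂ T then
    Module.finrank ℂ (LinearMap.range ((rieszProjection T μ h.choose : X →L[ℂ] X) : X →ₗ[ℂ] X))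
  else 0

/-- `∑_j |λ_j(T)|^p`, the sum over the discrete eigenvalues of `T`, counted with
algebraic multiplicity (as an extended nonnegative real). -/
noncomputable def eigSum (p : ℝ) (T : X →L[ℂ] X) : ℝ≥0∞ :=
  ∑' μ : {μ : ℂ // IsDiscreteEigenvalue T μ},
    (algebraicMultiplicity T (μ : ℂ) : ℝ≥0∞) * ENNReal.ofReal (‖(μ : ℂ)‖ ^ p)

/-- The number of discrete eigenvalues of `T` in the set `S`, counted with algebraic
multiplicity (as an extended nonnegative real). -/
noncomputable def eigCount (T : X →L[ℂ] X) (S : Set ℂ) : ℝ≥0∞ :=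
  ∑' μ : {μ : ℂ // μ ∈ S ∧ IsDiscreteEigenvalue T μ},
    (algebraicMultiplicity T (μ : ℂ) : ℝ≥0∞)

/-- An `l_p`-ideal in `B(X)`: a quasi-normed subspace (with quasi-norm `norm'` and
quasi-triangle constant `q`) of the bounded operators on `X` in which the finite rank
operators are dense (A1), whose quasi-norm dominates the operator norm (A2), which is a
two-sided ideal with submultiplicative quasi-norm (A3), and whose members have
`l_p`-summable discrete eigenvalue sequences, with eigenvalue constant `γ` (A4). -/
structure LpIdeal (p : ℝ) (X : Type*) [NormedAddCommGroup X] [NormedSpace ℂ X]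
    [CompleteSpace X] where
  carrier : Set (X →L[ℂ] X)
  norm' : (X →L[ℂ] X) → ℝ
  q : ℝ
  γ : ℝ
  one_le_q : 1 ≤ q
  γ_nonneg : 0 ≤ γ
  add_mem : ∀ {K L : X →L[ℂ] X}, K ∈ carrier → L ∈ carrier → K + L ∈ carrier
  smul_mem : ∀ (c : ℂ) {L : X →L[ℂ] X}, L ∈ carrier → c • L ∈ carrier
  norm'_nonneg : ∀ L ∈ carrier, 0 ≤ norm' L
  norm'_eq_zero_iff : ∀ L ∈ carrier, (norm' L = 0 ↔ L = 0)
  norm'_smul : ∀ L ∈ carrier, ∀ c : ℂ, norm' (c • L) = ‖c‖ * norm' L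
  norm'_add_le : ∀ K ∈ carrier, ∀ L ∈ carrier, norm' (K + L) ≤ q * (norm' K + norm' L)
  finiteRank_mem : ∀ F : X →L[ℂ] X, IsFiniteRank F → F ∈ carrier
  dense_finiteRank : ∀ L ∈ carrier, ∀ ε > 0, ∃ F : X →L[ℂ] X, IsFiniteRank F ∧ norm' (L - F) < ε
  opNorm_le : ∀ L ∈ carrier, ‖L‖ ≤ norm' L
  mul_mem : ∀ L ∈ carrier, ∀ A B : X →L[ℂ] X, A * L * B ∈ carrier
  mul_norm'_le : ∀ L ∈ carrier, ∀ A B : X →L[ℂ] X, norm' (A * L * B) ≤ ‖A‖ * norm' L * ‖B‖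
  eig_le : ∀ L ∈ carrier, eigSum p L ≤ ENNReal.ofReal ((γ * norm' L) ^ p)

/-- `D` is continuous on the ideal `I` with respect to the quasi-norm of `I`. -/
def IdealContinuous {p : ℝ} (I : LpIdeal p X) (D : (X →L[ℂ] X) → ℂ) : Prop :=
  ∀ L ∈ I.carrier, ∀ ε > 0, ∃ δ > 0, ∀ K ∈ I.carrier, I.norm' (K - L) < δ → ‖D K - D L‖ < ε

/-- `D` agrees with the `p`-regularized determinant on the finite rank operators. -/
def ExtendsDetp (p : ℝ) (D : (X →L[ℂ] X) → ℂ) : Prop :=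
  ∀ F : X →L[ℂ] X, IsFiniteRank F → D F = detp p F

set_option linter.unusedSectionVars false

section FiniteDimensional

variable {V : Type*} [AddCommGroup V] [Module ℂ V]

open Module Module.End in
theorem trace_pow_restrict_maxGenEigenspace [FiniteDimensional ℂ V] (f : End ℂ V) (μ : ℂ) (j : ℕ)
    (h : ∀ x ∈ f.maxGenEigenspace μ, (f ^ j) x ∈ f.maxGenEigenspace μ) :
    LinearMap.trace ℂ _ ((f ^ j).restrict h) = (f.charpoly.roots.count μ : ℂ) * μ ^ j := by
  have h1 : ∀ x ∈ f.maxGenEigenspace μ, f x ∈ f.maxGenEigenspace μ :=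
    mapsTo_maxGenEigenspace_of_comm rfl μ
  set g : End ℂ (f.maxGenEigenspace μ) := f.restrict h1 with hg
  have hpow : (f ^ j).restrict h = g ^ j := (Module.End.pow_restrict j h1 h).symm
  rw [hpow, Polynomial.count_roots, ← LinearMap.finrank_maxGenEigenspace_eq]
  have hN : IsNilpotent (g - algebraMap ℂ _ μ) :=
    isNilpotent_restrict_maxGenEigenspace_sub_algebraMap f μ
  clear hpow h
  induction j with
  | zero => simp
  | succ j ih =>
    have h2 : g ^ (j + 1) = g ^ j * (g - algebraMap ℂ _ μ) + μ • g ^ j := by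
      rw [mul_sub, pow_succ, ← Algebra.commutes, Algebra.smul_def]; abel
    have hc : Commute (g ^ j) (g - algebraMap ℂ _ μ) :=
      ((Commute.refl g).sub_right (Algebra.commutes μ g).symm).pow_left j
    have h3 : LinearMap.trace ℂ _ (g ^ j * (g - algebraMap ℂ _ μ)) = 0 :=
      (LinearMap.isNilpotent_trace_of_isNilpotent (hc.isNilpotent_mul_left hN)).eq_zero
    rw [h2, map_add, h3, map_smul, ih, zero_add, smul_eq_mul]
    ring

open Module Module.End in
theorem trace_pow_eq_sum_roots [FiniteDimensional ℂ V] (f : End ℂ V) (j : ℕ) :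
    LinearMap.trace ℂ V (f ^ j) = (f.charpoly.roots.map (· ^ j)).sum := by
  classical
  have hint := (DirectSum.isInternal_submodule_iff_iSupIndep_and_iSup_eq_top _).2
    ⟨independent_maxGenEigenspace f, iSup_maxGenEigenspace_eq_top f⟩
  have hfin : {μ | f.maxGenEigenspace μ ≠ ⊥}.Finite :=
    WellFoundedGT.finite_ne_bot_of_iSupIndep (independent_maxGenEigenspace f)
  have hm : ∀ μ : ℂ, ∀ x ∈ f.maxGenEigenspace μ, (f ^ j) x ∈ f.maxGenEigenspace μ := fun μ =>
    mapsTo_maxGenEigenspace_of_comm ((Commute.refl f).pow_right j) μ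
  rw [LinearMap.trace_eq_sum_trace_restrict' hint hfin hm, Finset.sum_multiset_map_count]
  simp_rw [trace_pow_restrict_maxGenEigenspace f _ j (hm _), nsmul_eq_mul]
  refine (Finset.sum_subset ?_ ?_).symm
  · intro μ hμ
    rw [Multiset.mem_toFinset, ← Multiset.count_pos, Polynomial.count_roots,
      ← LinearMap.finrank_maxGenEigenspace_eq] at hμ
    simp only [Set.Finite.mem_toFinset, Set.mem_ofPred_eq]
    intro h
    rw [h] at hμ
    simp at hμ
  · intro μ _ hμ
    rw [Multiset.mem_toFinset, ← Multiset.count_eq_zero] at hμ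
    simp [hμ]

theorem det_one_sub_smul_eq_prod_roots [FiniteDimensional ℂ V] (f : Module.End ℂ V) (z : ℂ) :
    LinearMap.det (1 - z • f) = (f.charpoly.roots.map (fun l => 1 - z * l)).prod := by
  have hs : f.charpoly.Splits := IsAlgClosed.splits _
  have heval : ∀ w : ℂ, LinearMap.det (algebraMap ℂ (Module.End ℂ V) w - f)
      = (f.charpoly.roots.map (fun l => w - l)).prod := by
    intro w
    have h := congrArg (Polynomial.eval w)
      (hs.eq_prod_roots_of_monic (LinearMap.charpoly_monic f))
    rw [Polynomial.eval_multiset_prod, Multiset.map_map] at h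
    rw [← LinearMap.eval_charpoly, h]
    simp
  have hcard : f.charpoly.roots.card = Module.finrank ℂ V := by
    rw [← LinearMap.charpoly_natDegree f]; exact hs.natDegree_eq_card_roots.symm
  rcases eq_or_ne z 0 with rfl | hz
  · simp
  · have h1 : (1 : Module.End ℂ V) - z • f = z • (algebraMap ℂ (Module.End ℂ V) z⁻¹ - f) := by
      rw [smul_sub, Algebra.algebraMap_eq_smul_one, smul_smul, mul_inv_cancel₀ hz, one_smul]
    rw [h1, LinearMap.det_smul, heval, ← hcard]
    induction f.charpoly.roots using Multiset.induction_on with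
    | empty => simp
    | cons a s ih =>
      simp only [Multiset.card_cons, Multiset.map_cons, Multiset.prod_cons, ← ih]
      rw [pow_succ]
      linear_combination (z ^ s.card * (Multiset.map (fun l => z⁻¹ - l) s).prod) * (mul_inv_cancel₀ hz)

theorem det_one_sub_restrict_eq [FiniteDimensional ℂ V] (W : Submodule ℂ V) (f : Module.End ℂ V)
    (hf : ∀ x, f x ∈ W) :
    LinearMap.det (1 - f.restrict (fun x (_ : x ∈ W) => hf x)) = LinearMap.det (1 - f) := by
  have he : W ≤ W.comap (1 - f) := fun x hx => W.sub_mem hx (hf x)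
  have h1 : W.mapQ W (1 - f) he = LinearMap.id := by
    ext x
    simpa [sub_eq_self] using hf x
  have h2 : (1 - f : Module.End ℂ V).restrict he = 1 - f.restrict (fun x (_ : x ∈ W) => hf x) := by
    ext x; rfl
  rw [LinearMap.det_eq_det_mul_det W (1 - f) he, h1, h2, LinearMap.det_id, mul_one]

end FiniteDimensional

/-- The restriction of `F` to a subspace containing its range. -/
def restrictOf (F : X →L[ℂ] X) (V : Submodule ℂ X)
    (h : LinearMap.range (F : X →ₗ[ℂ] X) ≤ V) : Module.End ℂ V :=
  (F : X →ₗ[ℂ] X).restrict fun x _ => h (LinearMap.mem_range_self _ x)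

theorem coe_restrictOf (F : X →L[ℂ] X) (V : Submodule ℂ X)
    (h : LinearMap.range (F : X →ₗ[ℂ] X) ≤ V) (x : V) : (restrictOf F V h x : X) = F x := rfl

theorem detOneSub_eq (F : X →L[ℂ] X) (V : Submodule ℂ X) [FiniteDimensional ℂ V]
    (h : LinearMap.range (F : X →ₗ[ℂ] X) ≤ V) :
    detOneSub F = LinearMap.det (1 - restrictOf F V h) := by
  set W := (LinearMap.range (F : X →ₗ[ℂ] X)).comap V.subtype with hW
  have hf : ∀ x, restrictOf F V h x ∈ W := fun x => LinearMap.mem_range_self _ (x : X)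
  rw [← det_one_sub_restrict_eq W (restrictOf F V h) hf]
  rw [← LinearMap.det_conj _ (Submodule.comapSubtypeEquivOfLe h)]
  rfl

theorem trOn_eq (F : X →L[ℂ] X) (V : Submodule ℂ X) [FiniteDimensional ℂ V]
    (h : LinearMap.range (F : X →ₗ[ℂ] X) ≤ V) :
    trOn F = LinearMap.trace ℂ V (restrictOf F V h) := by
  set W := (LinearMap.range (F : X →ₗ[ℂ] X)).comap V.subtype with hW
  have hf : ∀ x, restrictOf F V h x ∈ W := fun x => LinearMap.mem_range_self _ (x : X)
  rw [← LinearMap.trace_restrict_eq_of_forall_mem W (restrictOf F V h) hf]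
  rw [← LinearMap.trace_conj' _ (Submodule.comapSubtypeEquivOfLe h)]
  rfl

theorem range_pow_le (F : X →L[ℂ] X) (V : Submodule ℂ X)
    (h : LinearMap.range (F : X →ₗ[ℂ] X) ≤ V) {j : ℕ} (hj : j ≠ 0) :
    LinearMap.range ((F ^ j : X →L[ℂ] X) : X →ₗ[ℂ] X) ≤ V := by
  obtain ⟨i, rfl⟩ := Nat.exists_eq_succ_of_ne_zero hj
  rintro _ ⟨x, rfl⟩
  rw [pow_succ']
  exact h (LinearMap.mem_range_self _ _)

theorem restrictOf_pow (F : X →L[ℂ] X) (V : Submodule ℂ X)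
    (h : LinearMap.range (F : X →ₗ[ℂ] X) ≤ V) {j : ℕ} (hj : j ≠ 0) :
    restrictOf (F ^ j) V (range_pow_le F V h hj) = restrictOf F V h ^ j := by
  ext x
  rw [coe_restrictOf]
  clear hj
  induction j generalizing x with
  | zero => rfl
  | succ j ih =>
    rw [pow_succ, pow_succ, Module.End.mul_apply, ← ih]
    rfl

theorem detp_eq (p : ℝ) (F : X →L[ℂ] X) (V : Submodule ℂ X) [FiniteDimensional ℂ V]
    (h : LinearMap.range (F : X →ₗ[ℂ] X) ≤ V) :
    detp p F = LinearMap.det (1 - restrictOf F V h) *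
      Complex.exp (∑ k ∈ Finset.Icc 1 (⌈p⌉₊ - 1),
        LinearMap.trace ℂ V (restrictOf F V h ^ k) / (k : ℂ)) := by
  rw [detp, detOneSub_eq F V h]
  congr 2
  refine Finset.sum_congr rfl fun k hk => ?_
  have hk0 : k ≠ 0 := by have := (Finset.mem_Icc.1 hk).1; omega
  rw [trOn_eq (F ^ k) V (range_pow_le F V h hk0), restrictOf_pow F V h hk0]

/-- The eigenvalues of `F` on its range, with multiplicity. -/
noncomputable def eigRoots (F : X →L[ℂ] X) (hF : IsFiniteRank F) : Multiset ℂ :=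
  have : FiniteDimensional ℂ (LinearMap.range (F : X →ₗ[ℂ] X)) := hF
  (restrictOf F _ le_rfl).charpoly.roots

/-- The elementary factor `(1 - u) exp (u + u² / 2 + ⋯ + uᵐ / m)`. -/
noncomputable def elemFactor (m : ℕ) (u : ℂ) : ℂ :=
  (1 - u) * Complex.exp (∑ k ∈ Finset.Icc 1 m, u ^ k / (k : ℂ))

theorem IsFiniteRank.smul {F : X →L[ℂ] X} (hF : IsFiniteRank F) (z : ℂ) :
    IsFiniteRank (z • F) := by
  have : FiniteDimensional ℂ (LinearMap.range (F : X →ₗ[ℂ] X)) := hF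
  refine Submodule.finiteDimensional_of_le (S₂ := LinearMap.range (F : X →ₗ[ℂ] X)) ?_
  rintro _ ⟨x, rfl⟩
  exact ⟨z • x, by simp⟩

theorem IsFiniteRank.add {F G : X →L[ℂ] X} (hF : IsFiniteRank F) (hG : IsFiniteRank G) :
    IsFiniteRank (F + G) := by
  have : FiniteDimensional ℂ (LinearMap.range (F : X →ₗ[ℂ] X)) := hF
  have : FiniteDimensional ℂ (LinearMap.range (G : X →ₗ[ℂ] X)) := hG
  refine Submodule.finiteDimensional_of_le
    (S₂ := LinearMap.range (F : X →ₗ[ℂ] X) ⊔ LinearMap.range (G : X →ₗ[ℂ] X)) ?_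
  rintro _ ⟨x, rfl⟩
  exact Submodule.add_mem_sup (LinearMap.mem_range_self _ x) (LinearMap.mem_range_self _ x)

theorem IsFiniteRank.sub {F G : X →L[ℂ] X} (hF : IsFiniteRank F) (hG : IsFiniteRank G) :
    IsFiniteRank (F - G) := by
  have h := hF.add (hG.smul (-1))
  rwa [neg_one_smul, ← sub_eq_add_neg] at h

theorem detp_smul_eq_prod (p : ℝ) (F : X →L[ℂ] X) (hF : IsFiniteRank F) (z : ℂ) :
    detp p (z • F) = ((eigRoots F hF).map (fun l => elemFactor (⌈p⌉₊ - 1) (z * l))).prod := by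
  have : FiniteDimensional ℂ (LinearMap.range (F : X →ₗ[ℂ] X)) := hF
  have h : LinearMap.range ((z • F : X →L[ℂ] X) : X →ₗ[ℂ] X) ≤
      LinearMap.range (F : X →ₗ[ℂ] X) := by
    rintro _ ⟨x, rfl⟩
    exact ⟨z • x, by simp⟩
  have hr : restrictOf (z • F) _ h = z • restrictOf F _ le_rfl := rfl
  rw [detp_eq p (z • F) _ h, hr, det_one_sub_smul_eq_prod_roots]
  simp only [elemFactor, Multiset.prod_map_mul]
  congr 1
  have key : ∀ s : Multiset ℂ, (s.map fun l => Complex.exp (∑ k ∈ Finset.Icc 1 (⌈p⌉₊ - 1),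
      (z * l) ^ k / (k : ℂ))).prod = Complex.exp (∑ k ∈ Finset.Icc 1 (⌈p⌉₊ - 1),
      z ^ k * (s.map (· ^ k)).sum / (k : ℂ)) := by
    intro s
    induction s using Multiset.induction_on with
    | empty => simp
    | cons a s ih =>
      rw [Multiset.map_cons, Multiset.prod_cons, ih, ← Complex.exp_add,
        ← Finset.sum_add_distrib]
      congr 1
      refine Finset.sum_congr rfl fun k _ => ?_
      rw [Multiset.map_cons, Multiset.sum_cons]
      ring
  rw [key]
  congr 1
  refine Finset.sum_congr rfl fun k _ => ?_
  rw [smul_pow, map_smul, trace_pow_eq_sum_roots, smul_eq_mul]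
  rfl

theorem differentiable_matrix_det {ι : Type*} [Fintype ι] [DecidableEq ι] {M : ℂ → Matrix ι ι ℂ}
    {s : Set ℂ} (h : ∀ i j, DifferentiableOn ℂ (fun z => M z i j) s) :
    DifferentiableOn ℂ (fun z => (M z).det) s := by
  simp_rw [Matrix.det_apply]
  refine DifferentiableOn.fun_sum fun σ _ => ?_
  refine DifferentiableOn.const_smul (DifferentiableOn.fun_finsetProd fun i _ => h _ _) _

theorem differentiable_matrix_pow {ι : Type*} [Fintype ι] [DecidableEq ι] {M : ℂ → Matrix ι ι ℂ}
    {s : Set ℂ} (h : ∀ i j, DifferentiableOn ℂ (fun z => M z i j) s) (n : ℕ) :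
    ∀ i j, DifferentiableOn ℂ (fun z => (M z ^ n) i j) s := by
  induction n with
  | zero => intro i j; simp
  | succ n ih =>
    intro i j
    simp_rw [pow_succ, Matrix.mul_apply]
    exact DifferentiableOn.fun_sum fun k _ => (ih i k).mul (h k j)

theorem differentiable_detp_line (p : ℝ) {F G : X →L[ℂ] X} (hF : IsFiniteRank F)
    (hG : IsFiniteRank G) : Differentiable ℂ fun z : ℂ => detp p (F + z • G) := by
  have : FiniteDimensional ℂ (LinearMap.range (F : X →ₗ[ℂ] X)) := hF
  have : FiniteDimensional ℂ (LinearMap.range (G : X →ₗ[ℂ] X)) := hG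
  set V := LinearMap.range (F : X →ₗ[ℂ] X) ⊔ LinearMap.range (G : X →ₗ[ℂ] X) with hV
  have hFV : LinearMap.range (F : X →ₗ[ℂ] X) ≤ V := le_sup_left
  have hGV : LinearMap.range (G : X →ₗ[ℂ] X) ≤ V := le_sup_right
  have h : ∀ z : ℂ, LinearMap.range ((F + z • G : X →L[ℂ] X) : X →ₗ[ℂ] X) ≤ V := by
    rintro z _ ⟨x, rfl⟩
    exact V.add_mem (hFV (LinearMap.mem_range_self _ x))
      (V.smul_mem z (hGV (LinearMap.mem_range_self _ x)))
  have hr : ∀ z, restrictOf (F + z • G) V (h z) = restrictOf F V hFV + z • restrictOf G V hGV :=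
    fun z => rfl
  let b := Module.finBasis ℂ V
  set A := LinearMap.toMatrix b b (restrictOf F V hFV) with hA
  set B := LinearMap.toMatrix b b (restrictOf G V hGV) with hB
  have hM : ∀ z : ℂ, LinearMap.toMatrix b b (restrictOf (F + z • G) V (h z)) = A + z • B := by
    intro z; rw [hr, map_add, map_smul]
  have hd : ∀ i j, DifferentiableOn ℂ (fun z : ℂ => (A + z • B) i j) Set.univ := by
    intro i j
    simp only [Matrix.add_apply, Matrix.smul_apply, smul_eq_mul]
    fun_prop
  have hd1 : ∀ i j, DifferentiableOn ℂ (fun z : ℂ => (1 - (A + z • B)) i j) Set.univ := by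
    intro i j
    simp only [Matrix.sub_apply]
    exact (differentiableOn_const _).sub (hd i j)
  have heq : ∀ z : ℂ, detp p (F + z • G) = (1 - (A + z • B)).det *
      Complex.exp (∑ k ∈ Finset.Icc 1 (⌈p⌉₊ - 1), ((A + z • B) ^ k).trace / (k : ℂ)) := by
    intro z
    rw [detp_eq p _ V (h z), ← LinearMap.det_toMatrix b, map_sub, hM, LinearMap.toMatrix_one]
    congr 2
    refine Finset.sum_congr rfl fun k _ => ?_
    rw [LinearMap.trace_eq_matrix_trace ℂ b, ← LinearMap.toMatrix_pow, hM]
  rw [← differentiableOn_univ]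
  simp_rw [heq]
  refine (differentiable_matrix_det hd1).mul (DifferentiableOn.cexp ?_)
  refine DifferentiableOn.fun_sum fun k _ => DifferentiableOn.div_const ?_ _
  simp only [Matrix.trace, Matrix.diag]
  exact DifferentiableOn.fun_sum fun i _ => differentiable_matrix_pow hd k i i

theorem isUnit_one_sub_of_det_ne_zero (A : X →L[ℂ] X) (V : Submodule ℂ X) [FiniteDimensional ℂ V]
    (h : LinearMap.range (A : X →ₗ[ℂ] X) ≤ V) (hdet : LinearMap.det (1 - restrictOf A V h) ≠ 0) :
    IsUnit (1 - A) := by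
  have hu : IsUnit (1 - restrictOf A V h) :=
    (LinearMap.isUnit_iff_isUnit_det _).2 (isUnit_iff_ne_zero.2 hdet)
  have hb : Function.Bijective ⇑(1 - restrictOf A V h : Module.End ℂ V) := (Module.End.isUnit_iff _).1 hu
  rw [ContinuousLinearMap.isUnit_iff_bijective]
  constructor
  · rw [injective_iff_map_eq_zero]
    intro x hx
    have hx1 : x = A x := by simpa [sub_eq_zero] using hx
    have hxV : x ∈ V := by rw [hx1]; exact h (LinearMap.mem_range_self _ x)
    have h0 : (1 - restrictOf A V h : Module.End ℂ V) ⟨x, hxV⟩ = 0 := by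
      apply Subtype.ext
      simpa [coe_restrictOf] using hx
    have := (injective_iff_map_eq_zero _).1 hb.1 _ h0
    simpa using congrArg Subtype.val this
  · intro y
    obtain ⟨v, hv⟩ := hb.2 ⟨A y, h (LinearMap.mem_range_self _ y)⟩
    have hv1 : (v : X) - A v = A y := by simpa [coe_restrictOf] using congrArg Subtype.val hv
    refine ⟨y + v, ?_⟩
    have : (1 - A) (y + v) = y - A y + ((v : X) - A v) := by
      simp [sub_eq_add_neg]; abel
    rw [this, hv1]; abel

theorem exists_isolating_radius (T F : X →L[ℂ] X) (hF : IsFiniteRank F) {μ : ℂ}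
    (hTF : ‖T - F‖ < ‖μ‖ / 2) :
    ∃ r, 0 < r ∧ ∀ z ∈ Metric.closedBall μ r, z ≠ μ → z ∉ spectrum ℂ T := by
  have : FiniteDimensional ℂ (LinearMap.range (F : X →ₗ[ℂ] X)) := hF
  have hμpos : 0 < ‖μ‖ := by have := norm_nonneg (T - F); linarith
  have hμ : μ ≠ 0 := norm_pos_iff.1 hμpos
  set R := T - F with hR
  set V := LinearMap.range (F : X →ₗ[ℂ] X) with hV
  set U : Set ℂ := Metric.ball 0 (2 / ‖μ‖) with hU
  have hunit : ∀ w ∈ U, IsUnit (1 - w • R) := by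
    intro w hw
    refine isUnit_one_sub_of_norm_lt_one ?_
    rw [hU, mem_ball_zero_iff, lt_div_iff₀ hμpos] at hw
    rw [norm_smul]
    nlinarith [norm_nonneg w, norm_nonneg R]
  set A : ℂ → X →L[ℂ] X := fun w => w • (F * Ring.inverse (1 - w • R)) with hA
  have hAV : ∀ w, LinearMap.range ((A w : X →L[ℂ] X) : X →ₗ[ℂ] X) ≤ V := by
    rintro w _ ⟨x, rfl⟩
    exact V.smul_mem w (LinearMap.mem_range_self _ _)
  set h : ℂ → ℂ := fun w => LinearMap.det (1 - restrictOf (A w) V (hAV w)) with hh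
  have hspec : ∀ z, z ≠ 0 → z⁻¹ ∈ U → h z⁻¹ ≠ 0 → z ∉ spectrum ℂ T := by
    intro z hz hzU hhz
    have h1 := isUnit_one_sub_of_det_ne_zero (A z⁻¹) V (hAV _) hhz
    have h2 := h1.mul (hunit _ hzU)
    have h3 : (1 - A z⁻¹) * (1 - z⁻¹ • R) = 1 - z⁻¹ • T := by
      have : A z⁻¹ * (1 - z⁻¹ • R) = z⁻¹ • F := by
        rw [hA]
        simp only
        rw [smul_mul_assoc, mul_assoc, Ring.inverse_mul_cancel _ (hunit _ hzU), mul_one]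
      rw [sub_mul, this, one_mul, hR, smul_sub]; abel
    rw [h3] at h2
    rw [spectrum.notMem_iff]
    have h4 : algebraMap ℂ (X →L[ℂ] X) z - T = algebraMap ℂ (X →L[ℂ] X) z * (1 - z⁻¹ • T) := by
      rw [mul_sub, mul_one, ← Algebra.smul_def, smul_smul, mul_inv_cancel₀ hz, one_smul]
    rw [h4]
    exact ((isUnit_iff_ne_zero.2 hz).map (algebraMap ℂ (X →L[ℂ] X))).mul h2
  have hdiff : DifferentiableOn ℂ h U := by
    let b := Module.finBasis ℂ V
    have heq : ∀ w, h w = (1 - LinearMap.toMatrix b b (restrictOf (A w) V (hAV w))).det := by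
      intro w
      rw [hh]; simp only
      rw [← LinearMap.det_toMatrix b, map_sub, LinearMap.toMatrix_one]
    rw [show h = _ from funext heq]
    refine differentiable_matrix_det fun i j => ?_
    simp only [Matrix.sub_apply]
    refine (differentiableOn_const _).sub ?_
    let φ : X →L[ℂ] ℂ := (LinearMap.toContinuousLinearMap (b.coord i)).comp
      (F.codRestrict V fun x => LinearMap.mem_range_self _ x)
    have hφ : ∀ w, LinearMap.toMatrix b b (restrictOf (A w) V (hAV w)) i j
        = w * φ (Ring.inverse (1 - w • R) (b j)) := by
      intro w
      rw [LinearMap.toMatrix_apply]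
      have : restrictOf (A w) V (hAV w) (b j) =
          w • (F.codRestrict V fun x => LinearMap.mem_range_self _ x)
            (Ring.inverse (1 - w • R) (b j)) := rfl
      rw [this, map_smul]
      rfl
    simp_rw [hφ]
    refine differentiableOn_id.mul (φ.differentiable.comp_differentiableOn ?_)
    refine DifferentiableOn.clm_apply ?_ (differentiableOn_const _)
    intro w hw
    refine DifferentiableAt.differentiableWithinAt ?_
    refine DifferentiableAt.comp (g := Ring.inverse) w (differentiableAt_inverse (hunit w hw)) ?_
    fun_prop
  have han : AnalyticOnNhd ℂ h U := hdiff.analyticOnNhd Metric.isOpen_ball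
  have h0U : (0 : ℂ) ∈ U := Metric.mem_ball_self (by positivity)
  have h0 : h 0 = 1 := by
    have : restrictOf (A 0) V (hAV 0) = 0 := by
      ext x; simp [coe_restrictOf, hA]
    rw [hh]; simp [this]
  have hμU : μ⁻¹ ∈ U := by
    rw [hU, mem_ball_zero_iff, norm_inv, inv_eq_one_div]
    gcongr; norm_num
  have hne : ∀ᶠ w in nhdsWithin μ⁻¹ {μ⁻¹}ᶜ, h w ≠ 0 := by
    rcases (han _ hμU).eventually_eq_zero_or_eventually_ne_zero with h1 | h1
    · exfalso
      have := han.eqOn_of_preconnected_of_eventuallyEq (g := fun _ => 0)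
        (fun _ _ => analyticAt_const) (convex_ball _ _).isPreconnected hμU h1 h0U
      rw [h0] at this
      exact one_ne_zero this
    · exact h1
  have hcont : Filter.Tendsto (fun z : ℂ => z⁻¹) (nhdsWithin μ {μ}ᶜ) (nhdsWithin μ⁻¹ {μ⁻¹}ᶜ) := by
    refine tendsto_nhdsWithin_of_tendsto_nhds_of_eventually_within _
      ((continuousAt_inv₀ hμ).tendsto.mono_left nhdsWithin_le_nhds) ?_
    filter_upwards [self_mem_nhdsWithin] with z hz
    simpa using hz
  have hU2 : ∀ᶠ w in nhdsWithin μ⁻¹ {μ⁻¹}ᶜ, w ∈ U :=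
    mem_nhdsWithin_of_mem_nhds (Metric.isOpen_ball.mem_nhds hμU)
  have hz0 : ∀ᶠ z in nhdsWithin μ {μ}ᶜ, z ≠ 0 :=
    mem_nhdsWithin_of_mem_nhds (isOpen_ne.mem_nhds hμ)
  have hfinal : ∀ᶠ z in nhdsWithin μ {μ}ᶜ, z ∉ spectrum ℂ T := by
    filter_upwards [hcont.eventually hne, hcont.eventually hU2, hz0] with z h1 h2 h3
    exact hspec z h3 h2 h1
  rw [eventually_nhdsWithin_iff] at hfinal
  obtain ⟨r, hr, hr1⟩ := Metric.eventually_nhds_iff_ball.1 hfinal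
  refine ⟨r / 2, by positivity, fun z hz hzμ => hr1 z ?_ hzμ⟩
  exact Metric.closedBall_subset_ball (by linarith) hz

theorem clm_circleIntegral {E G : Type*} [NormedAddCommGroup E] [NormedSpace ℂ E] [CompleteSpace E]
    [NormedAddCommGroup G] [NormedSpace ℂ G] [CompleteSpace G] (L : E →L[ℂ] G) {f : ℂ → E}
    {c : ℂ} {r : ℝ} (hf : CircleIntegrable f c r) :
    L (∮ z in C(c, r), f z) = ∮ z in C(c, r), L (f z) := by
  rw [circleIntegral, circleIntegral, ← L.intervalIntegral_comp_comm hf.out]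
  simp

theorem resolvent_apply_of_pow_eq_zero (A : X →L[ℂ] X) {z ν : ℂ} (hz : z ∉ spectrum ℂ A)
    (hzν : z ≠ ν) {N : ℕ} {x : X} (hx : ((A - ν • 1) ^ N) x = 0) :
    resolvent A z x = ∑ i ∈ Finset.range N, ((z - ν)⁻¹ ^ (i + 1)) • ((A - ν • 1) ^ i) x := by
  have hu : IsUnit (algebraMap ℂ (X →L[ℂ] X) z - A) := spectrum.notMem_iff.1 hz
  set c := (z - ν)⁻¹ with hc
  have hc1 : c * (z - ν) = 1 := inv_mul_cancel₀ (sub_ne_zero.2 hzν)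
  have hstep : ∀ i, (algebraMap ℂ (X →L[ℂ] X) z - A) ((c ^ (i + 1)) • ((A - ν • 1) ^ i) x) =
      c ^ i • ((A - ν • 1) ^ i) x - c ^ (i + 1) • ((A - ν • 1) ^ (i + 1)) x := by
    intro i
    set y := ((A - ν • 1) ^ i) x with hy
    have h1 : ((A - ν • 1) ^ (i + 1)) x = A y - ν • y := by
      rw [pow_succ']; simp [hy]
    rw [h1, map_smul]
    have h2 : (algebraMap ℂ (X →L[ℂ] X) z - A) y = (z - ν) • y - (A y - ν • y) := by
      rw [Algebra.algebraMap_eq_smul_one]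
      simp [sub_smul]
    rw [h2, smul_sub, smul_smul, pow_succ, mul_assoc, hc1, mul_one]
  have hsum : (algebraMap ℂ (X →L[ℂ] X) z - A)
      (∑ i ∈ Finset.range N, (c ^ (i + 1)) • ((A - ν • 1) ^ i) x) = x := by
    rw [map_sum, Finset.sum_congr rfl fun i _ => hstep i, Finset.sum_range_sub', hx]
    simp
  have h3 : resolvent A z * (algebraMap ℂ (X →L[ℂ] X) z - A) = 1 := Ring.inverse_mul_cancel _ hu
  have h4 := congrArg (fun B : X →L[ℂ] X => B (∑ i ∈ Finset.range N,
    (c ^ (i + 1)) • ((A - ν • 1) ^ i) x)) h3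
  simp only [mul_apply_eq_comp, one_apply_eq_self] at h4
  rw [hsum] at h4
  exact h4

theorem continuousOn_resolvent (A : X →L[ℂ] X) {s : Set ℂ} (h : ∀ z ∈ s, z ∉ spectrum ℂ A) :
    ContinuousOn (resolvent A) s := fun z hz =>
  (spectrum.hasDerivAt_resolvent_const_left (a := A)
    (spectrum.mem_resolventSet_iff.2
      (spectrum.notMem_iff.1 (h z hz)))).continuousAt.continuousWithinAt

theorem sub_mul_resolvent (A : X →L[ℂ] X) {z : ℂ} (hz : z ∉ spectrum ℂ A) :
    (algebraMap ℂ (X →L[ℂ] X) z - A) * resolvent A z = 1 :=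
  Ring.mul_inverse_cancel _ (spectrum.notMem_iff.1 hz)

theorem resolvent_mul_sub (A : X →L[ℂ] X) {z : ℂ} (hz : z ∉ spectrum ℂ A) :
    resolvent A z * (algebraMap ℂ (X →L[ℂ] X) z - A) = 1 :=
  Ring.inverse_mul_cancel _ (spectrum.notMem_iff.1 hz)

theorem resolvent_comm (A : X →L[ℂ] X) {z : ℂ} (hz : z ∉ spectrum ℂ A) :
    A * resolvent A z = resolvent A z * A := by
  have h1 := sub_mul_resolvent A hz
  rw [← resolvent_mul_sub A hz, sub_mul, mul_sub, Algebra.commutes] at h1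
  exact sub_right_injective h1

/-- The contour integral `(2πi)⁻¹ ∮ g(z) (z - A)⁻¹ dz`. -/
noncomputable def contourCalc (A : X →L[ℂ] X) (μ : ℂ) (r : ℝ) (g : ℂ → ℂ) : X →L[ℂ] X :=
  (2 * Real.pi * Complex.I)⁻¹ • ∮ z in C(μ, r), g z • resolvent A z

theorem rieszProjection_eq_contourCalc (A : X →L[ℂ] X) (μ : ℂ) (r : ℝ) :
    rieszProjection A μ r = contourCalc A μ r fun _ => 1 := by
  simp [rieszProjection, contourCalc]

section Contour

variable (A : X →L[ℂ] X) {μ : ℂ} {r : ℝ} (hr : 0 ≤ r)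
  (hA : ∀ z ∈ Metric.sphere μ r, z ∉ spectrum ℂ A)

include hr hA in
theorem circleIntegrable_smul_resolvent {g : ℂ → ℂ} (hg : ContinuousOn g (Metric.sphere μ r)) :
    CircleIntegrable (fun z => g z • resolvent A z) μ r :=
  (hg.smul (continuousOn_resolvent A hA)).circleIntegrable hr

include hr hA in
theorem contourCalc_apply {g : ℂ → ℂ} (hg : ContinuousOn g (Metric.sphere μ r)) (x : X) :
    contourCalc A μ r g x =
      (2 * Real.pi * Complex.I : ℂ)⁻¹ • ∮ z in C(μ, r), g z • resolvent A z x := by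
  rw [contourCalc, smul_apply]
  congr 1
  exact clm_circleIntegral (ContinuousLinearMap.apply ℂ X x)
    (circleIntegrable_smul_resolvent A hr hA hg)

include hr hA in
theorem contourCalc_comm {g : ℂ → ℂ} (hg : ContinuousOn g (Metric.sphere μ r)) :
    A * contourCalc A μ r g = contourCalc A μ r g * A := by
  have hi := circleIntegrable_smul_resolvent A hr hA hg
  have h1 := clm_circleIntegral (ContinuousLinearMap.mul ℂ (X →L[ℂ] X) A) hi
  have h2 := clm_circleIntegral ((ContinuousLinearMap.mul ℂ (X →L[ℂ] X)).flip A) hi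
  simp only [ContinuousLinearMap.mul_apply', ContinuousLinearMap.flip_apply] at h1 h2
  rw [contourCalc, mul_smul_comm, smul_mul_assoc, h1, h2]
  congr 1
  refine circleIntegral.integral_congr hr fun z hz => ?_
  simp only [mul_smul_comm, smul_mul_assoc, resolvent_comm A (hA z hz)]

include hr hA in
theorem rieszProjection_eq_mul (h0 : (0 : ℂ) ∉ Metric.closedBall μ r) :
    rieszProjection A μ r = A * contourCalc A μ r fun z => z⁻¹ := by
  have hne : ∀ z ∈ Metric.closedBall μ r, z ≠ 0 := fun z hz h => h0 (h ▸ hz)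
  have hinv : ContinuousOn (fun z : ℂ => z⁻¹) (Metric.closedBall μ r) :=
    continuousOn_id.inv₀ hne
  have hinvs := hinv.mono Metric.sphere_subset_closedBall
  have hi := circleIntegrable_smul_resolvent A hr hA hinvs
  have h1 := clm_circleIntegral (ContinuousLinearMap.mul ℂ (X →L[ℂ] X) A) hi
  simp only [ContinuousLinearMap.mul_apply'] at h1
  rw [contourCalc, mul_smul_comm, rieszProjection, h1]
  congr 1
  have h2 : ∮ z in C(μ, r), z⁻¹ • (1 : X →L[ℂ] X) = 0 := by
    refine Complex.circleIntegral_eq_zero_of_differentiable_on_off_countable hr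
      (s := ∅) Set.countable_empty (hinv.smul continuousOn_const) ?_
    intro z hz
    exact (differentiableAt_inv
      (hne z (Metric.ball_subset_closedBall hz.1))).smul_const _
  rw [← sub_zero (∮ z in C(μ, r), resolvent A z), ← h2, ← circleIntegral.integral_sub]
  · refine circleIntegral.integral_congr hr fun z hz => ?_
    have hz0 := hne z (Metric.sphere_subset_closedBall hz)
    have h3 := sub_mul_resolvent A (hA z hz)
    rw [sub_mul, ← Algebra.smul_def] at h3
    simp only [mul_smul_comm]
    rw [← h3, smul_sub, smul_smul, inv_mul_cancel₀ hz0, one_smul]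
    abel
  · exact (continuousOn_resolvent A hA).circleIntegrable hr
  · exact (hinvs.smul continuousOn_const).circleIntegrable hr

include hr hA in
theorem contourCalc_apply_eq_zero {g : ℂ → ℂ} (hg : ContinuousOn g (Metric.closedBall μ r))
    (hgd : ∀ z ∈ Metric.ball μ r, DifferentiableAt ℂ g z) {ν : ℂ}
    (hν : ν ∉ Metric.closedBall μ r) {N : ℕ} {x : X} (hx : ((A - ν • 1) ^ N) x = 0) :
    contourCalc A μ r g x = 0 := by
  rw [contourCalc_apply A hr hA (hg.mono Metric.sphere_subset_closedBall)]
  have hne : ∀ z ∈ Metric.closedBall μ r, z - ν ≠ 0 := fun z hz h =>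
    hν (sub_eq_zero.1 h ▸ hz)
  have h1 : ∮ z in C(μ, r), g z • resolvent A z x = ∮ z in C(μ, r),
      g z • ∑ i ∈ Finset.range N, ((z - ν)⁻¹ ^ (i + 1)) • ((A - ν • 1) ^ i) x := by
    refine circleIntegral.integral_congr hr fun z hz => ?_
    rw [resolvent_apply_of_pow_eq_zero A (hA z hz)
      (sub_ne_zero.1 (hne z (Metric.sphere_subset_closedBall hz))) hx]
  rw [h1, Complex.circleIntegral_eq_zero_of_differentiable_on_off_countable hr
      (s := ∅) Set.countable_empty, smul_zero]
  · refine hg.smul (continuousOn_finsetSum _ fun i _ => ?_)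
    exact (((continuousOn_id.sub continuousOn_const).inv₀ hne).pow _).smul continuousOn_const
  · intro z hz
    refine (hgd z hz.1).smul (DifferentiableAt.fun_sum fun i _ => ?_)
    have hd : DifferentiableAt ℂ (fun w : ℂ => (w - ν)⁻¹) z :=
      DifferentiableAt.fun_inv (by fun_prop) (hne z (Metric.ball_subset_closedBall hz.1))
    exact (hd.fun_pow _).smul_const _

include hr hA in
theorem rieszProjection_apply_eq_self {ν : ℂ} (hν : ν ∈ Metric.ball μ r) {N : ℕ} {x : X}
    (hx : ((A - ν • 1) ^ N) x = 0) : rieszProjection A μ r x = x := by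
  rw [rieszProjection_eq_contourCalc, contourCalc_apply A hr hA continuousOn_const]
  have hne : ∀ z ∈ Metric.sphere μ r, z - ν ≠ 0 := by
    intro z hz h
    rw [sub_eq_zero] at h
    rw [← h, Metric.mem_ball, Metric.mem_sphere.1 hz] at hν
    exact lt_irrefl _ hν
  rcases Nat.eq_zero_or_pos N with rfl | hN
  · have : x = 0 := by simpa using hx
    simp [this, circleIntegral]
  have h1 : ∮ z in C(μ, r), (1 : ℂ) • resolvent A z x = ∮ z in C(μ, r),
      ∑ i ∈ Finset.range N, ((z - ν) ^ (-(i + 1 : ℕ) : ℤ)) • ((A - ν • 1) ^ i) x := by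
    refine circleIntegral.integral_congr hr fun z hz => ?_
    simp only [one_smul]
    rw [resolvent_apply_of_pow_eq_zero A (hA z hz) (sub_ne_zero.1 (hne z hz)) hx]
    refine Finset.sum_congr rfl fun i _ => ?_
    rw [zpow_neg, zpow_natCast, inv_pow]
  rw [h1, circleIntegral.integral_fun_sum, Finset.sum_eq_single_of_mem 0 (by simpa using hN)]
  · rw [circleIntegral.integral_smul_const]
    simp only [zero_add, Nat.cast_one, zpow_neg, zpow_one, pow_zero,
      one_apply_eq_self]
    rw [circleIntegral.integral_sub_inv_of_mem_ball hν, smul_smul, inv_mul_cancel₀, one_smul]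
    exact Complex.two_pi_I_ne_zero
  · intro i _ hi
    rw [circleIntegral.integral_smul_const, circleIntegral.integral_sub_zpow_of_ne, zero_smul]
    omega
  · intro i _
    refine ContinuousOn.circleIntegrable hr (ContinuousOn.smul ?_ continuousOn_const)
    intro z hz
    have hc : ContinuousAt (fun w : ℂ => w - ν) z := by fun_prop
    exact (hc.zpow₀ _ (Or.inl (hne z hz))).continuousWithinAt

end Contour

theorem finrank_biSup_eq_sum {V : Type*} [AddCommGroup V] [Module ℂ V] [FiniteDimensional ℂ V]
    {ι : Type*} {E : ι → Submodule ℂ V} (h : iSupIndep E) (s : Finset ι) :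
    Module.finrank ℂ (⨆ i ∈ s, E i : Submodule ℂ V) = ∑ i ∈ s, Module.finrank ℂ (E i) := by
  classical
  induction s using Finset.induction_on with
  | empty => simp
  | insert a s ha ih =>
    rw [Finset.sum_insert ha, Finset.iSup_insert, ← ih]
    have hd : Disjoint (E a) (⨆ i ∈ s, E i) := h.disjoint_biSup (y := (s : Set ι)) (by simpa using ha)
    have := Submodule.finrank_sup_add_finrank_inf_eq (E a) (⨆ i ∈ s, E i)
    rw [hd.eq_bot, finrank_bot, add_zero] at this
    exact this

theorem coe_pow_restrictOf_sub (A : X →L[ℂ] X) (V : Submodule ℂ X)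
    (h : LinearMap.range (A : X →ₗ[ℂ] X) ≤ V) (ν : ℂ) (N : ℕ) (y : V) :
    (((restrictOf A V h - ν • 1) ^ N) y : V) = ((A - ν • 1) ^ N) (y : X) := by
  induction N generalizing y with
  | zero => simp
  | succ N ih =>
    rw [pow_succ, pow_succ, Module.End.mul_apply, ih]
    rfl

theorem contourCalc_inv_rieszProjection (A : X →L[ℂ] X) {μ : ℂ} {r : ℝ} (hr : 0 ≤ r)
    (hA : ∀ z ∈ Metric.sphere μ r, z ∉ spectrum ℂ A) (h0 : (0 : ℂ) ∉ Metric.closedBall μ r)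
    {ν : ℂ} {N : ℕ} {y : X} (hy : ((A - ν • 1) ^ N) y = 0) :
    contourCalc A μ r (fun z => z⁻¹) (rieszProjection A μ r y) =
      contourCalc A μ r (fun z => z⁻¹) y := by
  rcases lt_trichotomy (dist ν μ) r with h | h | h
  · rw [rieszProjection_apply_eq_self A hr hA h hy]
  · have hu : IsUnit ((A - ν • 1) ^ N) := by
      refine IsUnit.pow _ ?_
      rw [← IsUnit.neg_iff, neg_sub, ← Algebra.algebraMap_eq_smul_one]
      exact spectrum.notMem_iff.1 (hA ν h)
    have hy0 : y = 0 :=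
      (injective_iff_map_eq_zero _).1 (ContinuousLinearMap.isUnit_iff_bijective.1 hu).1 y hy
    simp [hy0]
  · have hν : ν ∉ Metric.closedBall μ r := by simpa using h
    have hne : ∀ z ∈ Metric.closedBall μ r, z ≠ 0 := fun z hz h => h0 (h ▸ hz)
    rw [rieszProjection_eq_contourCalc, contourCalc_apply_eq_zero A hr hA continuousOn_const
      (fun z _ => differentiableAt_const _) hν hy, map_zero,
      contourCalc_apply_eq_zero A hr hA (g := fun z => z⁻¹) (continuousOn_id.inv₀ hne)
      (fun z hz => differentiableAt_inv (hne z (Metric.ball_subset_closedBall hz))) hν hy]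

theorem exists_pow_eq_zero_induction (A : X →L[ℂ] X) (hA : IsFiniteRank A) {M : X → Prop}
    (h0 : M 0) (hadd : ∀ x y, M x → M y → M (x + y))
    (hgen : ∀ (ν : ℂ) (N : ℕ) (y : X), ((A - ν • 1) ^ N) y = 0 → M y) (x : X) : M (A x) := by
  have : FiniteDimensional ℂ (LinearMap.range (A : X →ₗ[ℂ] X)) := hA
  set V := LinearMap.range (A : X →ₗ[ℂ] X) with hV
  suffices h : ∀ y : V, M y from h ⟨A x, LinearMap.mem_range_self _ x⟩
  intro y
  have hy : y ∈ ⨆ ν, (restrictOf A V le_rfl).maxGenEigenspace ν := by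
    rw [Module.End.iSup_maxGenEigenspace_eq_top]; trivial
  induction hy using Submodule.iSup_induction' with
  | mem ν y hy =>
    obtain ⟨N, hN⟩ := (Module.End.mem_maxGenEigenspace _ _ _).1 hy
    refine hgen ν N y ?_
    rw [← coe_pow_restrictOf_sub A V le_rfl, hN]; rfl
  | zero => simpa using h0
  | add y z _ _ hy hz => simpa using hadd _ _ hy hz

theorem rieszProjection_idempotent (A : X →L[ℂ] X) (hAf : IsFiniteRank A) {μ : ℂ} {r : ℝ}
    (hr : 0 ≤ r) (hA : ∀ z ∈ Metric.sphere μ r, z ∉ spectrum ℂ A)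
    (h0 : (0 : ℂ) ∉ Metric.closedBall μ r) (x : X) :
    rieszProjection A μ r (rieszProjection A μ r x) = rieszProjection A μ r x := by
  set P := rieszProjection A μ r with hP
  set Q := contourCalc A μ r (fun z => z⁻¹) with hQ
  have hne : ∀ z ∈ Metric.closedBall μ r, z ≠ 0 := fun z hz h => h0 (h ▸ hz)
  have hinvs : ContinuousOn (fun z : ℂ => z⁻¹) (Metric.sphere μ r) :=
    (continuousOn_id.inv₀ hne).mono Metric.sphere_subset_closedBall
  have hPQ : P = Q * A := by
    rw [hP, rieszProjection_eq_mul A hr hA h0, contourCalc_comm A hr hA hinvs]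
  have hAP : A * P = P * A := by
    rw [hP, rieszProjection_eq_contourCalc]
    exact contourCalc_comm A hr hA continuousOn_const
  have hPx : ∀ x, P x = Q (A x) := fun x => by rw [hPQ]; rfl
  have hAPx : ∀ x, A (P x) = P (A x) := fun x => congrArg (fun B : X →L[ℂ] X => B x) hAP
  have key : Q (P (A x)) = Q (A x) := by
    refine exists_pow_eq_zero_induction A hAf (M := fun y => Q (P y) = Q y) ?_ ?_ ?_ x
    · simp
    · intro x y hx hy
      simp only [map_add, hx, hy]
    · intro ν N y hy
      exact contourCalc_inv_rieszProjection A hr hA h0 hy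
  rw [hPx (P x), hAPx, key, ← hPx]

theorem finiteDimensional_range_of_norm_sub_lt {P P' : X →L[ℂ] X} (hP : ∀ x, P (P x) = P x)
    (hP' : IsFiniteRank P') (h : ‖P - P'‖ < 1) : IsFiniteRank P := by
  have : FiniteDimensional ℂ (LinearMap.range (P' : X →ₗ[ℂ] X)) := hP'
  let φ : LinearMap.range (P : X →ₗ[ℂ] X) →ₗ[ℂ] LinearMap.range (P' : X →ₗ[ℂ] X) :=
    (P' : X →ₗ[ℂ] X).rangeRestrict.comp (Submodule.subtype _)
  refine FiniteDimensional.of_injective φ ((injective_iff_map_eq_zero _).2 ?_)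
  rintro ⟨_, x, rfl⟩ hx
  have hx1 : P' (P x) = 0 := congrArg Subtype.val hx
  apply Subtype.ext
  change P x = 0
  by_contra hne
  have h1 : ‖(P - P') (P x)‖ ≤ ‖P - P'‖ * ‖P x‖ := ContinuousLinearMap.le_opNorm _ _
  have h2 : (P - P') (P x) = P x := by simp [hP, hx1]
  rw [h2] at h1
  nlinarith [norm_pos_iff.2 hne]

theorem eventually_sphere_notMem_spectrum (T : X →L[ℂ] X) {μ : ℂ} {r : ℝ}
    (hT : ∀ z ∈ Metric.sphere μ r, z ∉ spectrum ℂ T) {ε : ℝ} (hε : 0 < ε) :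
    ∀ᶠ S in nhds T, ∀ z ∈ Metric.sphere μ r,
      z ∉ spectrum ℂ S ∧ ‖resolvent S z - resolvent T z‖ < ε := by
  refine (isCompact_sphere μ r).eventually_forall_of_forall_eventually fun z hz => ?_
  have hu : IsUnit (algebraMap ℂ (X →L[ℂ] X) z - T) := spectrum.notMem_iff.1 (hT z hz)
  have hc : Continuous fun q : (X →L[ℂ] X) × ℂ => algebraMap ℂ (X →L[ℂ] X) q.2 - q.1 := by
    fun_prop
  have h1 : ∀ᶠ q : (X →L[ℂ] X) × ℂ in nhds (T, z), IsUnit (algebraMap ℂ (X →L[ℂ] X) q.2 - q.1) :=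
    hc.continuousAt.eventually (Units.isOpen.mem_nhds hu)
  have hres : ContinuousAt (fun q : (X →L[ℂ] X) × ℂ => resolvent q.1 q.2) (T, z) := by
    obtain ⟨u, hu1⟩ := hu
    have h2 := NormedRing.inverse_continuousAt u
    rw [hu1] at h2
    exact ContinuousAt.comp (f := fun q : (X →L[ℂ] X) × ℂ => algebraMap ℂ (X →L[ℂ] X) q.2 - q.1)
      (x := (T, z)) h2 hc.continuousAt
  have hres2 : ContinuousAt (fun q : (X →L[ℂ] X) × ℂ => resolvent T q.2) (T, z) := by
    obtain ⟨u, hu1⟩ := hu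
    have h2 := NormedRing.inverse_continuousAt u
    rw [hu1] at h2
    exact ContinuousAt.comp (f := fun q : (X →L[ℂ] X) × ℂ => algebraMap ℂ (X →L[ℂ] X) q.2 - T)
      (x := (T, z)) h2 (by fun_prop)
  have h3 := (hres.sub hres2).norm
  have h4 := h3.eventually_lt continuousAt_const (by simpa using hε)
  filter_upwards [h1, h4] with q hq1 hq2
  exact ⟨spectrum.notMem_iff.2 hq1, hq2⟩

theorem eventually_norm_rieszProjection_sub_lt (T : X →L[ℂ] X) {μ : ℂ} {r : ℝ} (hr : 0 ≤ r)
    (hT : ∀ z ∈ Metric.sphere μ r, z ∉ spectrum ℂ T) {ε : ℝ} (hε : 0 < ε) :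
    ∀ᶠ S in nhds T, (∀ z ∈ Metric.sphere μ r, z ∉ spectrum ℂ S) ∧
      ‖rieszProjection S μ r - rieszProjection T μ r‖ < ε := by
  have hε' : 0 < ε / (r + 1) := by positivity
  filter_upwards [eventually_sphere_notMem_spectrum T hT hε'] with S hS
  refine ⟨fun z hz => (hS z hz).1, ?_⟩
  rw [rieszProjection, rieszProjection, ← smul_sub, ← circleIntegral.integral_sub]
  · refine (circleIntegral.norm_two_pi_i_inv_smul_integral_le_of_norm_le_const hr
      (C := ε / (r + 1)) fun z hz => (hS z hz).2.le).trans_lt ?_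
    rw [mul_div_assoc', div_lt_iff₀ (by positivity)]
    nlinarith
  · exact (continuousOn_resolvent S fun z hz => (hS z hz).1).circleIntegrable hr
  · exact (continuousOn_resolvent T hT).circleIntegrable hr

open Filter Topology in
theorem isFiniteRank_rieszProjection {T : X →L[ℂ] X} {F : ℕ → X →L[ℂ] X}
    (hF : ∀ n, IsFiniteRank (F n)) (hlim : Tendsto F atTop (𝓝 T)) {μ : ℂ} {r : ℝ} (hr : 0 < r)
    (hμ : μ ≠ 0) (hT : ∀ z ∈ Metric.closedBall μ r, z ≠ μ → z ∉ spectrum ℂ T) :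
    IsFiniteRank (rieszProjection T μ r) := by
  have hTs : ∀ z ∈ Metric.sphere μ r, z ∉ spectrum ℂ T := fun z hz =>
    hT z (Metric.sphere_subset_closedBall hz) (Metric.ne_of_mem_sphere hz hr.ne')
  by_cases h0 : (0 : ℂ) ∈ Metric.closedBall μ r
  · have hu : IsUnit T := by
      have := spectrum.notMem_iff.1 (hT 0 h0 hμ.symm)
      simpa using this
    obtain ⟨n, hn⟩ := (hlim.eventually (Units.isOpen.mem_nhds hu)).exists
    have hs := (ContinuousLinearMap.isUnit_iff_bijective.1 hn).2
    have hfin : FiniteDimensional ℂ X := by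
      have h1 : FiniteDimensional ℂ (LinearMap.range (F n : X →ₗ[ℂ] X)) := hF n
      rw [LinearMap.range_eq_top.2 hs] at h1
      exact Module.Finite.equiv Submodule.topEquiv
    unfold IsFiniteRank
    infer_instance
  · have hconv : ∀ ε > 0, ∀ᶠ n in atTop, (∀ z ∈ Metric.sphere μ r, z ∉ spectrum ℂ (F n)) ∧
        ‖rieszProjection (F n) μ r - rieszProjection T μ r‖ < ε := fun ε hε =>
      hlim.eventually (eventually_norm_rieszProjection_sub_lt T hr.le hTs hε)
    have hPlim : Tendsto (fun n => rieszProjection (F n) μ r) atTop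
        (𝓝 (rieszProjection T μ r)) := by
      rw [Metric.tendsto_atTop']
      intro ε hε
      obtain ⟨N, hN⟩ := eventually_atTop.1 (hconv ε hε)
      exact ⟨N, fun n hn => by rw [dist_eq_norm]; exact (hN n hn.le).2⟩
    have hidem : rieszProjection T μ r * rieszProjection T μ r = rieszProjection T μ r := by
      refine tendsto_nhds_unique (hPlim.mul hPlim) (hPlim.congr' ?_)
      filter_upwards [hconv 1 one_pos] with n hn
      ext x
      exact (rieszProjection_idempotent (F n) (hF n) hr.le hn.1 h0 x).symm
    obtain ⟨n, hn1, hn2⟩ := (hconv 1 one_pos).exists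
    refine finiteDimensional_range_of_norm_sub_lt (P' := rieszProjection (F n) μ r)
      (fun x => congrArg (fun B : X →L[ℂ] X => B x) hidem) ?_ (by rwa [norm_sub_rev])
    have h1 : FiniteDimensional ℂ (LinearMap.range (F n : X →ₗ[ℂ] X)) := hF n
    refine Submodule.finiteDimensional_of_le (S₂ := LinearMap.range (F n : X →ₗ[ℂ] X)) ?_
    rw [rieszProjection_eq_mul (F n) hr.le hn1 h0]
    rintro _ ⟨x, rfl⟩
    exact LinearMap.mem_range_self _ _

open Classical in
theorem card_filter_le_finrank_rieszProjection {T F : X →L[ℂ] X} (hF : IsFiniteRank F) {μ : ℂ}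
    {r : ℝ} (hr : 0 ≤ r) (hFs : ∀ z ∈ Metric.sphere μ r, z ∉ spectrum ℂ F)
    (hT : IsFiniteRank (rieszProjection T μ r))
    (hTF : ‖rieszProjection F μ r - rieszProjection T μ r‖ < 1) :
    ((eigRoots F hF).filter (· ∈ Metric.ball μ r)).card ≤
      Module.finrank ℂ (LinearMap.range (rieszProjection T μ r : X →ₗ[ℂ] X)) := by
  have : FiniteDimensional ℂ (LinearMap.range (rieszProjection T μ r : X →ₗ[ℂ] X)) := hT
  have : FiniteDimensional ℂ (LinearMap.range (F : X →ₗ[ℂ] X)) := hF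
  set V := LinearMap.range (F : X →ₗ[ℂ] X) with hV
  set f := restrictOf F V le_rfl with hf
  have heig : eigRoots F hF = f.charpoly.roots := rfl
  set s := (f.charpoly.roots.filter (· ∈ Metric.ball μ r)).toFinset with hs
  have hcard : ((eigRoots F hF).filter (· ∈ Metric.ball μ r)).card =
      Module.finrank ℂ (⨆ ν ∈ s, f.maxGenEigenspace ν : Submodule ℂ V) := by
    rw [finrank_biSup_eq_sum (Module.End.independent_maxGenEigenspace f), heig,
      ← Multiset.toFinset_sum_count_eq]
    refine Finset.sum_congr rfl fun ν hν => ?_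
    rw [LinearMap.finrank_maxGenEigenspace_eq, ← Polynomial.count_roots,
      Multiset.count_filter_of_pos]
    rw [hs, Multiset.mem_toFinset, Multiset.mem_filter] at hν
    exact hν.2
  rw [hcard]
  have hid : ∀ y ∈ (⨆ ν ∈ s, f.maxGenEigenspace ν : Submodule ℂ V),
      rieszProjection F μ r (y : X) = y := by
    intro y hy
    have hle : (⨆ ν ∈ s, f.maxGenEigenspace ν : Submodule ℂ V) ≤
        (LinearMap.ker ((rieszProjection F μ r - 1 : X →L[ℂ] X) : X →ₗ[ℂ] X)).comap V.subtype := by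
      refine iSup₂_le fun ν hν y hy => ?_
      rw [hs, Multiset.mem_toFinset, Multiset.mem_filter] at hν
      obtain ⟨N, hN⟩ := (Module.End.mem_maxGenEigenspace _ _ _).1 hy
      have h1 : ((F - ν • 1) ^ N) (y : X) = 0 := by
        rw [← coe_pow_restrictOf_sub F V le_rfl, ← hf, hN]; rfl
      have h2 := rieszProjection_apply_eq_self F hr hFs hν.2 h1
      simpa [sub_eq_zero] using h2
    have := hle hy
    simpa [sub_eq_zero] using this
  let φ : (⨆ ν ∈ s, f.maxGenEigenspace ν : Submodule ℂ V) →ₗ[ℂ]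
      LinearMap.range (rieszProjection T μ r : X →ₗ[ℂ] X) :=
    (rieszProjection T μ r : X →ₗ[ℂ] X).rangeRestrict.comp
      (V.subtype.comp (Submodule.subtype _))
  refine LinearMap.finrank_le_finrank_of_injective (f := φ) ((injective_iff_map_eq_zero _).2 ?_)
  rintro ⟨y, hy⟩ hy0
  have hy1 : rieszProjection T μ r (y : X) = 0 := congrArg Subtype.val hy0
  have hy2 := hid y hy
  apply Subtype.ext
  apply Subtype.ext
  change (y : X) = 0
  by_contra hne
  have h1 := (rieszProjection F μ r - rieszProjection T μ r).le_opNorm (y : X)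
  rw [sub_apply, hy1, hy2, sub_zero] at h1
  nlinarith [norm_pos_iff.2 hne]

theorem rieszProjection_eq_zero {T : X →L[ℂ] X} {μ : ℂ} {r : ℝ} (hr : 0 ≤ r)
    (h : ∀ z ∈ Metric.closedBall μ r, z ∉ spectrum ℂ T) : rieszProjection T μ r = 0 := by
  rw [rieszProjection, Complex.circleIntegral_eq_zero_of_differentiable_on_off_countable hr
    Set.countable_empty (continuousOn_resolvent T h), smul_zero]
  intro z hz
  exact (spectrum.hasDerivAt_resolvent_const_left (spectrum.mem_resolventSet_iff.2
    (spectrum.notMem_iff.1 (h z (Metric.ball_subset_closedBall hz.1))))).differentiableAt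

open Classical Filter Topology in
/-- If at least `m ≥ 1` eigenvalues of finite rank operators `F n → T` accumulate at `μ ≠ 0`,
then `μ` is a discrete eigenvalue of `T` of algebraic multiplicity at least `m`. -/
theorem isDiscreteEigenvalue_of_tendsto {T : X →L[ℂ] X} {F : ℕ → X →L[ℂ] X}
    (hF : ∀ n, IsFiniteRank (F n)) (hlim : Tendsto F atTop (𝓝 T)) {μ : ℂ} (hμ : μ ≠ 0) {m : ℕ}
    (hm : 1 ≤ m) (hcount : ∀ r > 0, ∀ᶠ n in atTop,
      m ≤ ((eigRoots (F n) (hF n)).filter (· ∈ Metric.ball μ r)).card) :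
    IsDiscreteEigenvalue T μ ∧ m ≤ algebraicMultiplicity T μ := by
  have hiso : ∃ r, 0 < r ∧ ∀ z ∈ Metric.closedBall μ r, z ≠ μ → z ∉ spectrum ℂ T := by
    obtain ⟨n, hn⟩ := (Metric.tendsto_nhds.1 hlim (‖μ‖ / 2) (by positivity)).exists
    rw [dist_comm, dist_eq_norm] at hn
    exact exists_isolating_radius T (F n) (hF n) hn
  have key : ∀ r, 0 < r → (∀ z ∈ Metric.closedBall μ r, z ≠ μ → z ∉ spectrum ℂ T) →
      IsFiniteRank (rieszProjection T μ r) ∧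
      m ≤ Module.finrank ℂ (LinearMap.range (rieszProjection T μ r : X →ₗ[ℂ] X)) := by
    intro r hr hr1
    have hfr := isFiniteRank_rieszProjection hF hlim hr hμ hr1
    refine ⟨hfr, ?_⟩
    have hTs : ∀ z ∈ Metric.sphere μ r, z ∉ spectrum ℂ T := fun z hz =>
      hr1 z (Metric.sphere_subset_closedBall hz) (Metric.ne_of_mem_sphere hz hr.ne')
    obtain ⟨n, hn1, hn2, hn3⟩ := ((hcount r hr).and (hlim.eventually
      (eventually_norm_rieszProjection_sub_lt T hr.le hTs one_pos))).exists
    exact hn1.trans (card_filter_le_finrank_rieszProjection (hF n) hr.le hn2 hfr hn3)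
  obtain ⟨r, hr, hr1⟩ := hiso
  refine ⟨⟨?_, r, hr, hr1, (key r hr hr1).1⟩, ?_⟩
  · by_contra hμs
    have h0 := rieszProjection_eq_zero (T := T) (μ := μ) hr.le fun z hz => by
      by_cases hzμ : z = μ
      · rwa [hzμ]
      · exact hr1 z hz hzμ
    have h1 := (key r hr hr1).2
    rw [h0] at h1
    have h2 : LinearMap.range ((0 : X →L[ℂ] X) : X →ₗ[ℂ] X) = ⊥ := LinearMap.range_zero
    rw [h2, finrank_bot] at h1
    omega
  · have hex : ∃ r, 0 < r ∧ ∀ z ∈ Metric.closedBall μ r, z ≠ μ → z ∉ spectrum ℂ T := ⟨r, hr, hr1⟩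
    rw [algebraicMultiplicity, dif_pos hex]
    exact (key _ hex.choose_spec.1 hex.choose_spec.2).2

/-- `a` lists the multiset `s`, followed by zeros. -/
structure Enumerates (a : ℕ → ℂ) (s : Multiset ℂ) : Prop where
  eq_map : s = (Multiset.range s.card).map a
  eq_zero : ∀ j, s.card ≤ j → a j = 0

open Classical Filter Topology in
theorem sum_ofReal_rpow_le_eigSum {T : X →L[ℂ] X} {F : ℕ → X →L[ℂ] X}
    (hF : ∀ n, IsFiniteRank (F n)) (hlim : Tendsto F atTop (𝓝 T)) {p : ℝ} (hp : 0 < p)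
    {a : ℕ → ℕ → ℂ} (ha : ∀ n, Enumerates (a n) (eigRoots (F n) (hF n))) {b : ℕ → ℂ}
    (hab : ∀ j, Tendsto (fun n => a n j) atTop (𝓝 (b j))) (J : Finset ℕ) :
    ∑ j ∈ J, ENNReal.ofReal (‖b j‖ ^ p) ≤ eigSum p T := by
  set J' := J.filter (fun j => b j ≠ 0) with hJ'
  have h1 : ∑ j ∈ J, ENNReal.ofReal (‖b j‖ ^ p) = ∑ j ∈ J', ENNReal.ofReal (‖b j‖ ^ p) := by
    rw [hJ', Finset.sum_filter]
    refine Finset.sum_congr rfl fun j _ => ?_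
    split_ifs with h
    · rfl
    · rw [not_not.1 h]; simp [Real.zero_rpow hp.ne']
  have key : ∀ μ ∈ J'.image b, IsDiscreteEigenvalue T μ ∧
      (J'.filter (fun j => b j = μ)).card ≤ algebraicMultiplicity T μ := by
    intro μ hμ
    obtain ⟨j₀, hj₀, rfl⟩ := Finset.mem_image.1 hμ
    have hμ0 : b j₀ ≠ 0 := (Finset.mem_filter.1 hj₀).2
    refine isDiscreteEigenvalue_of_tendsto hF hlim hμ0 ?_ ?_
    · exact Finset.card_pos.2 ⟨j₀, Finset.mem_filter.2 ⟨hj₀, rfl⟩⟩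
    · intro r hr
      set fib := J'.filter (fun j => b j = b j₀) with hfib
      have hev : ∀ᶠ n in atTop, ∀ j ∈ fib, a n j ∈ Metric.ball (b j₀) (min r ‖b j₀‖) := by
        rw [eventually_all_finset]
        intro j hj
        have hj1 : b j = b j₀ := (Finset.mem_filter.1 hj).2
        have := (hab j).eventually (Metric.ball_mem_nhds (b j) (lt_min hr (norm_pos_iff.2 hμ0)))
        rwa [hj1] at this
      filter_upwards [hev] with n hn
      rw [(ha n).eq_map, Multiset.filter_map, Multiset.card_map]
      change fib.card ≤ ((Finset.range (eigRoots (F n) (hF n)).card).filter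
        (fun j => a n j ∈ Metric.ball (b j₀) r)).card
      refine Finset.card_le_card fun j hj => ?_
      have hj1 := hn j hj
      rw [Finset.mem_filter, Finset.mem_range]
      refine ⟨?_, Metric.ball_subset_ball (min_le_left _ _) hj1⟩
      by_contra hlt
      rw [(ha n).eq_zero j (not_lt.1 hlt), Metric.mem_ball, dist_zero_left] at hj1
      exact lt_irrefl _ (hj1.trans_le (min_le_right _ _))
  rw [h1, eigSum, ← Finset.sum_fiberwise_of_maps_to (g := b) (t := J'.image b)
    (fun j hj => Finset.mem_image_of_mem b hj)]
  have h2 : ∀ μ ∈ J'.image b, ∑ j ∈ J' with b j = μ, ENNReal.ofReal (‖b j‖ ^ p) ≤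
      (algebraicMultiplicity T μ : ℝ≥0∞) * ENNReal.ofReal (‖μ‖ ^ p) := by
    intro μ hμ
    have h3 : ∑ j ∈ J' with b j = μ, ENNReal.ofReal (‖b j‖ ^ p) =
        ∑ j ∈ J' with b j = μ, ENNReal.ofReal (‖μ‖ ^ p) := by
      refine Finset.sum_congr rfl fun j hj => ?_
      rw [(Finset.mem_filter.1 hj).2]
    rw [h3, Finset.sum_const, nsmul_eq_mul]
    gcongr
    exact (key μ hμ).2
  refine (Finset.sum_le_sum h2).trans ?_
  rw [← Finset.sum_subtype_of_mem (p := fun μ => IsDiscreteEigenvalue T μ)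
    (fun μ => (algebraicMultiplicity T μ : ℝ≥0∞) * ENNReal.ofReal (‖μ‖ ^ p))
    (fun μ hμ => (key μ hμ).1)]
  exact ENNReal.sum_le_tsum _

open Filter Topology in
theorem sum_rpow_le_of_eigSum_le {T : X →L[ℂ] X} {F : ℕ → X →L[ℂ] X}
    (hF : ∀ n, IsFiniteRank (F n)) (hlim : Tendsto F atTop (𝓝 T)) {p : ℝ} (hp : 0 < p)
    {a : ℕ → ℕ → ℂ} (ha : ∀ n, Enumerates (a n) (eigRoots (F n) (hF n))) {b : ℕ → ℂ}
    (hab : ∀ j, Tendsto (fun n => a n j) atTop (𝓝 (b j))) {B : ℝ} (hB : 0 ≤ B)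
    (hT : eigSum p T ≤ ENNReal.ofReal B) (J : Finset ℕ) : ∑ j ∈ J, ‖b j‖ ^ p ≤ B := by
  have h := (sum_ofReal_rpow_le_eigSum hF hlim hp ha hab J).trans hT
  rw [← ENNReal.ofReal_sum_of_nonneg fun j _ => by positivity] at h
  exact (ENNReal.ofReal_le_ofReal_iff hB).1 h

theorem sum_rpow_le_of_enumerates {F : X →L[ℂ] X} (hF : IsFiniteRank F) {p : ℝ} (hp : 0 < p)
    {a : ℕ → ℂ} (ha : Enumerates a (eigRoots F hF)) {B : ℝ} (hB : 0 ≤ B)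
    (hT : eigSum p F ≤ ENNReal.ofReal B) (J : Finset ℕ) : ∑ j ∈ J, ‖a j‖ ^ p ≤ B :=
  sum_rpow_le_of_eigSum_le (fun _ => hF) tendsto_const_nhds hp (fun _ => ha)
    (fun _ => tendsto_const_nhds) hB hT J

/-- A multiset of complex numbers can be listed by decreasing modulus. -/
theorem exists_enumerates_antitone (s : Multiset ℂ) :
    ∃ a : ℕ → ℂ, Enumerates a s ∧ Antitone fun j => ‖a j‖ := by
  classical
  let r : ℂ → ℂ → Prop := fun x y => ‖y‖ ≤ ‖x‖
  have : Std.Total r := ⟨fun x y => le_total _ _⟩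
  have : IsTrans ℂ r := ⟨fun x y z h1 h2 => le_trans h2 h1⟩
  obtain ⟨l, hl, hs⟩ : ∃ l : List ℂ, (l : Multiset ℂ) = s ∧ l.Pairwise r := by
    induction s using Quotient.inductionOn with
    | h l =>
      exact ⟨l.insertionSort r, Multiset.coe_eq_coe.2 (List.perm_insertionSort r l),
        List.pairwise_insertionSort r l⟩
  have hcard : s.card = l.length := by rw [← hl]; rfl
  refine ⟨fun j => l.getD j 0, ⟨?_, ?_⟩, ?_⟩
  · rw [hcard, ← hl]
    change (l : Multiset ℂ) = ((List.range l.length).map fun j => l.getD j 0 : List ℂ)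
    congr 1
    refine List.ext_getElem (by simp) fun i h1 h2 => ?_
    simp [h1]
  · intro j hj
    rw [hcard] at hj
    simp [hj]
  · intro i j hij
    simp only
    rcases lt_or_ge j l.length with hj | hj
    · rcases hij.eq_or_lt with rfl | hlt
      · exact le_rfl
      · have hi : i < l.length := hij.trans_lt hj
        rw [List.getD_eq_getElem _ _ hi, List.getD_eq_getElem _ _ hj]
        exact List.pairwise_iff_getElem.1 hs i j hi hj hlt
    · rw [List.getD_eq_default _ _ hj, norm_zero]
      exact norm_nonneg _

@[simp]
theorem elemFactor_zero (m : ℕ) : elemFactor m 0 = 1 := by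
  have : ∑ k ∈ Finset.Icc 1 m, (0 : ℂ) ^ k / (k : ℂ) = 0 := by
    refine Finset.sum_eq_zero fun k hk => ?_
    rw [zero_pow (by have := (Finset.mem_Icc.1 hk).1; omega), zero_div]
  simp [elemFactor, this]

theorem continuous_elemFactor (m : ℕ) : Continuous (elemFactor m) := by
  unfold elemFactor
  fun_prop

theorem norm_elemFactor_le_exp_sum (m : ℕ) (u : ℂ) :
    ‖elemFactor m u‖ ≤ Real.exp (Real.log (1 + ‖u‖) + ∑ k ∈ Finset.Icc 1 m, ‖u‖ ^ k) := by
  rw [elemFactor, norm_mul, Complex.norm_exp, Real.exp_add, Real.exp_log (by positivity)]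
  gcongr
  · simpa using norm_sub_le (1 : ℂ) u
  · refine (Complex.re_le_norm _).trans ((norm_sum_le _ _).trans (Finset.sum_le_sum fun k hk => ?_))
    rw [norm_div, norm_pow, Complex.norm_natCast]
    have : (1 : ℝ) ≤ k := by exact_mod_cast (Finset.mem_Icc.1 hk).1
    exact div_le_self (by positivity) this

theorem norm_elemFactor_le_of_small {m : ℕ} {u : ℂ} (hu : ‖u‖ ≤ 1 / 2) :
    ‖elemFactor m u‖ ≤
      Real.exp ((-(u ^ (m + 1) / ((m : ℂ) + 1))).re + ‖u‖ ^ (m + 2)) := by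
  have h1 : (1 - u) ≠ 0 := by
    intro h
    rw [sub_eq_zero.1 h |>.symm, norm_one] at hu
    norm_num at hu
  have h2 : elemFactor m u =
      Complex.exp (Complex.log (1 - u) + ∑ k ∈ Finset.Icc 1 m, u ^ k / (k : ℂ)) := by
    rw [elemFactor, Complex.exp_add, Complex.exp_log h1]
  have h3 := Complex.norm_log_sub_logTaylor_le (m + 1) (z := -u) (by rw [norm_neg]; linarith)
  have h4 : Complex.logTaylor (m + 1 + 1) (-u) =
      -∑ k ∈ Finset.Icc 1 m, u ^ k / (k : ℂ) - u ^ (m + 1) / ((m : ℂ) + 1) := by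
    have : ∀ n : ℕ, Complex.logTaylor (n + 1) (-u) = -∑ k ∈ Finset.Icc 1 n, u ^ k / (k : ℂ) := by
      intro n
      induction n with
      | zero => simp [Complex.logTaylor]
      | succ n ih =>
        rw [Complex.logTaylor_succ, Pi.add_apply, Finset.sum_Icc_succ_top (by omega), ih]
        have : (-1 : ℂ) ^ (n + 1 + 1) * (-u) ^ (n + 1) = -u ^ (n + 1) := by
          rw [neg_pow u, pow_succ (-1 : ℂ) (n + 1)]
          have : ((-1 : ℂ) ^ (n + 1)) * (-1) ^ (n + 1) = 1 := by
            rw [← mul_pow]; simp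
          linear_combination (-u ^ (n + 1)) * this
        rw [this]
        ring
    rw [this, Finset.sum_Icc_succ_top (by omega)]
    push_cast
    ring
  rw [h2, Complex.norm_exp]
  gcongr
  have h5 : ‖u‖ ^ (m + 1 + 1) * (1 - ‖u‖)⁻¹ / ((m + 1 : ℕ) + 1) ≤ ‖u‖ ^ (m + 2) := by
    have h6 : (1 - ‖u‖)⁻¹ ≤ 2 := by
      rw [inv_le_comm₀ (by linarith) (by norm_num)]; linarith
    rw [div_le_iff₀ (by positivity)]
    have h7 : (2 : ℝ) ≤ ((m + 1 : ℕ) : ℝ) + 1 := by push_cast; linarith [(m.cast_nonneg : (0 : ℝ) ≤ m)]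
    exact mul_le_mul_of_nonneg_left (h6.trans h7) (by positivity)
  rw [norm_neg] at h3
  have h8 := (Complex.re_le_norm _).trans (h3.trans h5)
  rw [h4, ← sub_eq_add_neg] at h8
  simp only [Complex.sub_re, Complex.neg_re, Complex.add_re] at h8 ⊢
  linarith

theorem pow_le_rpow_mul_rpow {x η p : ℝ} {n : ℕ} (hx : 0 ≤ x) (hxη : x ≤ η) (hp : 0 < p)
    (hpn : p ≤ n) : x ^ n ≤ x ^ p * η ^ ((n : ℝ) - p) := by
  rcases hx.eq_or_lt with rfl | hx0
  · have hn : n ≠ 0 := by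
      rintro rfl
      simp only [Nat.cast_zero] at hpn
      linarith
    rw [zero_pow hn, Real.zero_rpow hp.ne', zero_mul]
  · calc x ^ n = x ^ p * x ^ ((n : ℝ) - p) := by
          rw [← Real.rpow_add hx0, add_sub_cancel, Real.rpow_natCast]
      _ ≤ _ := by
          gcongr

theorem norm_le_of_antitone_of_sum_rpow_le {a : ℕ → ℂ} {p C : ℝ} (hp : 0 < p)
    (hanti : Antitone fun j => ‖a j‖) (haC : ∀ J : Finset ℕ, ∑ j ∈ J, ‖a j‖ ^ p ≤ C)
    {N j : ℕ} (hj : N ≤ j) : ‖a j‖ ≤ (C / ((N : ℝ) + 1)) ^ p⁻¹ := by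
  refine (hanti hj).trans ?_
  rw [Real.le_rpow_inv_iff_of_pos (norm_nonneg _) _ hp, le_div_iff₀ (by positivity)]
  · calc ‖a N‖ ^ p * ((N : ℝ) + 1) = ∑ j ∈ Finset.range (N + 1), ‖a N‖ ^ p := by
          rw [Finset.sum_const, Finset.card_range, nsmul_eq_mul]; push_cast; ring
      _ ≤ ∑ j ∈ Finset.range (N + 1), ‖a j‖ ^ p := by
          refine Finset.sum_le_sum fun j hj => ?_
          have := hanti (Nat.lt_succ_iff.1 (Finset.mem_range.1 hj))
          gcongr
      _ ≤ C := haC _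
  · have := haC ∅
    rw [Finset.sum_empty] at this
    positivity

theorem summable_pow_of_sum_rpow_le {b : ℕ → ℂ} {p C : ℝ} (hp : 0 < p) {n : ℕ} (hpn : p ≤ n)
    (hbC : ∀ J : Finset ℕ, ∑ j ∈ J, ‖b j‖ ^ p ≤ C) : Summable fun j => b j ^ n := by
  have h1 : Summable fun j => ‖b j‖ ^ p :=
    summable_of_sum_le (fun j => by positivity) hbC
  refine Summable.of_norm_bounded (h1.mul_right ((C ^ p⁻¹) ^ ((n : ℝ) - p))) fun j => ?_
  rw [norm_pow]
  refine pow_le_rpow_mul_rpow (norm_nonneg _) ?_ hp hpn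
  have h2 := hbC {j}
  rw [Finset.sum_singleton] at h2
  exact (Real.le_rpow_inv_iff_of_pos (norm_nonneg _) ((by positivity : (0:ℝ) ≤ ‖b j‖ ^ p).trans h2)
    hp).2 h2

open Filter Topology in
/-- Upper bound for a limit of products of elementary factors. The zeros that escape to infinity
leave behind an exponential factor of order `m + 1`. -/
theorem norm_le_of_tendsto_prod_elemFactor {m : ℕ} {p C : ℝ} (hp : 0 < p) (hpm : p ≤ m + 1)
    {a : ℕ → ℕ → ℂ} (hanti : ∀ n, Antitone fun j => ‖a n j‖)
    (haC : ∀ n (J : Finset ℕ), ∑ j ∈ J, ‖a n j‖ ^ p ≤ C) {b : ℕ → ℂ}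
    (hab : ∀ j, Tendsto (fun n => a n j) atTop (𝓝 (b j))) {s w : ℕ → ℂ} {s₀ w₀ z : ℂ}
    (hs : Tendsto s atTop (𝓝 s₀)) (hw : Tendsto w atTop (𝓝 w₀))
    (hsa : ∀ n, ∀ᶠ M in atTop, s n = ∑ j ∈ Finset.range M, a n j ^ (m + 1))
    (hwa : ∀ n, ∀ᶠ M in atTop, w n = ∏ j ∈ Finset.range M, elemFactor m (z * a n j))
    {e : ℝ → ℝ} (he : ∀ u, ‖elemFactor m u‖ ≤ Real.exp (e ‖u‖))
    (hes : Summable fun j => e ‖z * b j‖) :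
    ‖w₀‖ ≤ Real.exp ((-(z ^ (m + 1) / ((m : ℂ) + 1) * (s₀ - ∑' j, b j ^ (m + 1)))).re +
      ∑' j, e ‖z * b j‖) := by
  have hbC : ∀ J : Finset ℕ, ∑ j ∈ J, ‖b j‖ ^ p ≤ C := fun J =>
    le_of_tendsto (tendsto_finsetSum J fun j _ => (hab j).norm.rpow_const (Or.inr hp.le))
      (Eventually.of_forall fun n => haC n J)
  have hC : 0 ≤ C := by simpa using hbC ∅
  set η : ℕ → ℝ := fun N => (C / ((N : ℝ) + 1)) ^ p⁻¹ with hη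
  have hη0 : Tendsto η atTop (𝓝 0) := by
    have h1 : Tendsto (fun N : ℕ => C / ((N : ℝ) + 1)) atTop (𝓝 0) :=
      tendsto_const_div_atTop_nhds_zero_nat C |>.comp (tendsto_add_atTop_nat 1) |>.congr
        fun N => by simp
    have h2 := h1.rpow_const (p := p⁻¹) (Or.inr (by positivity))
    rwa [Real.zero_rpow (by positivity)] at h2
  have hηnn : ∀ N, 0 ≤ η N := fun N => by positivity
  have hfin : ∀ᶠ N in atTop, ‖w₀‖ ≤ Real.exp (∑ j ∈ Finset.range N, e ‖z * b j‖ +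
      (-(z ^ (m + 1) / ((m : ℂ) + 1) * (s₀ - ∑ j ∈ Finset.range N, b j ^ (m + 1)))).re +
      ‖z‖ ^ (m + 2) * (C * η N ^ (((m + 2 : ℕ) : ℝ) - p))) := by
    have hsmall : ∀ᶠ N in atTop, ‖z‖ * η N ≤ 1 / 2 := by
      have := hη0.const_mul ‖z‖
      rw [mul_zero] at this
      exact (this.eventually (gt_mem_nhds (by norm_num : (0 : ℝ) < 1 / 2))).mono fun _ h => h.le
    filter_upwards [hsmall] with N hN
    have hn : ∀ n, ‖w n‖ ≤ ‖∏ j ∈ Finset.range N, elemFactor m (z * a n j)‖ *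
        Real.exp ((-(z ^ (m + 1) / ((m : ℂ) + 1) *
          (s n - ∑ j ∈ Finset.range N, a n j ^ (m + 1)))).re +
        ‖z‖ ^ (m + 2) * (C * η N ^ (((m + 2 : ℕ) : ℝ) - p))) := by
      intro n
      obtain ⟨M, h1, h2, h3⟩ := ((hsa n).and ((hwa n).and (eventually_ge_atTop N))).exists
      rw [h2, h1, ← Finset.prod_range_mul_prod_Ico _ h3, ← Finset.sum_range_add_sum_Ico _ h3,
        norm_mul, add_sub_cancel_left]
      gcongr
      rw [norm_prod]
      have h4 : ∀ j ∈ Finset.Ico N M, ‖a n j‖ ≤ η N := fun j hj =>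
        norm_le_of_antitone_of_sum_rpow_le hp (hanti n) (haC n) (Finset.mem_Ico.1 hj).1
      have h5 : ∀ j ∈ Finset.Ico N M, ‖elemFactor m (z * a n j)‖ ≤
          Real.exp ((-((z * a n j) ^ (m + 1) / ((m : ℂ) + 1))).re + ‖z * a n j‖ ^ (m + 2)) := by
        intro j hj
        refine norm_elemFactor_le_of_small ?_
        rw [norm_mul]
        exact (mul_le_mul_of_nonneg_left (h4 j hj) (norm_nonneg _)).trans hN
      refine (Finset.prod_le_prod (fun _ _ => norm_nonneg _) h5).trans ?_
      rw [← Real.exp_sum]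
      gcongr
      rw [Finset.sum_add_distrib]
      gcongr
      · rw [← Complex.re_sum]
        refine le_of_eq (congrArg Complex.re ?_)
        rw [Finset.mul_sum, ← Finset.sum_neg_distrib]
        refine Finset.sum_congr rfl fun j _ => ?_
        ring
      · calc ∑ j ∈ Finset.Ico N M, ‖z * a n j‖ ^ (m + 2)
            ≤ ∑ j ∈ Finset.Ico N M, ‖z‖ ^ (m + 2) *
              (‖a n j‖ ^ p * η N ^ (((m + 2 : ℕ) : ℝ) - p)) := by
              refine Finset.sum_le_sum fun j hj => ?_
              rw [norm_mul, mul_pow]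
              gcongr
              refine pow_le_rpow_mul_rpow (norm_nonneg _) (h4 j hj) hp ?_
              push_cast
              linarith
          _ = ‖z‖ ^ (m + 2) * ((∑ j ∈ Finset.Ico N M, ‖a n j‖ ^ p) *
              η N ^ (((m + 2 : ℕ) : ℝ) - p)) := by
              rw [Finset.sum_mul, Finset.mul_sum]
          _ ≤ _ := by
              gcongr
              exact haC n _
    have hlim : ‖w₀‖ ≤ ‖∏ j ∈ Finset.range N, elemFactor m (z * b j)‖ *
        Real.exp ((-(z ^ (m + 1) / ((m : ℂ) + 1) *
          (s₀ - ∑ j ∈ Finset.range N, b j ^ (m + 1)))).re +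
        ‖z‖ ^ (m + 2) * (C * η N ^ (((m + 2 : ℕ) : ℝ) - p))) := by
      refine le_of_tendsto_of_tendsto' hw.norm (Tendsto.mul ?_ ?_) hn
      · exact (tendsto_finsetProd _ fun j _ =>
          ((continuous_elemFactor m).tendsto _).comp ((hab j).const_mul z)).norm
      · refine (Real.continuous_exp.tendsto _).comp (Tendsto.add ?_ tendsto_const_nhds)
        refine (Complex.continuous_re.tendsto _).comp (Tendsto.neg (Tendsto.const_mul _ ?_))
        exact hs.sub (tendsto_finsetSum _ fun j _ => (hab j).pow _)
    refine hlim.trans ?_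
    rw [add_assoc, Real.exp_add (∑ j ∈ Finset.range N, e ‖z * b j‖), Real.exp_sum, norm_prod]
    gcongr
    exact he _
  refine ge_of_tendsto ?_ hfin
  refine (Real.continuous_exp.tendsto _).comp ?_
  rw [add_comm (-_ : ℂ).re, ← add_zero (_ + _ : ℝ)]
  refine (hes.hasSum.tendsto_sum_nat.add ?_).add ?_
  · refine (Complex.continuous_re.tendsto _).comp (Tendsto.neg (Tendsto.const_mul _ ?_))
    refine tendsto_const_nhds.sub (Summable.hasSum ?_).tendsto_sum_nat
    exact summable_pow_of_sum_rpow_le hp (by push_cast; linarith) hbC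
  · have h1 : 0 < ((m + 2 : ℕ) : ℝ) - p := by push_cast; linarith
    have h2 := hη0.rpow_const (p := ((m + 2 : ℕ) : ℝ) - p) (Or.inr h1.le)
    rw [Real.zero_rpow h1.ne'] at h2
    simpa using (h2.const_mul C).const_mul (‖z‖ ^ (m + 2))

theorem Enumerates.sum_range_pow {a : ℕ → ℂ} {s : Multiset ℂ} (h : Enumerates a s) {k M : ℕ}
    (hk : k ≠ 0) (hM : s.card ≤ M) : ∑ j ∈ Finset.range M, a j ^ k = (s.map (· ^ k)).sum := by
  have h1 : (s.map (· ^ k)).sum = ∑ j ∈ Finset.range s.card, a j ^ k := by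
    conv_lhs => rw [h.eq_map, Multiset.map_map]
    rfl
  rw [h1]
  refine (Finset.sum_subset (Finset.range_mono hM) fun j _ hj => ?_).symm
  rw [h.eq_zero j (by simpa using hj), zero_pow hk]

theorem Enumerates.prod_range_elemFactor {a : ℕ → ℂ} {s : Multiset ℂ} (h : Enumerates a s)
    {m M : ℕ} (z : ℂ) (hM : s.card ≤ M) : ∏ j ∈ Finset.range M, elemFactor m (z * a j) =
      (s.map fun l => elemFactor m (z * l)).prod := by
  have h1 : (s.map fun l => elemFactor m (z * l)).prod =
      ∏ j ∈ Finset.range s.card, elemFactor m (z * a j) := by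
    conv_lhs => rw [h.eq_map, Multiset.map_map]
    rfl
  rw [h1]
  refine (Finset.prod_subset (Finset.range_mono hM) fun j _ hj => ?_).symm
  rw [h.eq_zero j (by simpa using hj), mul_zero, elemFactor_zero]

/-- `Q` obeys the growth estimate of `exp (c zᵏ)` times the canonical product of genus `k - 1`
with zeros `1 / b j`, where `k = ⌈p⌉₊`. -/
def HasFactorBound (p : ℝ) (c : ℂ) (b : ℕ → ℂ) (Q : ℂ → ℂ) : Prop :=
  ∀ e : ℝ → ℝ, (∀ u, ‖elemFactor (⌈p⌉₊ - 1) u‖ ≤ Real.exp (e ‖u‖)) →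
    ∀ z, (Summable fun j => e ‖z * b j‖) →
      ‖Q z‖ ≤ Real.exp ((c * z ^ ⌈p⌉₊).re + ∑' j, e ‖z * b j‖)

open Filter Topology in
theorem exists_hasFactorBound_of_isFiniteRank {p : ℝ} (hp : 0 < p) {F : X →L[ℂ] X}
    (hF : IsFiniteRank F) {B : ℝ} (hB : 0 ≤ B) (hT : eigSum p F ≤ ENNReal.ofReal B) :
    ∃ b : ℕ → ℂ, (∀ J : Finset ℕ, ∑ j ∈ J, ‖b j‖ ^ p ≤ B) ∧
      HasFactorBound p 0 b fun z => detp p (z • F) := by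
  obtain ⟨a, ha, hanti⟩ := exists_enumerates_antitone (eigRoots F hF)
  have hk : 0 < ⌈p⌉₊ := Nat.ceil_pos.2 hp
  have hk1 : ⌈p⌉₊ - 1 + 1 = ⌈p⌉₊ := by omega
  have hbB := sum_rpow_le_of_enumerates hF hp ha hB hT
  refine ⟨a, hbB, fun e he z hes => ?_⟩
  have h := norm_le_of_tendsto_prod_elemFactor (m := ⌈p⌉₊ - 1) (z := z) hp (C := B)
    (by have := Nat.le_ceil p; rw [← hk1] at this; exact_mod_cast this)
    (a := fun _ => a) (fun _ => hanti) (fun _ => hbB) (fun _ => tendsto_const_nhds)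
    (s := fun _ => ((eigRoots F hF).map (· ^ ⌈p⌉₊)).sum) tendsto_const_nhds
    (w := fun _ => detp p (z • F)) tendsto_const_nhds ?_ ?_ he hes
  · have h1 : ∑' j, a j ^ (⌈p⌉₊ - 1 + 1) = ((eigRoots F hF).map (· ^ ⌈p⌉₊)).sum := by
      rw [hk1, ← ha.sum_range_pow hk.ne' le_rfl]
      refine tsum_eq_sum fun j hj => ?_
      rw [ha.eq_zero j (by simpa using hj), zero_pow hk.ne']
    simpa [h1] using h
  · intro _
    filter_upwards [eventually_ge_atTop (eigRoots F hF).card] with M hM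
    rw [hk1, ha.sum_range_pow hk.ne' hM]
  · intro _
    filter_upwards [eventually_ge_atTop (eigRoots F hF).card] with M hM
    rw [ha.prod_range_elemFactor z hM, detp_smul_eq_prod p F hF]

open Filter Topology in
theorem exists_hasFactorBound {p : ℝ} (hp : 0 < p) {T : X →L[ℂ] X} {F : ℕ → X →L[ℂ] X}
    (hF : ∀ n, IsFiniteRank (F n)) (hlim : Tendsto F atTop (𝓝 T)) {C B : ℝ} (hC : 0 ≤ C)
    (hFC : ∀ n, eigSum p (F n) ≤ ENNReal.ofReal C) (hB : 0 ≤ B)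
    (hT : eigSum p T ≤ ENNReal.ofReal B) {Q : ℂ → ℂ}
    (hQ : ∀ z, Tendsto (fun n => detp p (z • F n)) atTop (𝓝 (Q z))) :
    ∃ (c : ℂ) (b : ℕ → ℂ), (∀ J : Finset ℕ, ∑ j ∈ J, ‖b j‖ ^ p ≤ B) ∧ HasFactorBound p c b Q := by
  have hk : 0 < ⌈p⌉₊ := Nat.ceil_pos.2 hp
  have hk1 : ⌈p⌉₊ - 1 + 1 = ⌈p⌉₊ := by omega
  choose a ha hanti using fun n => exists_enumerates_antitone (eigRoots (F n) (hF n))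
  have haC : ∀ n (J : Finset ℕ), ∑ j ∈ J, ‖a n j‖ ^ p ≤ C := fun n =>
    sum_rpow_le_of_enumerates (hF n) hp (ha n) hC (hFC n)
  set s : ℕ → ℂ := fun n => ((eigRoots (F n) (hF n)).map (· ^ ⌈p⌉₊)).sum with hs
  have hsa : ∀ n, ∀ᶠ M in atTop, s n = ∑ j ∈ Finset.range M, a n j ^ ⌈p⌉₊ := by
    intro n
    filter_upwards [eventually_ge_atTop (eigRoots (F n) (hF n)).card] with M hM
    rw [(ha n).sum_range_pow hk.ne' hM]
  have hab : ∀ n j, ‖a n j‖ ≤ C ^ p⁻¹ := by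
    intro n j
    have h2 := haC n {j}
    rw [Finset.sum_singleton] at h2
    exact (Real.le_rpow_inv_iff_of_pos (norm_nonneg _) hC hp).2 h2
  have hsb : ∀ n, ‖s n‖ ≤ C * (C ^ p⁻¹) ^ ((⌈p⌉₊ : ℝ) - p) := by
    intro n
    obtain ⟨M, hM⟩ := (hsa n).exists
    rw [hM]
    calc ‖∑ j ∈ Finset.range M, a n j ^ ⌈p⌉₊‖ ≤ ∑ j ∈ Finset.range M, ‖a n j‖ ^ ⌈p⌉₊ := by
          simpa only [norm_pow] using norm_sum_le (Finset.range M) fun j => a n j ^ ⌈p⌉₊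
      _ ≤ ∑ j ∈ Finset.range M, ‖a n j‖ ^ p * (C ^ p⁻¹) ^ ((⌈p⌉₊ : ℝ) - p) :=
          Finset.sum_le_sum fun j _ =>
            pow_le_rpow_mul_rpow (norm_nonneg _) (hab n j) hp (Nat.le_ceil p)
      _ ≤ _ := by
          rw [← Finset.sum_mul]
          gcongr
          exact haC n _
  have hcomp : IsCompact ((Set.univ.pi fun _ : ℕ => Metric.closedBall (0 : ℂ) (C ^ p⁻¹)) ×ˢ
      Metric.closedBall (0 : ℂ) (C * (C ^ p⁻¹) ^ ((⌈p⌉₊ : ℝ) - p))) :=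
    (isCompact_univ_pi fun _ => isCompact_closedBall _ _).prod (isCompact_closedBall _ _)
  obtain ⟨⟨b, s₀⟩, -, φ, hφ, hlimφ⟩ := hcomp.tendsto_subseq (x := fun n => (a n, s n))
    fun n => ⟨fun j _ => by simpa using hab n j, by simpa using hsb n⟩
  have hbφ : ∀ j, Tendsto (fun n => a (φ n) j) atTop (𝓝 (b j)) := fun j =>
    ((continuous_apply j).tendsto _).comp ((continuous_fst.tendsto _).comp hlimφ)
  have hsφ : Tendsto (fun n => s (φ n)) atTop (𝓝 s₀) := (continuous_snd.tendsto _).comp hlimφ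
  refine ⟨-((s₀ - ∑' j, b j ^ ⌈p⌉₊) / (⌈p⌉₊ : ℂ)), b,
    sum_rpow_le_of_eigSum_le (fun n => hF (φ n)) (hlim.comp hφ.tendsto_atTop) hp
      (fun n => ha (φ n)) hbφ hB hT, fun e he z hes => ?_⟩
  have h := norm_le_of_tendsto_prod_elemFactor (m := ⌈p⌉₊ - 1) (z := z) hp (C := C)
    (by have := Nat.le_ceil p; rw [← hk1] at this; exact_mod_cast this)
    (a := fun n => a (φ n)) (fun n => hanti _) (fun n => haC _) hbφ hsφ
    ((hQ z).comp hφ.tendsto_atTop) (by simpa only [hk1] using fun n => hsa (φ n)) ?_ he hes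
  · convert h using 4
    have h1 : ((⌈p⌉₊ - 1 : ℕ) : ℂ) + 1 = (⌈p⌉₊ : ℂ) := by exact_mod_cast hk1
    rw [h1, hk1]
    ring
  · intro n
    filter_upwards [eventually_ge_atTop (eigRoots (F (φ n)) (hF (φ n))).card] with M hM
    rw [(ha (φ n)).prod_range_elemFactor z hM, ← detp_smul_eq_prod p _ (hF (φ n))]
    rfl

theorem summable_const_mul_norm_mul_rpow {b : ℕ → ℂ} {p B : ℝ}
    (hbB : ∀ J : Finset ℕ, ∑ j ∈ J, ‖b j‖ ^ p ≤ B) (Γ : ℝ) (z : ℂ) :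
    Summable fun j => Γ * ‖z * b j‖ ^ p := by
  have h1 : Summable fun j => ‖b j‖ ^ p := summable_of_sum_le (fun j => by positivity) hbB
  refine ((h1.mul_left (‖z‖ ^ p)).mul_left Γ).congr fun j => ?_
  rw [norm_mul, Real.mul_rpow (norm_nonneg _) (norm_nonneg _)]

theorem HasFactorBound.norm_one_le {p Γ B : ℝ} {c : ℂ} {b : ℕ → ℂ} {Q : ℂ → ℂ} (hΓ : 0 ≤ Γ)
    (hE : ∀ u, ‖elemFactor (⌈p⌉₊ - 1) u‖ ≤ Real.exp (Γ * ‖u‖ ^ p))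
    (hbB : ∀ J : Finset ℕ, ∑ j ∈ J, ‖b j‖ ^ p ≤ B) (hQ : HasFactorBound p c b Q) :
    ‖Q 1‖ ≤ Real.exp (c.re + Γ * B) := by
  have h := hQ (fun ρ => Γ * ρ ^ p) hE 1 (summable_const_mul_norm_mul_rpow hbB Γ 1)
  refine h.trans ?_
  rw [one_pow, mul_one, tsum_mul_left]
  gcongr
  have h1 : Summable fun j => ‖b j‖ ^ p := summable_of_sum_le (fun j => by positivity) hbB
  simpa only [one_mul] using h1.tsum_le_of_sum_le hbB

open Filter Topology in
theorem HasFactorBound.exists_littleO {p Γ B : ℝ} (hp : 0 < p) {c : ℂ} {b : ℕ → ℂ} {Q : ℂ → ℂ}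
    (hΓ : 0 ≤ Γ) (hE : ∀ u, ‖elemFactor (⌈p⌉₊ - 1) u‖ ≤ Real.exp (Γ * ‖u‖ ^ p))
    (hbB : ∀ J : Finset ℕ, ∑ j ∈ J, ‖b j‖ ^ p ≤ B) (hQ : HasFactorBound p c b Q) :
    ∃ Φ : ℝ → ℝ, (∀ r, 0 ≤ Φ r) ∧ Tendsto (fun r => Φ r / r ^ ⌈p⌉₊) atTop (𝓝 0) ∧
      ∀ z, ‖Q z‖ ≤ Real.exp ((c * z ^ ⌈p⌉₊).re + Φ ‖z‖) := by
  have hk : 0 < ⌈p⌉₊ := Nat.ceil_pos.2 hp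
  set e : ℝ → ℝ := fun ρ =>
    min (Γ * ρ ^ p) (Real.log (1 + ρ) + ∑ i ∈ Finset.Icc 1 (⌈p⌉₊ - 1), ρ ^ i) with he
  have he0 : ∀ ρ, 0 ≤ ρ → 0 ≤ e ρ := fun ρ hρ =>
    le_min (by positivity) (add_nonneg (Real.log_nonneg (by linarith))
      (Finset.sum_nonneg fun _ _ => by positivity))
  have heE : ∀ u, ‖elemFactor (⌈p⌉₊ - 1) u‖ ≤ Real.exp (e ‖u‖) := by
    intro u
    rw [he]
    simp only
    rcases min_choice (Γ * ‖u‖ ^ p)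
      (Real.log (1 + ‖u‖) + ∑ i ∈ Finset.Icc 1 (⌈p⌉₊ - 1), ‖u‖ ^ i) with h | h <;> rw [h]
    · exact hE u
    · exact norm_elemFactor_le_exp_sum _ u
  have hsum : ∀ z, Summable fun j => e ‖z * b j‖ := fun z =>
    Summable.of_nonneg_of_le (fun j => he0 _ (norm_nonneg _)) (fun j => min_le_left _ _)
      (summable_const_mul_norm_mul_rpow hbB Γ z)
  refine ⟨fun r => ∑' j, e (|r| * ‖b j‖), fun r => tsum_nonneg fun j => he0 _ (by positivity),
    ?_, fun z => ?_⟩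
  · have h1 : Summable fun j => Γ * ‖b j‖ ^ p :=
      (summable_of_sum_le (fun j => by positivity) hbB).mul_left Γ
    have h2 : Tendsto (fun r : ℝ => ∑' j, e (|r| * ‖b j‖) / r ^ ⌈p⌉₊) atTop
        (𝓝 (∑' _ : ℕ, (0 : ℝ))) := by
      refine tendsto_tsum_of_dominated_convergence h1 (fun j => ?_) ?_
      · have hlog : Tendsto (fun r : ℝ => Real.log (1 + r * ‖b j‖) / r ^ ⌈p⌉₊) atTop (𝓝 0) := by
          have h3 : Tendsto (fun r : ℝ => (Real.log (1 + ‖b j‖) + Real.log r) / r) atTop (𝓝 0) := by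
            have h4 : Tendsto (fun r : ℝ => Real.log (1 + ‖b j‖) / r + Real.log r / r) atTop
                (𝓝 (0 + 0)) :=
              (tendsto_const_nhds.div_atTop tendsto_id).add
                (Real.isLittleO_log_id_atTop.tendsto_div_nhds_zero)
            rw [add_zero] at h4
            exact h4.congr fun r => by rw [add_div]
          refine squeeze_zero' ?_ ?_ h3
          · filter_upwards [eventually_ge_atTop 1] with r hr
            exact div_nonneg (Real.log_nonneg (by nlinarith [norm_nonneg (b j)])) (by positivity)
          · filter_upwards [eventually_ge_atTop 1] with r hr
            have hr0 : (0 : ℝ) < r := by linarith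
            rw [← Real.log_mul (by positivity) hr0.ne']
            have h5 : Real.log (1 + r * ‖b j‖) ≤ Real.log ((1 + ‖b j‖) * r) :=
              Real.log_le_log (by positivity) (by nlinarith [norm_nonneg (b j)])
            have h6 : 0 ≤ Real.log ((1 + ‖b j‖) * r) :=
              Real.log_nonneg (by nlinarith [norm_nonneg (b j)])
            calc _ ≤ Real.log ((1 + ‖b j‖) * r) / r ^ ⌈p⌉₊ := by gcongr
              _ ≤ _ := by
                gcongr
                exact le_self_pow₀ hr hk.ne'
        have hpow : ∀ i ∈ Finset.Icc 1 (⌈p⌉₊ - 1),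
            Tendsto (fun r : ℝ => (r * ‖b j‖) ^ i / r ^ ⌈p⌉₊) atTop (𝓝 0) := by
          intro i hi
          have hi1 : i < ⌈p⌉₊ := by have := (Finset.mem_Icc.1 hi).2; omega
          have h3 := (tendsto_pow_div_pow_atTop_zero (𝕜 := ℝ) hi1).const_mul (‖b j‖ ^ i)
          rw [mul_zero] at h3
          refine h3.congr fun r => ?_
          rw [mul_pow]; ring
        have h7 := hlog.add (tendsto_finsetSum _ hpow)
        rw [Finset.sum_const_zero, add_zero] at h7
        refine squeeze_zero' ?_ ?_ h7
        · filter_upwards [eventually_ge_atTop 1] with r hr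
          exact div_nonneg (he0 _ (by positivity)) (by positivity)
        · filter_upwards [eventually_ge_atTop 1] with r hr
          rw [← Finset.sum_div, ← add_div, abs_of_nonneg (by linarith)]
          gcongr
          exact min_le_right _ _
      · filter_upwards [eventually_ge_atTop 1] with r hr j
        have hr0 : (0 : ℝ) < r := by linarith
        rw [abs_of_pos hr0, Real.norm_of_nonneg (div_nonneg (he0 _ (by positivity)) (by positivity)),
          div_le_iff₀ (by positivity)]
        calc e (r * ‖b j‖) ≤ Γ * (r * ‖b j‖) ^ p := min_le_left _ _
          _ = Γ * ‖b j‖ ^ p * r ^ p := by rw [Real.mul_rpow hr0.le (norm_nonneg _)]; ring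
          _ ≤ _ := by
            gcongr
            rw [← Real.rpow_natCast]
            exact Real.rpow_le_rpow_of_exponent_le hr (Nat.le_ceil p)
    rw [tsum_zero] at h2
    exact h2.congr fun r => tsum_div_const
  · have h := hQ e heE z (hsum z)
    simpa only [norm_mul, abs_norm] using h

theorem finrank_range_rieszProjection_le (A : X →L[ℂ] X) (hA : IsFiniteRank A) {μ : ℂ} {r : ℝ}
    (hr : 0 < r) (h : ∀ z ∈ Metric.closedBall μ r, z ≠ μ → z ∉ spectrum ℂ A) (hμ : μ ≠ 0) :
    Module.finrank ℂ (LinearMap.range ((rieszProjection A μ r : X →L[ℂ] X) : X →ₗ[ℂ] X)) ≤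
      Module.finrank ℂ (LinearMap.range (A : X →ₗ[ℂ] X)) := by
  have : FiniteDimensional ℂ (LinearMap.range (A : X →ₗ[ℂ] X)) := hA
  have hle : LinearMap.range ((rieszProjection A μ r : X →L[ℂ] X) : X →ₗ[ℂ] X) ≤
      LinearMap.range (A : X →ₗ[ℂ] X) := by
    by_cases h0 : (0 : ℂ) ∈ Metric.closedBall μ r
    · have h1 := h 0 h0 hμ.symm
      rw [spectrum.zero_mem_iff, not_not] at h1
      obtain ⟨u, rfl⟩ := h1
      rintro y -
      refine ⟨(↑u⁻¹ : X →L[ℂ] X) y, ?_⟩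
      exact DFunLike.congr_fun (Units.mul_inv u) y
    · rw [rieszProjection_eq_mul A hr.le (fun z hz => h z (Metric.sphere_subset_closedBall hz)
        (Metric.ne_of_mem_sphere hz hr.ne')) h0]
      rintro _ ⟨y, rfl⟩
      exact ⟨contourCalc A μ r (fun z => z⁻¹) y, rfl⟩
  exact Submodule.finrank_mono hle

theorem exists_rank_one_idempotent [Nontrivial X] : ∃ P : X →L[ℂ] X, P * P = P ∧
    Module.finrank ℂ (LinearMap.range (P : X →ₗ[ℂ] X)) = 1 := by
  obtain ⟨x, hx⟩ := exists_ne (0 : X)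
  obtain ⟨f, hf⟩ := SeparatingDual.exists_eq_one (R := ℂ) hx
  refine ⟨f.smulRight x, ?_, ?_⟩
  · ext y
    simp [hf]
  · have : LinearMap.range ((f.smulRight x : X →L[ℂ] X) : X →ₗ[ℂ] X) = Submodule.span ℂ {x} := by
      ext y
      rw [Submodule.mem_span_singleton]
      constructor
      · rintro ⟨w, rfl⟩
        exact ⟨f w, rfl⟩
      · rintro ⟨c, rfl⟩
        exact ⟨c • x, by simp [hf]⟩
    rw [this, finrank_span_singleton hx]

theorem eigSum_smul_idempotent_le {P : X →L[ℂ] X} (hP : P * P = P)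
    (h1 : Module.finrank ℂ (LinearMap.range (P : X →ₗ[ℂ] X)) = 1) {p : ℝ} (hp : 0 < p) (u : ℂ) :
    eigSum p (u • P) ≤ ENNReal.ofReal (‖u‖ ^ p) := by
  have hPf : IsFiniteRank P := FiniteDimensional.of_finrank_pos (by omega)
  have hspec : ∀ μ ∈ spectrum ℂ (u • P), μ ≠ 0 → μ = u := by
    intro μ hμ hμ0
    have h2 := spectrum.subset_polynomial_aeval (u • P)
      (Polynomial.X * (Polynomial.X - Polynomial.C u)) ⟨μ, hμ, rfl⟩
    have h3 : Polynomial.aeval (u • P) (Polynomial.X * (Polynomial.X - Polynomial.C u)) = 0 := by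
      simp only [map_mul, map_sub, Polynomial.aeval_X, Polynomial.aeval_C]
      rw [mul_sub, ← Algebra.commutes, ← Algebra.smul_def, smul_mul_smul_comm, hP, smul_smul,
        sub_self]
    have : Nontrivial X := by
      by_contra h
      rw [not_nontrivial_iff_subsingleton] at h
      rw [Module.finrank_zero_of_subsingleton] at h1
      omega
    rw [h3, spectrum.zero_eq, Set.mem_singleton_iff] at h2
    simp only [Polynomial.eval_mul, Polynomial.eval_sub, Polynomial.eval_X,
      Polynomial.eval_C] at h2
    rcases mul_eq_zero.1 h2 with h | h
    · exact absurd h hμ0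
    · exact sub_eq_zero.1 h
  have hmult : u ≠ 0 → algebraicMultiplicity (u • P) u ≤ 1 := by
    intro hu
    rw [algebraicMultiplicity]
    split_ifs with h
    · refine (finrank_range_rieszProjection_le _ (hPf.smul u) h.choose_spec.1
        h.choose_spec.2 hu).trans ?_
      rw [← h1]
      have : FiniteDimensional ℂ (LinearMap.range (P : X →ₗ[ℂ] X)) := hPf
      refine Submodule.finrank_mono ?_
      rintro _ ⟨y, rfl⟩
      exact ⟨u • y, by simp⟩
    · exact zero_le_one
  rw [eigSum]
  set g : ℂ → ℝ≥0∞ := fun μ =>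
    (algebraicMultiplicity (u • P) μ : ℝ≥0∞) * ENNReal.ofReal (‖μ‖ ^ p) with hg
  have h0 : g 0 = 0 := by simp [hg, Real.zero_rpow hp.ne']
  calc ∑' μ : {μ : ℂ // IsDiscreteEigenvalue (u • P) μ}, g μ
      = ∑' μ : ℂ, Set.indicator {μ | IsDiscreteEigenvalue (u • P) μ} g μ :=
        tsum_subtype {μ | IsDiscreteEigenvalue (u • P) μ} g
    _ = Set.indicator {μ | IsDiscreteEigenvalue (u • P) μ} g u := by
        refine tsum_eq_single u fun μ hμ => ?_
        by_cases hd : IsDiscreteEigenvalue (u • P) μ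
        · rw [Set.indicator_of_mem (by exact hd)]
          by_cases h : μ = 0
          · rw [h, h0]
          · exact absurd (hspec μ hd.1 h) hμ
        · exact Set.indicator_of_notMem (by exact hd) _
    _ ≤ g u := Set.indicator_le_self _ _ _
    _ ≤ ENNReal.ofReal (‖u‖ ^ p) := by
        by_cases hu : u = 0
        · rw [hu, h0]; exact zero_le
        · calc g u ≤ 1 * ENNReal.ofReal (‖u‖ ^ p) := by
                rw [hg]
                simp only
                gcongr
                exact_mod_cast hmult hu
            _ = _ := one_mul _

theorem detp_smul_idempotent {P : X →L[ℂ] X} (hP : P * P = P)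
    (h1 : Module.finrank ℂ (LinearMap.range (P : X →ₗ[ℂ] X)) = 1) (p : ℝ) (u : ℂ) :
    detp p (u • P) = elemFactor (⌈p⌉₊ - 1) u := by
  have hPf : IsFiniteRank P := FiniteDimensional.of_finrank_pos (by omega)
  have : FiniteDimensional ℂ (LinearMap.range (P : X →ₗ[ℂ] X)) := hPf
  have hr : restrictOf P _ le_rfl = 1 := by
    ext ⟨y, hy⟩
    obtain ⟨w, rfl⟩ := hy
    rw [coe_restrictOf]
    exact DFunLike.congr_fun hP w
  have heig : eigRoots P hPf = {1} := by
    have h2 : (restrictOf P (LinearMap.range (P : X →ₗ[ℂ] X)) le_rfl).charpoly.roots = {1} := by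
      rw [hr, LinearMap.charpoly_one, h1, pow_one, ← Polynomial.C_1, Polynomial.roots_X_sub_C]
    exact h2
  rw [detp_smul_eq_prod p P hPf, heig]
  simp

/-- A growth bound for the regularized determinant of finite rank operators passes to the
elementary factors. -/
theorem norm_elemFactor_le_of_detp_bound [Nontrivial X] {p Γ : ℝ} (hp : 0 < p) (hΓ : 0 ≤ Γ)
    (hΓb : ∀ F : X →L[ℂ] X, IsFiniteRank F →
      ‖detp p F‖ ≤ Real.exp (Γ * (eigSum p F).toReal)) (u : ℂ) :
    ‖elemFactor (⌈p⌉₊ - 1) u‖ ≤ Real.exp (Γ * ‖u‖ ^ p) := by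
  obtain ⟨P, hP, h1⟩ := exists_rank_one_idempotent (X := X)
  have hPf : IsFiniteRank P := FiniteDimensional.of_finrank_pos (by omega)
  rw [← detp_smul_idempotent hP h1]
  refine (hΓb _ (hPf.smul u)).trans ?_
  gcongr
  exact ENNReal.toReal_le_of_le_ofReal (by positivity) (eigSum_smul_idempotent_le hP h1 hp u)

namespace LpIdeal

variable {p : ℝ} (I : LpIdeal p X)

theorem norm'_sub_le {K L : X →L[ℂ] X} (hK : K ∈ I.carrier) (hL : L ∈ I.carrier) :
    I.norm' (K - L) ≤ I.q * (I.norm' K + I.norm' L) := by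
  have h := I.norm'_add_le K hK _ (I.smul_mem (-1) hL)
  rwa [I.norm'_smul L hL, norm_neg, norm_one, one_mul, neg_one_smul, ← sub_eq_add_neg] at h

theorem sub_mem {K L : X →L[ℂ] X} (hK : K ∈ I.carrier) (hL : L ∈ I.carrier) :
    K - L ∈ I.carrier := by
  have h := I.add_mem hK (I.smul_mem (-1) hL)
  rwa [neg_one_smul, ← sub_eq_add_neg] at h

theorem norm'_sub_comm {K L : X →L[ℂ] X} (hK : K ∈ I.carrier) (hL : L ∈ I.carrier) :
    I.norm' (K - L) = I.norm' (L - K) := by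
  have h := I.norm'_smul _ (I.sub_mem hK hL) (-1)
  rwa [neg_one_smul, neg_sub, norm_neg, norm_one, one_mul, eq_comm] at h

theorem norm'_sub_le_add {K L M : X →L[ℂ] X} (hK : K ∈ I.carrier) (hL : L ∈ I.carrier)
    (hM : M ∈ I.carrier) : I.norm' (K - M) ≤ I.q * (I.norm' (K - L) + I.norm' (L - M)) := by
  have h := I.norm'_add_le _ (I.sub_mem hK hL) _ (I.sub_mem hL hM)
  rwa [sub_add_sub_cancel] at h

theorem q_pos : 0 < I.q := zero_lt_one.trans_le I.one_le_q

theorem norm'_le_of_sub {K L : X →L[ℂ] X} (hK : K ∈ I.carrier) (hL : L ∈ I.carrier) :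
    I.norm' K ≤ I.q * (I.norm' (L - K) + I.norm' L) := by
  have h := I.norm'_add_le _ (I.sub_mem hK hL) _ hL
  rwa [sub_add_cancel, I.norm'_sub_comm hK hL] at h

/-- A function that is entire along lines and grows at most like `exp (c ‖T‖ ^ p)` is locally
Lipschitz, with the constant given by Cauchy's estimate. -/
theorem norm_sub_le_of_growth {V : (X →L[ℂ] X) → Prop} (hVI : ∀ T, V T → T ∈ I.carrier)
    (hVa : ∀ S T, V S → V T → V (S + T)) (hVs : ∀ (z : ℂ) T, V T → V (z • T))
    {d : (X →L[ℂ] X) → ℂ}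
    (hd : ∀ S T, V S → V T → Differentiable ℂ fun z : ℂ => d (S + z • T)) {c : ℝ} (hc : 0 ≤ c)
    (hp : 0 < p) (hgrow : ∀ T, V T → ‖d T‖ ≤ Real.exp (c * I.norm' T ^ p)) {K L : X →L[ℂ] X}
    (hK : V K) (hL : V L) : ‖d K - d L‖ ≤ I.norm' (K - L) *
      Real.exp (I.q ^ (2 * p) * c * (I.norm' K + I.norm' L + 1) ^ p) := by
  have hKI := hVI K hK
  have hLI := hVI L hL
  have hq := I.one_le_q
  have hq0 := I.q_pos
  have hK0 := I.norm'_nonneg K hKI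
  have hL0 := I.norm'_nonneg L hLI
  set t := I.norm' (K - L) with ht
  rcases (I.norm'_nonneg _ (I.sub_mem hKI hLI)).eq_or_lt with h0 | h0
  · have h1 : K = L := sub_eq_zero.1 ((I.norm'_eq_zero_iff _ (I.sub_mem hKI hLI)).1 h0.symm)
    rw [h1, sub_self, norm_zero, ht, ← h0, zero_mul]
  have hVadd : V (K + L) := hVa _ _ hK hL
  have hVsub : V (K - L) := by
    have := hVa _ _ hK (hVs (-1) _ hL)
    rwa [neg_one_smul, ← sub_eq_add_neg] at this
  set A : X →L[ℂ] X := (1 / 2 : ℂ) • (K + L) with hA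
  have hVA : V A := hVs _ _ hVadd
  set g : ℂ → ℂ := fun z => d (A + z • (K - L)) with hg
  have hgd : Differentiable ℂ g := hd _ _ hVA hVsub
  set E := Real.exp (I.q ^ (2 * p) * c * (I.norm' K + I.norm' L + 1) ^ p) with hE
  have hbound : ∀ z : ℂ, ‖z‖ ≤ 1 / 2 + t⁻¹ → ‖g z‖ ≤ E := by
    intro z hz
    have hVz : V (A + z • (K - L)) := hVa _ _ hVA (hVs _ _ hVsub)
    refine (hgrow _ hVz).trans ?_
    have h1 : I.norm' (A + z • (K - L)) ≤ I.q ^ 2 * (I.norm' K + I.norm' L + 1) := by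
      have h2 := I.norm'_add_le _ (hVI _ hVA) _ (I.smul_mem z (hVI _ hVsub))
      rw [hA, I.norm'_smul _ (hVI _ hVadd), I.norm'_smul _ (hVI _ hVsub), ← ht] at h2
      have h3 := I.norm'_add_le _ hKI _ hLI
      have h4 := I.norm'_sub_le hKI hLI
      have h5 : ‖z‖ * t ≤ 1 / 2 * t + 1 := by
        calc ‖z‖ * t ≤ (1 / 2 + t⁻¹) * t := by gcongr
          _ = _ := by rw [add_mul, inv_mul_cancel₀ h0.ne']
      have h6 : ‖(1 / 2 : ℂ)‖ = 1 / 2 := by norm_num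
      rw [h6] at h2
      rw [← ht] at h4
      calc _ ≤ _ := h2
        _ ≤ I.q * (1 / 2 * (I.q * (I.norm' K + I.norm' L)) +
            (1 / 2 * (I.q * (I.norm' K + I.norm' L)) + 1)) := by
            gcongr
            exact h5.trans (by gcongr)
        _ ≤ I.q * (I.q * (I.norm' K + I.norm' L) + I.q) :=
            mul_le_mul_of_nonneg_left (by linarith) hq0.le
        _ = _ := by ring
    rw [hE, show I.q ^ (2 * p) * c * (I.norm' K + I.norm' L + 1) ^ p =
      c * (I.q ^ 2 * (I.norm' K + I.norm' L + 1)) ^ p by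
        rw [Real.mul_rpow (by positivity) (by positivity), Real.rpow_mul hq0.le]
        norm_cast
        ring]
    have := I.norm'_nonneg _ (hVI _ hVz)
    gcongr
  have hderiv : ∀ z ∈ Metric.closedBall (0 : ℂ) (1 / 2), ‖deriv g z‖ ≤ E * t := by
    intro z hz
    have h1 := Complex.norm_deriv_le_of_forall_mem_sphere_norm_le (c := z) (R := t⁻¹) (C := E)
      (f := g) (by positivity) hgd.diffContOnCl ?_
    · rwa [div_inv_eq_mul] at h1
    · intro w hw
      refine hbound w ?_
      rw [mem_closedBall_zero_iff] at hz
      have h2 : ‖w‖ ≤ ‖z‖ + ‖w - z‖ := by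
        have := norm_add_le z (w - z)
        rwa [add_sub_cancel] at this
      rw [mem_sphere_iff_norm] at hw
      linarith
  have h1 := (convex_closedBall (0 : ℂ) (1 / 2)).norm_image_sub_le_of_norm_deriv_le
    (f := g) (x := -(1 / 2)) (y := 1 / 2) (fun z _ => hgd z) hderiv (by simp) (by simp)
  have h2 : g (1 / 2) = d K := by
    rw [hg, hA]
    simp only
    rw [← smul_add, add_add_sub_cancel, ← two_smul ℂ K, smul_smul]
    norm_num
  have h3 : g (-(1 / 2)) = d L := by
    rw [hg, hA]
    simp only
    rw [neg_smul, ← sub_eq_add_neg, ← smul_sub, show K + L - (K - L) = (2 : ℂ) • L by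
      rw [two_smul]; abel, smul_smul]
    norm_num
  rw [h2, h3] at h1
  refine h1.trans (le_of_eq ?_)
  norm_num
  ring

end LpIdeal

namespace LpIdeal

variable {p : ℝ} (I : LpIdeal p X)

/-- `D` is approximated by the regularized determinants of finite rank operators, with a linear
rate that is uniform on bounded subsets of `I`. -/
def Approximates (D : (X →L[ℂ] X) → ℂ) : Prop :=
  ∀ R, ∃ W, 0 ≤ W ∧ ∀ L ∈ I.carrier, I.norm' L ≤ R → ∀ F, IsFiniteRank F → I.norm' (L - F) ≤ 1 →
    ‖D L - detp p F‖ ≤ W * I.norm' (L - F)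

theorem exists_seq_finiteRank {L : X →L[ℂ] X} (hL : L ∈ I.carrier) :
    ∃ F : ℕ → X →L[ℂ] X, (∀ n, IsFiniteRank (F n)) ∧
      ∀ n, I.norm' (L - F n) < 1 / ((n : ℝ) + 1) := by
  choose F hF hF1 using fun n : ℕ =>
    I.dense_finiteRank L hL (1 / ((n : ℝ) + 1)) Nat.one_div_pos_of_nat
  exact ⟨F, hF, hF1⟩

open Filter Topology in
theorem exists_approximates (hp : 0 < p) {c : ℝ} (hc : 0 ≤ c)
    (hgrow : ∀ F : X →L[ℂ] X, IsFiniteRank F → ‖detp p F‖ ≤ Real.exp (c * I.norm' F ^ p)) :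
    ∃ D, I.Approximates D := by
  have hq := I.one_le_q
  have hq0 := I.q_pos
  set W : ℝ → ℝ := fun t =>
    I.q * Real.exp (I.q ^ (2 * p) * c * (2 * I.q * (t + 1) + 1) ^ p) with hW
  have key : ∀ L ∈ I.carrier, ∀ F, IsFiniteRank F → I.norm' (L - F) ≤ 1 → ∀ G, IsFiniteRank G →
      I.norm' (L - G) ≤ 1 →
      ‖detp p F - detp p G‖ ≤ W (I.norm' L) * (I.norm' (L - F) + I.norm' (L - G)) := by
    intro L hL F hF hF1 G hG hG1
    have hFI := I.finiteRank_mem F hF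
    have hGI := I.finiteRank_mem G hG
    have h := I.norm_sub_le_of_growth (V := IsFiniteRank) I.finiteRank_mem
      (fun _ _ h1 h2 => h1.add h2) (fun z _ h => h.smul z) (d := detp p)
      (fun _ _ h1 h2 => differentiable_detp_line p h1 h2) hc hp hgrow hF hG
    have h1 := I.norm'_sub_le_add hFI hL hGI
    rw [I.norm'_sub_comm hFI hL] at h1
    have hsub := I.norm'_nonneg _ (I.sub_mem hL hFI)
    have hsub' := I.norm'_nonneg _ (I.sub_mem hL hGI)
    have hF0 := I.norm'_nonneg _ hFI
    have hG0 := I.norm'_nonneg _ hGI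
    have h2 : I.norm' F ≤ I.q * (I.norm' L + 1) :=
      (I.norm'_le_of_sub hFI hL).trans (mul_le_mul_of_nonneg_left (by linarith) hq0.le)
    have h3 : I.norm' G ≤ I.q * (I.norm' L + 1) :=
      (I.norm'_le_of_sub hGI hL).trans (mul_le_mul_of_nonneg_left (by linarith) hq0.le)
    have h4 : I.norm' F + I.norm' G + 1 ≤ 2 * I.q * (I.norm' L + 1) + 1 := by linarith
    calc _ ≤ _ := h
      _ ≤ (I.q * (I.norm' (L - F) + I.norm' (L - G))) *
          Real.exp (I.q ^ (2 * p) * c * (2 * I.q * (I.norm' L + 1) + 1) ^ p) := by gcongr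
      _ = _ := by rw [hW]; ring
  have hW0 : ∀ t, 0 ≤ W t := fun t => by positivity
  have hlim : ∀ L ∈ I.carrier, ∃ y : ℂ, ∀ F, IsFiniteRank F → I.norm' (L - F) ≤ 1 →
      ‖y - detp p F‖ ≤ W (I.norm' L) * I.norm' (L - F) := by
    intro L hL
    obtain ⟨F, hF, hF1⟩ := I.exists_seq_finiteRank hL
    have hle : ∀ n, I.norm' (L - F n) ≤ 1 := fun n => (hF1 n).le.trans <| by
      rw [div_le_one (by positivity)]; linarith [(n.cast_nonneg : (0 : ℝ) ≤ n)]
    have h0 : Tendsto (fun n : ℕ => 1 / ((n : ℝ) + 1)) atTop (𝓝 0) :=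
      tendsto_one_div_add_atTop_nhds_zero_nat
    have hδ : Tendsto (fun n => I.norm' (L - F n)) atTop (𝓝 0) :=
      squeeze_zero (fun n => I.norm'_nonneg _ (I.sub_mem hL (I.finiteRank_mem _ (hF n))))
        (fun n => (hF1 n).le) h0
    have hcau : CauchySeq fun n => detp p (F n) := by
      refine cauchySeq_of_le_tendsto_0
        (fun N : ℕ => W (I.norm' L) * (1 / ((N : ℝ) + 1) + 1 / ((N : ℝ) + 1))) ?_ ?_
      · intro n m N hn hm
        rw [dist_eq_norm]
        refine (key L hL _ (hF n) (hle n) _ (hF m) (hle m)).trans ?_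
        have h1 := (hF1 n).le.trans (Nat.one_div_le_one_div (α := ℝ) hn)
        have h2 := (hF1 m).le.trans (Nat.one_div_le_one_div (α := ℝ) hm)
        exact mul_le_mul_of_nonneg_left (add_le_add h1 h2) (hW0 _)
      · simpa using (h0.add h0).const_mul (W (I.norm' L))
    obtain ⟨y, hy⟩ := cauchySeq_tendsto_of_complete hcau
    refine ⟨y, fun G hG hG1 => ?_⟩
    have h1 : Tendsto (fun n => W (I.norm' L) * (I.norm' (L - F n) + I.norm' (L - G))) atTop
        (𝓝 (W (I.norm' L) * (0 + I.norm' (L - G)))) := (hδ.add_const _).const_mul _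
    rw [zero_add] at h1
    exact le_of_tendsto_of_tendsto' (hy.sub_const _).norm h1 fun n =>
      key L hL _ (hF n) (hle n) _ hG hG1
  choose! D hD using hlim
  refine ⟨D, fun R => ⟨W (max R 0), hW0 _, fun L hL hLR F hF hF1 => (hD L hL F hF hF1).trans ?_⟩⟩
  have h1 := I.norm'_nonneg _ (I.sub_mem hL (I.finiteRank_mem F hF))
  have h2 := I.norm'_nonneg _ hL
  have h3 : I.norm' L ≤ max R 0 := hLR.trans (le_max_left _ _)
  refine mul_le_mul_of_nonneg_right ?_ h1
  simp only [hW]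
  gcongr

namespace Approximates

variable {I} {D : (X →L[ℂ] X) → ℂ} (hD : I.Approximates D)

include hD

open Filter Topology in
theorem tendsto {L : X →L[ℂ] X} (hL : L ∈ I.carrier) {F : ℕ → X →L[ℂ] X}
    (hF : ∀ n, IsFiniteRank (F n)) (hlim : Tendsto (fun n => I.norm' (L - F n)) atTop (𝓝 0)) :
    Tendsto (fun n => detp p (F n)) atTop (𝓝 (D L)) := by
  obtain ⟨W, -, hW⟩ := hD (I.norm' L)
  rw [tendsto_iff_norm_sub_tendsto_zero]
  refine squeeze_zero' (Eventually.of_forall fun _ => norm_nonneg _) ?_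
    (by simpa using hlim.const_mul W)
  filter_upwards [hlim.eventually (gt_mem_nhds zero_lt_one)] with n hn
  rw [norm_sub_rev]
  exact hW L hL le_rfl _ (hF n) hn.le

theorem extendsDetp : ExtendsDetp p D := by
  intro F hF
  obtain ⟨W, -, hW⟩ := hD (I.norm' F)
  have hFI := I.finiteRank_mem F hF
  have h0 : I.norm' (F - F) = 0 := (I.norm'_eq_zero_iff _ (I.sub_mem hFI hFI)).2 (sub_self F)
  have h := hW F hFI le_rfl F hF (h0.trans_le zero_le_one)
  rw [h0, mul_zero] at h
  exact sub_eq_zero.1 (norm_le_zero_iff.1 h)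

theorem exists_delta {L : X →L[ℂ] X} (hL : L ∈ I.carrier) {ε : ℝ} (hε : 0 < ε) :
    ∃ δ > 0, ∀ F, IsFiniteRank F → I.norm' (L - F) < δ → ‖D L - detp p F‖ < ε := by
  obtain ⟨W, hW0, hW⟩ := hD (I.norm' L)
  refine ⟨min 1 (ε / (W + 1)), lt_min one_pos (by positivity), fun F hF hF1 => ?_⟩
  have h1 := hW L hL le_rfl F hF (hF1.le.trans (min_le_left _ _))
  have h2 : I.norm' (L - F) < ε / (W + 1) := hF1.trans_le (min_le_right _ _)
  have h3 := I.norm'_nonneg _ (I.sub_mem hL (I.finiteRank_mem F hF))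
  rw [lt_div_iff₀ (by positivity)] at h2
  nlinarith

theorem idealContinuous : IdealContinuous I D := by
  intro L hL ε hε
  obtain ⟨δ, hδ, h⟩ := exists_delta hD hL (half_pos hε)
  have hq0 := I.q_pos
  refine ⟨δ / (2 * I.q), by positivity, fun K hK hKL => ?_⟩
  obtain ⟨δ₁, hδ₁, h₁⟩ := exists_delta hD hK (half_pos hε)
  obtain ⟨F, hF, hKF⟩ := I.dense_finiteRank K hK (min δ₁ (δ / (2 * I.q)))
    (lt_min hδ₁ (by positivity))
  have hFI := I.finiteRank_mem F hF
  have h2 := h₁ F hF (hKF.trans_le (min_le_left _ _))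
  have h3 : I.norm' (L - F) < δ := by
    have h4 := I.norm'_sub_le_add hL hK hFI
    rw [I.norm'_sub_comm hL hK] at h4
    have h5 := hKF.trans_le (min_le_right _ _)
    calc _ ≤ _ := h4
      _ < I.q * (δ / (2 * I.q) + δ / (2 * I.q)) := by gcongr
      _ = δ := by field_simp; ring
  have h6 := h F hF h3
  rw [norm_sub_rev] at h6
  calc ‖D K - D L‖ ≤ ‖D K - detp p F‖ + ‖detp p F - D L‖ := norm_sub_le_norm_sub_add_norm_sub _ _ _
    _ < ε / 2 + ε / 2 := add_lt_add h2 h6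
    _ = ε := add_halves ε

open Filter Topology in
theorem eq_of_continuous_of_extends {D' : (X →L[ℂ] X) → ℂ} (hc : IdealContinuous I D')
    (he : ExtendsDetp p D') {L : X →L[ℂ] X} (hL : L ∈ I.carrier) : D' L = D L := by
  obtain ⟨F, hF, hF1⟩ := I.exists_seq_finiteRank hL
  have hlim : Tendsto (fun n => I.norm' (L - F n)) atTop (𝓝 0) :=
    squeeze_zero (fun n => I.norm'_nonneg _ (I.sub_mem hL (I.finiteRank_mem _ (hF n))))
      (fun n => (hF1 n).le) tendsto_one_div_add_atTop_nhds_zero_nat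
  refine tendsto_nhds_unique ?_ (hD.tendsto hL hF hlim)
  rw [Metric.tendsto_nhds]
  intro ε hε
  obtain ⟨δ, hδ, h⟩ := hc L hL ε hε
  filter_upwards [hlim.eventually (gt_mem_nhds hδ)] with n hn
  have hFI := I.finiteRank_mem _ (hF n)
  rw [dist_eq_norm, ← he _ (hF n)]
  exact h _ hFI (by rwa [I.norm'_sub_comm hFI hL])

theorem norm_le {c : ℝ} (hp : 0 < p) (hc : 0 ≤ c)
    (hgrow : ∀ F : X →L[ℂ] X, IsFiniteRank F → ‖detp p F‖ ≤ Real.exp (c * I.norm' F ^ p))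
    {L : X →L[ℂ] X} (hL : L ∈ I.carrier) :
    ‖D L‖ ≤ Real.exp (c * (I.q * (I.norm' L + 1)) ^ p) := by
  refine le_of_forall_pos_le_add fun ε hε => ?_
  obtain ⟨δ, hδ, h⟩ := exists_delta hD hL hε
  obtain ⟨F, hF, hLF⟩ := I.dense_finiteRank L hL (min δ 1) (lt_min hδ one_pos)
  have hFI := I.finiteRank_mem F hF
  have h1 := h F hF (hLF.trans_le (min_le_left _ _))
  have h2 : I.norm' F ≤ I.q * (I.norm' L + 1) := by
    refine (I.norm'_le_of_sub hFI hL).trans (mul_le_mul_of_nonneg_left ?_ I.q_pos.le)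
    linarith [hLF.trans_le (min_le_right δ 1)]
  have h3 := I.norm'_nonneg F hFI
  calc ‖D L‖ ≤ ‖detp p F‖ + ‖D L - detp p F‖ := by
        have := norm_add_le (detp p F) (D L - detp p F)
        rwa [add_sub_cancel] at this
    _ ≤ Real.exp (c * I.norm' F ^ p) + ε := add_le_add (hgrow F hF) h1.le
    _ ≤ _ := by gcongr

open Filter Topology in
theorem differentiable_line {S T : X →L[ℂ] X} (hS : S ∈ I.carrier) (hT : T ∈ I.carrier) :
    Differentiable ℂ fun z : ℂ => D (S + z • T) := by
  obtain ⟨F, hF, hF1⟩ := I.exists_seq_finiteRank hS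
  obtain ⟨G, hG, hG1⟩ := I.exists_seq_finiteRank hT
  have hq0 := I.q_pos
  have hS0 := I.norm'_nonneg S hS
  have hT0 := I.norm'_nonneg T hT
  have hunif : ∀ R : ℝ, 0 < R → TendstoUniformlyOn (fun n (z : ℂ) => detp p (F n + z • G n))
      (fun z => D (S + z • T)) atTop (Metric.ball 0 R) := by
    intro R hR
    obtain ⟨W, hW0, hW⟩ := hD (I.q * (I.norm' S + R * I.norm' T))
    have hdist : ∀ n, ∀ z ∈ Metric.ball (0 : ℂ) R, I.norm' (S + z • T - (F n + z • G n)) ≤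
        I.q * (1 + R) * (1 / ((n : ℝ) + 1)) := by
      intro n z hz
      have hFI := I.sub_mem hS (I.finiteRank_mem _ (hF n))
      have hGI := I.sub_mem hT (I.finiteRank_mem _ (hG n))
      have h1 := I.norm'_add_le _ hFI _ (I.smul_mem z hGI)
      rw [I.norm'_smul _ hGI, smul_sub] at h1
      rw [show S + z • T - (F n + z • G n) = S - F n + (z • T - z • G n) by abel]
      have hz1 : ‖z‖ ≤ R := (mem_ball_zero_iff.1 hz).le
      have h0 := I.norm'_nonneg _ hGI
      calc _ ≤ _ := h1
        _ ≤ I.q * (1 / ((n : ℝ) + 1) + R * (1 / ((n : ℝ) + 1))) := by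
          gcongr
          · exact (hF1 n).le
          · exact (hG1 n).le
        _ = _ := by ring
    have hlim : Tendsto (fun n : ℕ => I.q * (1 + R) * (1 / ((n : ℝ) + 1))) atTop (𝓝 0) := by
      simpa using tendsto_one_div_add_atTop_nhds_zero_nat.const_mul (I.q * (1 + R))
    rw [Metric.tendstoUniformlyOn_iff]
    intro ε hε
    have hlim2 := hlim.const_mul W
    rw [mul_zero] at hlim2
    filter_upwards [hlim.eventually (gt_mem_nhds one_pos), hlim2.eventually (gt_mem_nhds hε)]
      with n hn1 hn2 z hz
    have hz1 : ‖z‖ ≤ R := (mem_ball_zero_iff.1 hz).le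
    rw [dist_eq_norm]
    have hmem := I.add_mem hS (I.smul_mem z hT)
    refine (hW _ hmem ?_ _ ((hF n).add ((hG n).smul z)) ((hdist n z hz).trans hn1.le)).trans_lt
      ((mul_le_mul_of_nonneg_left (hdist n z hz) hW0).trans_lt hn2)
    refine (I.norm'_add_le _ hS _ (I.smul_mem z hT)).trans ?_
    rw [I.norm'_smul _ hT]
    gcongr
  intro z
  have hz : z ∈ Metric.ball (0 : ℂ) (‖z‖ + 1) := by simp
  have h := (hunif (‖z‖ + 1) (by positivity)).tendstoLocallyUniformlyOn.differentiableOn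
    (Eventually.of_forall fun n => (differentiable_detp_line p (hF n) (hG n)).differentiableOn)
    Metric.isOpen_ball
  exact (h z hz).differentiableAt (Metric.isOpen_ball.mem_nhds hz)

open Filter Topology in
theorem continuous_smul_add_smul {L S : X →L[ℂ] X} (hL : L ∈ I.carrier) (hS : S ∈ I.carrier) :
    Continuous fun x : ℂ × ℂ => D (x.1 • (L + x.2 • S)) := by
  rw [continuous_iff_continuousAt]
  intro x₀
  rw [ContinuousAt, Metric.tendsto_nhds]
  intro ε hε
  have hmem : ∀ x : ℂ × ℂ, x.1 • (L + x.2 • S) ∈ I.carrier := fun x =>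
    I.smul_mem _ (I.add_mem hL (I.smul_mem _ hS))
  obtain ⟨δ, hδ, h⟩ := hD.idealContinuous _ (hmem x₀) ε hε
  have hcont : Tendsto (fun x : ℂ × ℂ => I.q * (‖x.1 - x₀.1‖ * I.norm' L +
      ‖x.1 * x.2 - x₀.1 * x₀.2‖ * I.norm' S)) (𝓝 x₀) (𝓝 0) := by
    have : Continuous fun x : ℂ × ℂ => I.q * (‖x.1 - x₀.1‖ * I.norm' L +
      ‖x.1 * x.2 - x₀.1 * x₀.2‖ * I.norm' S) := by fun_prop
    simpa using this.tendsto x₀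
  filter_upwards [hcont.eventually (gt_mem_nhds hδ)] with x hx
  rw [dist_eq_norm]
  refine h _ (hmem x) (lt_of_le_of_lt ?_ hx)
  rw [show x.1 • (L + x.2 • S) - x₀.1 • (L + x₀.2 • S) =
    (x.1 - x₀.1) • L + (x.1 * x.2 - x₀.1 * x₀.2) • S by module]
  refine (I.norm'_add_le _ (I.smul_mem _ hL) _ (I.smul_mem _ hS)).trans ?_
  rw [I.norm'_smul _ hL, I.norm'_smul _ hS]

end Approximates

end LpIdeal

theorem log_one_add_norm_le_circleAverage {f : ℂ → ℂ} (hf : Differentiable ℂ f)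
    (c : ℂ) {R : ℝ} (hR : 0 < R) :
    Real.log (1 + ‖f c‖) ≤ Real.circleAverage (fun z => Real.log (1 + ‖f z‖)) c R := by
  have hpos : ∀ z, 0 < 1 + ‖f z‖ := fun z => by positivity
  have hcont : Continuous fun z => Real.log (1 + ‖f z‖) :=
    (continuous_const.add hf.continuous.norm).log fun z => (hpos z).ne'
  obtain ⟨b, hb, hbf⟩ : ∃ b : ℂ, ‖b‖ = 1 ∧ b * f c = ‖f c‖ := by
    by_cases h0 : f c = 0
    · exact ⟨1, by simp, by simp [h0]⟩
    · refine ⟨(‖f c‖ : ℂ) / f c, ?_, ?_⟩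
      · have : ‖f c‖ ≠ 0 := norm_ne_zero_iff.2 h0
        simp [this]
      · field_simp
  set g : ℂ → ℂ := fun z => 1 + b * f z with hg
  have hgd : Differentiable ℂ g := by fun_prop
  have hga : AnalyticOnNhd ℂ g (Metric.closedBall c |R|) := fun z _ => hgd.analyticAt z
  have hgc : g c = ((1 + ‖f c‖ : ℝ) : ℂ) := by simp [hg, hbf]
  have hgc0 : g c ≠ 0 := by
    rw [hgc]; exact_mod_cast (hpos c).ne'
  have hJ := hga.circleAverage_log_norm hR.ne' hgc0
  have hnn : 0 ≤ ∑ᶠ u, MeromorphicOn.divisor g (Metric.closedBall c |R|) u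
      * Real.log (R * ‖c - u‖⁻¹) := by
    refine finsum_nonneg fun u => ?_
    by_cases hu : u ∈ Metric.closedBall c |R|
    · refine mul_nonneg ?_ ?_
      · exact_mod_cast (MeromorphicOn.AnalyticOnNhd.divisor_nonneg hga) u
      · rw [abs_of_pos hR, Metric.mem_closedBall, dist_comm, dist_eq_norm] at hu
        rcases eq_or_lt_of_le (norm_nonneg (c - u)) with h | h
        · simp [← h]
        · refine Real.log_nonneg ?_
          rw [← div_eq_mul_inv, le_div_iff₀ h]; simpa using hu
    · simp [hu]
  have hle : Real.log ‖g c‖ ≤ Real.circleAverage (fun z => Real.log ‖g z‖) c R := by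
    rw [hJ]; linarith
  rw [hgc, Complex.norm_real, Real.norm_of_nonneg (hpos c).le] at hle
  refine hle.trans (Real.circleAverage_mono
    (MeromorphicOn.circleIntegrable_log_norm fun z _ => (hgd.analyticAt z).meromorphicAt)
    hcont.continuousOn.circleIntegrable' fun z _ => ?_)
  rcases eq_or_lt_of_le (norm_nonneg (g z)) with h | h
  · rw [← h, Real.log_zero]
    exact Real.log_nonneg (by simp)
  · refine Real.log_le_log h ((norm_add_le _ _).trans ?_)
    simp [hb]

theorem log_add_norm_le_circleAverage {f : ℂ → ℂ} (hf : Differentiable ℂ f) {ε : ℝ} (hε : 0 < ε)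
    (c : ℂ) {R : ℝ} (hR : 0 < R) :
    Real.log (ε + ‖f c‖) ≤ Real.circleAverage (fun z => Real.log (ε + ‖f z‖)) c R := by
  have hd : Differentiable ℂ fun z => f z / (ε : ℂ) := by fun_prop
  have h := log_one_add_norm_le_circleAverage hd c hR
  have hscale : ∀ z, Real.log (ε + ‖f z‖) = Real.log ε + Real.log (1 + ‖f z / (ε : ℂ)‖) := by
    intro z
    rw [← Real.log_mul hε.ne' (by positivity), norm_div, Complex.norm_real,
      Real.norm_of_nonneg hε.le]
    congr 1
    field_simp
  simp_rw [hscale]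
  have hcont : Continuous fun z => Real.log (1 + ‖f z / (ε : ℂ)‖) :=
    (continuous_const.add hd.continuous.norm).log fun z =>
      (add_pos_of_pos_of_nonneg one_pos (norm_nonneg _)).ne'
  rw [Real.circleAverage_fun_add continuousOn_const.circleIntegrable'
    hcont.continuousOn.circleIntegrable', Real.circleAverage_const]
  linarith

theorem continuous_circleAverage_param {h : ℂ → ℂ → ℝ}
    (hh : Continuous fun x : ℂ × ℂ => h x.1 x.2) :
    Continuous fun ζ => Real.circleAverage (fun w => h w ζ) 0 1 := by
  have hint : Continuous fun ζ => ∫ θ in (0 : ℝ)..2 * Real.pi, h (circleMap 0 1 θ) ζ := by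
    refine intervalIntegral.continuous_parametric_intervalIntegral_of_continuous' ?_ _ _
    exact hh.comp (((continuous_circleMap 0 1).comp continuous_snd).prodMk continuous_fst)
  exact hint.const_smul (2 * Real.pi)⁻¹

theorem circleAverage_circleAverage_swap {h : ℂ → ℂ → ℝ}
    (hh : Continuous fun x : ℂ × ℂ => h x.1 x.2) :
    Real.circleAverage (fun w => Real.circleAverage (fun v => h w v) 0 1) 0 1
      = Real.circleAverage (fun v => Real.circleAverage (fun w => h w v) 0 1) 0 1 := by
  have hc : Continuous fun x : ℝ × ℝ => h (circleMap 0 1 x.1) (circleMap 0 1 x.2) :=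
    hh.comp (((continuous_circleMap 0 1).comp continuous_fst).prodMk
      ((continuous_circleMap 0 1).comp continuous_snd))
  simp only [Real.circleAverage_def, smul_eq_mul, intervalIntegral.integral_const_mul]
  rw [MeasureTheory.intervalIntegral_intervalIntegral_swap]
  exact (hc.continuousOn.integrableOn_compact
    (isCompact_uIcc.prod isCompact_uIcc)).mono_set
    (Set.prod_mono Set.uIoc_subset_uIcc Set.uIoc_subset_uIcc)

/-- The mean value inequality over all circles, written over the unit circle. -/
def SubMean (φ : ℂ → ℝ) : Prop :=
  ∀ a b, φ a ≤ Real.circleAverage (fun w => φ (a + w * b)) 0 1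

theorem subMean_log_add_norm {f : ℂ → ℂ} (hf : Differentiable ℂ f) {ε : ℝ} (hε : 0 < ε) :
    SubMean fun z => Real.log (ε + ‖f z‖) := by
  intro a b
  have hd : Differentiable ℂ fun w => f (a + w * b) := by fun_prop
  simpa using log_add_norm_le_circleAverage hd hε 0 one_pos

theorem setIntegral_ball_zero_rotate (φ : ℂ → ℝ) (R : ℝ) {w : ℂ} (hw : ‖w‖ = 1) :
    ∫ z in Metric.ball (0 : ℂ) R, φ (w * z) = ∫ z in Metric.ball (0 : ℂ) R, φ z := by
  let e := rotation ⟨w, by simpa [Submonoid.unitSphere] using hw⟩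
  have h := e.measurePreserving.setIntegral_preimage_emb
    e.toMeasurableEquiv.measurableEmbedding φ (Metric.ball 0 R)
  rw [← h]
  have : e ⁻¹' Metric.ball 0 R = Metric.ball 0 R := by
    rw [e.preimage_ball]; simp
  rw [this]
  rfl

theorem setIntegral_ball_translate (φ : ℂ → ℝ) (a : ℂ) (R : ℝ) :
    ∫ z in Metric.ball a R, φ z = ∫ z in Metric.ball (0 : ℂ) R, φ (a + z) := by
  have h := (MeasureTheory.measurePreserving_add_left MeasureTheory.volume a).setIntegral_preimage_emb
    (measurableEmbedding_addLeft a) φ (Metric.ball a R)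
  rw [← h]
  congr 2
  ext z; simp [Metric.mem_ball, dist_eq_norm]

theorem SubMean.mul_volume_ball_le {φ : ℂ → ℝ} (hφ : SubMean φ) (hc : Continuous φ) (a : ℂ)
    (R : ℝ) :
    φ a * MeasureTheory.volume.real (Metric.ball a R) ≤ ∫ z in Metric.ball a R, φ z := by
  have hvol : MeasureTheory.volume.real (Metric.ball a R)
      = MeasureTheory.volume.real (Metric.ball (0 : ℂ) R) := by
    simp [MeasureTheory.measureReal_def, Complex.volume_ball]
  have hcc : Continuous fun x : ℝ × ℂ => φ (a + circleMap 0 1 x.1 * x.2) := by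
    fun_prop
  have hmean : ∫ z in Metric.ball (0 : ℂ) R, φ (a + z)
      = ∫ z in Metric.ball (0 : ℂ) R, Real.circleAverage (fun w => φ (a + w * z)) 0 1 := by
    simp only [Real.circleAverage_def, smul_eq_mul]
    rw [MeasureTheory.integral_const_mul, ← MeasureTheory.intervalIntegral_integral_swap]
    · have : ∀ θ : ℝ, ∫ z in Metric.ball (0 : ℂ) R, φ (a + circleMap 0 1 θ * z)
          = ∫ z in Metric.ball (0 : ℂ) R, φ (a + z) := fun θ =>
        setIntegral_ball_zero_rotate (fun z => φ (a + z)) R (by simp)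
      simp only [this, intervalIntegral.integral_const]
      rw [smul_eq_mul, sub_zero, inv_mul_cancel_left₀ (by positivity)]
    · rw [MeasureTheory.Measure.prod_restrict]
      refine (hcc.continuousOn.integrableOn_compact
        ((isCompact_uIcc (a := 0) (b := 2 * Real.pi)).prod
          (isCompact_closedBall (0 : ℂ) R))).mono_set
        (Set.prod_mono Set.uIoc_subset_uIcc Metric.ball_subset_closedBall)
  rw [setIntegral_ball_translate, hmean, hvol, mul_comm, ← smul_eq_mul,
    ← MeasureTheory.setIntegral_const]
  refine MeasureTheory.setIntegral_mono_on ?_ ?_ measurableSet_ball fun z _ => hφ a z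
  · exact MeasureTheory.integrableOn_const MeasureTheory.measure_ball_lt_top.ne
  · have : Continuous fun z => Real.circleAverage (fun w => φ (a + w * z)) 0 1 :=
      continuous_circleAverage_param (h := fun w z => φ (a + w * z)) (by fun_prop)
    exact (this.continuousOn.integrableOn_compact (isCompact_closedBall (0 : ℂ) R)).mono_set
      Metric.ball_subset_closedBall

theorem SubMean.circleAverage {h : ℂ → ℂ → ℝ} (hh : Continuous fun x : ℂ × ℂ => h x.1 x.2)
    (hs : ∀ w, ‖w‖ = 1 → SubMean (h w)) :
    SubMean fun ζ => Real.circleAverage (fun w => h w ζ) 0 1 := by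
  intro a b
  have hc : Continuous fun x : ℂ × ℂ => h x.2 (a + x.1 * b) := hh.comp
    (continuous_snd.prodMk (by fun_prop : Continuous fun x : ℂ × ℂ => a + x.1 * b))
  rw [circleAverage_circleAverage_swap (h := fun v w => h w (a + v * b)) hc]
  refine Real.circleAverage_mono ?_ ?_ fun w hw => hs w (by simpa using hw) a b
  · have : Continuous fun w => h w a := hh.comp (continuous_id.prodMk continuous_const)
    exact this.continuousOn.circleIntegrable'
  · exact (continuous_circleAverage_param
      (h := fun v w => h w (a + v * b)) hc).continuousOn.circleIntegrable'

theorem SubMean.const_mul {φ : ℂ → ℝ} (hφ : SubMean φ) {t : ℝ} (ht : 0 ≤ t) :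
    SubMean fun z => t * φ z := by
  intro a b
  have := Real.circleAverage_fun_smul (a := t) (f := fun w => φ (a + w * b)) (c := 0) (R := 1)
  simp only [smul_eq_mul] at this
  rw [this]
  exact mul_le_mul_of_nonneg_left (hφ a b) ht

theorem circleAverage_weighted_harmonic {k : ℕ} (hk : k ≠ 0) (s M : ℝ) (d : ℂ) :
    Real.circleAverage (fun w => (1 + s * (w ^ k).re) * (M + (d * w ^ k).re)) 0 1
      = M + s / 2 * d.re := by
  set P : ℂ → ℂ := fun w => M + M * s * w ^ k + d * w ^ k + s / 2 * (d * w ^ (2 * k) + d) with hP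
  have hPd : Differentiable ℂ P := by fun_prop
  have hav : Real.circleAverage P 0 1 = P 0 := hPd.diffContOnCl.circleAverage
  have hre : Real.circleAverage (fun w => (P w).re) 0 1 = (P 0).re := by
    rw [← hav]
    exact Complex.reCLM.circleAverage_comp_comm hPd.continuous.continuousOn.circleIntegrable'
  have hP0 : (P 0).re = M + s / 2 * d.re := by
    simp [hP, hk]
  rw [← hP0, ← hre]
  refine Real.circleAverage_congr_sphere fun w hw => ?_
  have hw1 : ‖w ^ k‖ = 1 := by
    have : ‖w‖ = 1 := by simpa using hw
    simp [this]
  have hsq : (w ^ k).re * (w ^ k).re + (w ^ k).im * (w ^ k).im = 1 := by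
    rw [← Complex.normSq_apply, Complex.normSq_eq_norm_sq, hw1]; norm_num
  have h2 : w ^ (2 * k) = w ^ k * w ^ k := by rw [← pow_add]; ring_nf
  simp only [hP, h2]
  generalize w ^ k = v at *
  simp
  linear_combination (s / 2 * d.re) * hsq

/-- A weighted mean of `log ‖G z ζ‖` over the circle `‖z‖ = r`, regularized at the zeros of `G`. -/
noncomputable def weightedLogMean (G : ℂ → ℂ → ℂ) (k : ℕ) (s r : ℝ) (ζ : ℂ) : ℝ :=
  (r ^ k)⁻¹ * Real.circleAverage
    (fun w => (1 + s * (w ^ k).re) * Real.log (Real.exp (-r ^ (k + 1)) + ‖G (r * w) ζ‖)) 0 1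

theorem weight_nonneg {s : ℝ} (hs : |s| ≤ 1) (k : ℕ) {w : ℂ} (hw : ‖w‖ = 1) :
    0 ≤ 1 + s * (w ^ k).re := by
  have h1 : |(w ^ k).re| ≤ 1 := (Complex.abs_re_le_norm _).trans (by simp [hw])
  have h2 : |s * (w ^ k).re| ≤ 1 := by
    rw [abs_mul]; exact mul_le_one₀ hs (abs_nonneg _) h1
  linarith [(abs_le.1 h2).1]

theorem continuous_weightedLogMean_integrand {G : ℂ → ℂ → ℂ}
    (hG : Continuous fun x : ℂ × ℂ => G x.1 x.2) (k : ℕ) (s r : ℝ) :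
    Continuous fun x : ℂ × ℂ => (1 + s * (x.1 ^ k).re)
      * Real.log (Real.exp (-r ^ (k + 1)) + ‖G (r * x.1) x.2‖) := by
  have h1 : Continuous fun x : ℂ × ℂ => G (r * x.1) x.2 :=
    hG.comp ((continuous_const.mul continuous_fst).prodMk continuous_snd)
  have h2 : Continuous fun x : ℂ × ℂ => (x.1 ^ k).re :=
    Complex.continuous_re.comp (continuous_fst.pow k)
  exact (continuous_const.add (continuous_const.mul h2)).mul
    ((continuous_const.add h1.norm).log fun x =>
      (add_pos_of_pos_of_nonneg (Real.exp_pos _) (norm_nonneg _)).ne')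

theorem circleIntegrable_weightedLogMean_integrand {G : ℂ → ℂ → ℂ}
    (hG : Continuous fun x : ℂ × ℂ => G x.1 x.2) (k : ℕ) (s r : ℝ) (ζ : ℂ) :
    CircleIntegrable (fun w => (1 + s * (w ^ k).re)
      * Real.log (Real.exp (-r ^ (k + 1)) + ‖G (r * w) ζ‖)) 0 1 :=
  ((continuous_weightedLogMean_integrand hG k s r).comp
    (continuous_id.prodMk continuous_const)).continuousOn.circleIntegrable'

theorem continuous_weightedLogMean {G : ℂ → ℂ → ℂ}
    (hG : Continuous fun x : ℂ × ℂ => G x.1 x.2) (k : ℕ) (s r : ℝ) :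
    Continuous (weightedLogMean G k s r) :=
  continuous_const.mul (continuous_circleAverage_param
    (h := fun w ζ => (1 + s * (w ^ k).re)
      * Real.log (Real.exp (-r ^ (k + 1)) + ‖G (r * w) ζ‖))
    (continuous_weightedLogMean_integrand hG k s r))

theorem subMean_weightedLogMean {G : ℂ → ℂ → ℂ}
    (hG : Continuous fun x : ℂ × ℂ => G x.1 x.2) (hζ : ∀ z, Differentiable ℂ (G z)) (k : ℕ)
    {s : ℝ} (hs : |s| ≤ 1) {r : ℝ} (hr : 0 ≤ r) : SubMean (weightedLogMean G k s r) := by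
  refine SubMean.const_mul (SubMean.circleAverage (h := fun w ζ => (1 + s * (w ^ k).re)
      * Real.log (Real.exp (-r ^ (k + 1)) + ‖G (r * w) ζ‖))
    (continuous_weightedLogMean_integrand hG k s r) fun w hw => ?_) (by positivity)
  exact (subMean_log_add_norm (hζ _) (Real.exp_pos _)).const_mul (weight_nonneg hs k hw)

theorem weightedLogMean_le {G : ℂ → ℂ → ℂ} (hG : Continuous fun x : ℂ × ℂ => G x.1 x.2)
    {k : ℕ} (hk : k ≠ 0) {s : ℝ} (hs : |s| ≤ 1) {r : ℝ} (hr : 1 ≤ r) {ζ d : ℂ} {M : ℝ}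
    (hM : 0 ≤ M) (hd : -r ^ (k + 1) ≤ -‖d‖)
    (hle : ∀ w, ‖w‖ = 1 → ‖G (r * w) ζ‖ ≤ Real.exp ((d * w ^ k).re + M)) :
    weightedLogMean G k s r ζ ≤ (r ^ k)⁻¹ * (Real.log 2 + M + s / 2 * d.re) := by
  refine mul_le_mul_of_nonneg_left ?_ (by positivity)
  rw [← circleAverage_weighted_harmonic hk s (Real.log 2 + M) d]
  refine Real.circleAverage_mono (circleIntegrable_weightedLogMean_integrand hG k s r ζ) ?_ ?_
  · have : Continuous fun w : ℂ => (1 + s * (w ^ k).re) * (Real.log 2 + M + (d * w ^ k).re) := by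
      fun_prop
    exact this.continuousOn.circleIntegrable'
  · intro w hw
    have hw1 : ‖w‖ = 1 := by simpa using hw
    refine mul_le_mul_of_nonneg_left ?_ (weight_nonneg hs k hw1)
    have hdw : -‖d‖ ≤ (d * w ^ k).re := by
      have h := Complex.abs_re_le_norm (d * w ^ k)
      rw [norm_mul, norm_pow, hw1, one_pow, mul_one] at h
      exact (abs_le.1 h).1
    have h1 : Real.exp (-r ^ (k + 1)) ≤ Real.exp ((d * w ^ k).re + M) :=
      Real.exp_le_exp.2 (by linarith)
    calc Real.log (Real.exp (-r ^ (k + 1)) + ‖G (r * w) ζ‖)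
        ≤ Real.log (2 * Real.exp ((d * w ^ k).re + M)) :=
          Real.log_le_log (by positivity) (by linarith [hle w hw1])
      _ = Real.log 2 + M + (d * w ^ k).re := by
          rw [Real.log_mul two_ne_zero (Real.exp_pos _).ne', Real.log_exp]; ring

theorem weightedLogMean_le_of_growth {G : ℂ → ℂ → ℂ}
    (hG : Continuous fun x : ℂ × ℂ => G x.1 x.2) {k : ℕ} (hk : k ≠ 0) {s : ℝ} (hs : |s| ≤ 1)
    {r : ℝ} (hr : 1 ≤ r) {ζ : ℂ} {A : ℝ} (hA : 0 ≤ A)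
    (hle : ∀ z, 1 ≤ ‖z‖ → ‖G z ζ‖ ≤ Real.exp (A * ‖z‖ ^ k)) :
    weightedLogMean G k s r ζ ≤ A + 1 := by
  have hrk : 1 ≤ r ^ k := one_le_pow₀ hr
  have h := weightedLogMean_le hG hk hs hr (ζ := ζ) (d := 0) (M := A * r ^ k) (by positivity)
    (by simp; positivity) fun w hw => by
      have hn : ‖(r : ℂ) * w‖ = r := by
        rw [norm_mul, hw, mul_one, Complex.norm_real, Real.norm_of_nonneg (by linarith)]
      have h1 := hle (r * w) (by rw [hn]; exact hr)
      rw [hn] at h1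
      simpa using h1
  refine h.trans ?_
  rw [inv_mul_le_iff₀ (by positivity)]
  have := Real.log_two_lt_d9
  simp only [Complex.zero_re, mul_zero, add_zero]
  nlinarith

theorem weightedLogMean_add_nonneg {G : ℂ → ℂ → ℂ}
    (hG : Continuous fun x : ℂ × ℂ => G x.1 x.2) {ζ : ℂ} (hz : Differentiable ℂ fun z => G z ζ)
    (h0 : G 0 ζ = 1) (k : ℕ) {r : ℝ} (hr : 0 ≤ r) :
    0 ≤ weightedLogMean G k 1 r ζ + weightedLogMean G k (-1) r ζ := by
  rw [weightedLogMean, weightedLogMean, ← mul_add, ← Real.circleAverage_fun_add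
    (circleIntegrable_weightedLogMean_integrand hG k 1 r ζ)
    (circleIntegrable_weightedLogMean_integrand hG k (-1) r ζ)]
  have hd : Differentiable ℂ fun w : ℂ => G (r * w) ζ :=
    hz.comp (differentiable_id.const_mul (r : ℂ))
  have hsub := log_add_norm_le_circleAverage hd (Real.exp_pos (-r ^ (k + 1))) 0 one_pos
  have hfun : (fun w : ℂ => (1 + 1 * (w ^ k).re)
        * Real.log (Real.exp (-r ^ (k + 1)) + ‖G (r * w) ζ‖)
      + (1 + -1 * (w ^ k).re) * Real.log (Real.exp (-r ^ (k + 1)) + ‖G (r * w) ζ‖))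
      = fun w : ℂ => (2 : ℝ) • Real.log (Real.exp (-r ^ (k + 1)) + ‖G (r * w) ζ‖) := by
    funext w; simp only [smul_eq_mul]; ring
  rw [hfun, Real.circleAverage_fun_smul]
  have hlog : 0 ≤ Real.log (Real.exp (-r ^ (k + 1)) + ‖G (r * 0) ζ‖) := by
    refine Real.log_nonneg ?_
    simp [h0, Real.exp_nonneg]
  have := hlog.trans hsub
  positivity

open Filter Topology in
theorem exists_tendsto_weightedLogMean_le {G : ℂ → ℂ → ℂ}
    (hG : Continuous fun x : ℂ × ℂ => G x.1 x.2) {k : ℕ} (hk : k ≠ 0) {s : ℝ} (hs : |s| ≤ 1)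
    {ζ c : ℂ} {Φ : ℝ → ℝ} (hΦ0 : ∀ r, 0 ≤ Φ r)
    (hΦ : Tendsto (fun r => Φ r / r ^ k) atTop (𝓝 0))
    (hle : ∀ z, ‖G z ζ‖ ≤ Real.exp ((c * z ^ k).re + Φ ‖z‖)) :
    ∃ b : ℕ → ℝ, Tendsto b atTop (𝓝 (s / 2 * c.re)) ∧
      ∀ᶠ n : ℕ in atTop, weightedLogMean G k s n ζ ≤ b n := by
  refine ⟨fun n => Real.log 2 * ((n : ℝ) ^ k)⁻¹ + Φ n / (n : ℝ) ^ k + s / 2 * c.re, ?_, ?_⟩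
  · have h1 : Tendsto (fun n : ℕ => ((n : ℝ) ^ k)⁻¹) atTop (𝓝 0) :=
      ((tendsto_pow_atTop hk).comp tendsto_natCast_atTop_atTop).inv_tendsto_atTop
    have h2 : Tendsto (fun n : ℕ => Φ n / (n : ℝ) ^ k) atTop (𝓝 0) :=
      hΦ.comp tendsto_natCast_atTop_atTop
    simpa using ((h1.const_mul (Real.log 2)).add h2).add_const (s / 2 * c.re)
  · filter_upwards [eventually_ge_atTop 1,
      tendsto_natCast_atTop_atTop.eventually_ge_atTop ‖c‖] with n hn hc
    have hn1 : (1 : ℝ) ≤ n := by exact_mod_cast hn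
    have hnk : (0 : ℝ) < (n : ℝ) ^ k := by positivity
    have h := weightedLogMean_le hG hk hs hn1 (ζ := ζ) (d := c * (n : ℂ) ^ k) (M := Φ n)
      (hΦ0 _) (by
        rw [norm_mul, norm_pow, Complex.norm_natCast, pow_succ, neg_le_neg_iff, mul_comm]
        exact mul_le_mul_of_nonneg_left hc hnk.le) fun w hw => by
      have hz := hle ((n : ℝ) * w)
      rw [norm_mul, hw, mul_one, Complex.norm_real, Real.norm_of_nonneg (by positivity),
        mul_pow, ← mul_assoc] at hz
      exact_mod_cast hz
    refine h.trans (le_of_eq ?_)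
    have hre : (c * (n : ℂ) ^ k).re = c.re * (n : ℝ) ^ k := by
      rw [← Complex.ofReal_natCast, ← Complex.ofReal_pow, Complex.re_mul_ofReal]
    rw [hre]
    field_simp

open Filter Topology in
theorem half_re_add_le_of_growth {G : ℂ → ℂ → ℂ} (hG : Continuous fun x : ℂ × ℂ => G x.1 x.2)
    (hz : ∀ ζ, Differentiable ℂ fun z => G z ζ) (hζ : ∀ z, Differentiable ℂ (G z))
    (h0 : ∀ ζ, G 0 ζ = 1) {k : ℕ} (hk : k ≠ 0) {R A : ℝ} (hR : 0 < R) (hA : 0 ≤ A)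
    (hgrow : ∀ z ζ, 1 ≤ ‖z‖ → ‖ζ‖ ≤ R + 2 → ‖G z ζ‖ ≤ Real.exp (A * ‖z‖ ^ k))
    {c : ℂ → ℂ} {Φ : ℂ → ℝ → ℝ} (hΦ0 : ∀ ζ, ‖ζ‖ ≤ R + 2 → ∀ r, 0 ≤ Φ ζ r)
    (hΦ : ∀ ζ, ‖ζ‖ ≤ R + 2 → Tendsto (fun r => Φ ζ r / r ^ k) atTop (𝓝 0))
    (hle : ∀ ζ, ‖ζ‖ ≤ R + 2 → ∀ z, ‖G z ζ‖ ≤ Real.exp ((c ζ * z ^ k).re + Φ ζ ‖z‖))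
    (hc1 : (c 1).re ≤ 0) :
    R ^ 2 * ((c 0).re / 2 + (A + 1)) ≤ (R + 1) ^ 2 * (A + 1) := by
  set C := A + 1 with hC
  set u : ℕ → ℂ → ℝ := fun n => weightedLogMean G k 1 n with hu
  set v : ℕ → ℂ → ℝ := fun n => weightedLogMean G k (-1) n with hv
  set B₀ := Metric.ball (0 : ℂ) R with hB₀
  set B₁ := Metric.ball (1 : ℂ) (R + 1) with hB₁
  have hs1 : |(1 : ℝ)| ≤ 1 := by simp
  have hs2 : |(-1 : ℝ)| ≤ 1 := by simp
  have hB₁le : ∀ ζ ∈ B₁, ‖ζ‖ ≤ R + 2 := by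
    intro ζ h
    have h1 : ‖ζ - 1‖ < R + 1 := by simpa [hB₁, dist_eq_norm] using h
    have := norm_add_le (ζ - 1) 1
    simp at this
    linarith
  have hsubset : B₀ ⊆ B₁ := by
    refine Metric.ball_subset_ball' ?_
    simp [dist_eq_norm]
  have huc : ∀ n, Continuous (u n) := fun n => continuous_weightedLogMean hG k 1 n
  have hvc : ∀ n, Continuous (v n) := fun n => continuous_weightedLogMean hG k (-1) n
  have huC : ∀ n : ℕ, 1 ≤ n → ∀ ζ, ‖ζ‖ ≤ R + 2 → u n ζ ≤ C := fun n hn ζ hh =>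
    weightedLogMean_le_of_growth hG hk hs1 (by exact_mod_cast hn) hA fun z hz1 => hgrow z ζ hz1 hh
  have hvC : ∀ n : ℕ, 1 ≤ n → ∀ ζ, ‖ζ‖ ≤ R + 2 → v n ζ ≤ C := fun n hn ζ hh =>
    weightedLogMean_le_of_growth hG hk hs2 (by exact_mod_cast hn) hA fun z hz1 => hgrow z ζ hz1 hh
  have hadd : ∀ n ζ, 0 ≤ u n ζ + v n ζ := fun n ζ =>
    weightedLogMean_add_nonneg hG (hz ζ) (h0 ζ) k n.cast_nonneg
  have hint : ∀ {φ : ℂ → ℝ} (_ : Continuous φ) (a : ℂ) (ρ : ℝ),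
      MeasureTheory.IntegrableOn φ (Metric.ball a ρ) := fun hφ a ρ =>
    (hφ.continuousOn.integrableOn_compact (isCompact_closedBall a ρ)).mono_set
      Metric.ball_subset_closedBall
  have hvol : ∀ (a : ℂ) {ρ : ℝ}, 0 ≤ ρ →
      MeasureTheory.volume.real (Metric.ball a ρ) = ρ ^ 2 * Real.pi := fun a ρ hρ => by
    simp [MeasureTheory.measureReal_def, Complex.volume_ball, hρ]
  have hI : Tendsto (fun n => ∫ ζ in B₁, (u n ζ + v n ζ)) atTop (𝓝 0) := by
    have h : Tendsto (fun n => ∫ ζ in B₁, (u n ζ + v n ζ)) atTop (𝓝 (∫ _ in B₁, (0 : ℝ))) := by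
      refine MeasureTheory.tendsto_integral_filter_of_dominated_convergence (fun _ => 2 * C)
        (Eventually.of_forall fun n => ((huc n).add (hvc n)).aestronglyMeasurable) ?_
        (hint continuous_const 1 (R + 1)) ?_
      · filter_upwards [eventually_ge_atTop 1] with n hn
        filter_upwards [MeasureTheory.ae_restrict_mem measurableSet_ball] with ζ hh
        rw [Real.norm_of_nonneg (hadd n ζ)]
        linarith [huC n hn ζ (hB₁le ζ hh), hvC n hn ζ (hB₁le ζ hh)]
      · filter_upwards [MeasureTheory.ae_restrict_mem measurableSet_ball] with ζ hh
        have hζR := hB₁le ζ hh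
        obtain ⟨b, hb, hub⟩ := exists_tendsto_weightedLogMean_le hG hk hs1 (hΦ0 ζ hζR)
          (hΦ ζ hζR) (hle ζ hζR)
        obtain ⟨b', hb', hvb⟩ := exists_tendsto_weightedLogMean_le hG hk hs2 (hΦ0 ζ hζR)
          (hΦ ζ hζR) (hle ζ hζR)
        have hbb : Tendsto (fun n => b n + b' n) atTop (𝓝 0) := by
          convert hb.add hb' using 2; ring
        refine tendsto_of_tendsto_of_tendsto_of_le_of_le' tendsto_const_nhds hbb
          (Eventually.of_forall fun n => hadd n ζ) ?_
        filter_upwards [hub, hvb] with n h1 h2 using add_le_add h1 h2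
    simpa using h
  have hstep : ∀ n : ℕ, 1 ≤ n → (-v n 0 + C) * (R ^ 2 * Real.pi)
      ≤ (∫ ζ in B₁, (u n ζ + v n ζ)) + (u n 1 + C) * ((R + 1) ^ 2 * Real.pi) := by
    intro n hn
    have hu0 := (subMean_weightedLogMean hG hζ k hs1 n.cast_nonneg).mul_volume_ball_le (huc n) 0 R
    have hv1 := (subMean_weightedLogMean hG hζ k hs2 n.cast_nonneg).mul_volume_ball_le
      (hvc n) 1 (R + 1)
    rw [hvol _ hR.le] at hu0
    rw [hvol _ (by linarith)] at hv1
    have hadd_const : ∀ (a : ℂ) {ρ : ℝ}, 0 ≤ ρ → ∫ ζ in Metric.ball a ρ, (u n ζ + C)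
        = (∫ ζ in Metric.ball a ρ, u n ζ) + C * (ρ ^ 2 * Real.pi) := fun a ρ hρ => by
      rw [MeasureTheory.integral_add (hint (huc n) a ρ) (hint continuous_const a ρ),
        MeasureTheory.setIntegral_const, hvol a hρ, smul_eq_mul, mul_comm C]
    have hmono : ∫ ζ in B₀, (u n ζ + C) ≤ ∫ ζ in B₁, (u n ζ + C) := by
      refine MeasureTheory.setIntegral_mono_set
        (hint ((huc n).add continuous_const) 1 (R + 1)) ?_ hsubset.eventuallyLE
      filter_upwards [MeasureTheory.ae_restrict_mem measurableSet_ball] with ζ hh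
      have h1 := hadd n ζ
      have h2 := hvC n hn ζ (hB₁le ζ hh)
      simp only [Pi.zero_apply]
      linarith
    have hsum : ∫ ζ in B₁, (u n ζ + v n ζ) = (∫ ζ in B₁, u n ζ) + ∫ ζ in B₁, v n ζ :=
      MeasureTheory.integral_add (hint (huc n) 1 (R + 1)) (hint (hvc n) 1 (R + 1))
    rw [hadd_const 0 hR.le, hadd_const 1 (by linarith)] at hmono
    have h1 : -v n 0 * (R ^ 2 * Real.pi) ≤ u n 0 * (R ^ 2 * Real.pi) :=
      mul_le_mul_of_nonneg_right (by linarith [hadd n 0]) (by positivity)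
    have h2 : -u n 1 * ((R + 1) ^ 2 * Real.pi) ≤ v n 1 * ((R + 1) ^ 2 * Real.pi) :=
      mul_le_mul_of_nonneg_right (by linarith [hadd n 1]) (by positivity)
    rw [hsum]
    linarith
  obtain ⟨b, hb, hvb⟩ := exists_tendsto_weightedLogMean_le hG hk hs2
    (hΦ0 0 (by simp; linarith)) (hΦ 0 (by simp; linarith)) (hle 0 (by simp; linarith))
  obtain ⟨b', hb', hub⟩ := exists_tendsto_weightedLogMean_le hG hk hs1
    (hΦ0 1 (by simp; linarith)) (hΦ 1 (by simp; linarith)) (hle 1 (by simp; linarith))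
  have hlim := le_of_tendsto_of_tendsto ((hb.neg.add_const C).mul_const (R ^ 2 * Real.pi))
    (hI.add ((hb'.add_const C).mul_const ((R + 1) ^ 2 * Real.pi))) <| by
      filter_upwards [hvb, hub, eventually_ge_atTop 1] with n h1 h2 h3
      have hp : 0 ≤ R ^ 2 * Real.pi := by positivity
      have hp' : 0 ≤ (R + 1) ^ 2 * Real.pi := by positivity
      have h4 : (-b n + C) * (R ^ 2 * Real.pi) ≤ (-v n 0 + C) * (R ^ 2 * Real.pi) :=
        mul_le_mul_of_nonneg_right (by linarith [show v n 0 ≤ b n from h1]) hp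
      have h5 : (u n 1 + C) * ((R + 1) ^ 2 * Real.pi) ≤ (b' n + C) * ((R + 1) ^ 2 * Real.pi) :=
        mul_le_mul_of_nonneg_right (by linarith [show u n 1 ≤ b' n from h2]) hp'
      linarith [hstep n h3]
  have hpi := Real.pi_pos
  have hfin : R ^ 2 * ((c 0).re / 2 + C) * Real.pi
      ≤ ((R + 1) ^ 2 * C + (R + 1) ^ 2 * ((c 1).re / 2)) * Real.pi := by linarith
  have h6 := le_of_mul_le_mul_right hfin hpi
  have h7 : (R + 1) ^ 2 * ((c 1).re / 2) ≤ 0 :=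
    mul_nonpos_of_nonneg_of_nonpos (by positivity) (by linarith)
  linarith

namespace LpIdeal

variable {p : ℝ} (I : LpIdeal p X)

theorem norm_detp_le {Γ : ℝ} (hΓ : 0 ≤ Γ)
    (hΓb : ∀ F : X →L[ℂ] X, IsFiniteRank F → ‖detp p F‖ ≤ Real.exp (Γ * (eigSum p F).toReal))
    {F : X →L[ℂ] X} (hF : IsFiniteRank F) :
    ‖detp p F‖ ≤ Real.exp (I.γ ^ p * Γ * I.norm' F ^ p) := by
  have hFI := I.finiteRank_mem F hF
  have h0 := I.norm'_nonneg F hFI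
  have hγ := I.γ_nonneg
  refine (hΓb F hF).trans (Real.exp_le_exp.2 ?_)
  calc Γ * (eigSum p F).toReal ≤ Γ * (I.γ * I.norm' F) ^ p := by
        refine mul_le_mul_of_nonneg_left ?_ hΓ
        exact ENNReal.toReal_le_of_le_ofReal (by positivity) (I.eig_le F hFI)
    _ = I.γ ^ p * Γ * I.norm' F ^ p := by rw [Real.mul_rpow hγ h0]; ring

variable {I} {D : (X →L[ℂ] X) → ℂ}

open Filter Topology in
theorem Approximates.exists_hasFactorBound (hD : I.Approximates D) (hp : 0 < p) {L : X →L[ℂ] X}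
    (hL : L ∈ I.carrier) :
    ∃ (c : ℂ) (b : ℕ → ℂ), (∀ J : Finset ℕ, ∑ j ∈ J, ‖b j‖ ^ p ≤ (I.γ * I.norm' L) ^ p) ∧
      HasFactorBound p c b fun z => D (z • L) := by
  obtain ⟨F, hF, hF1⟩ := I.exists_seq_finiteRank hL
  have hFI := fun n => I.finiteRank_mem _ (hF n)
  have hL0 := I.norm'_nonneg L hL
  have hγ := I.γ_nonneg
  have hq0 := I.q_pos
  have hlim : Tendsto (fun n => I.norm' (L - F n)) atTop (𝓝 0) :=
    squeeze_zero (fun n => I.norm'_nonneg _ (I.sub_mem hL (hFI n)))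
      (fun n => (hF1 n).le) tendsto_one_div_add_atTop_nhds_zero_nat
  have hop : Tendsto F atTop (𝓝 L) := by
    rw [tendsto_iff_norm_sub_tendsto_zero]
    refine squeeze_zero (fun _ => norm_nonneg _) (fun n => ?_) hlim
    rw [norm_sub_rev]
    exact I.opNorm_le _ (I.sub_mem hL (hFI n))
  refine _root_.exists_hasFactorBound hp hF hop (C := (I.γ * (I.q * (1 + I.norm' L))) ^ p)
    (by positivity) (fun n => (I.eig_le _ (hFI n)).trans ?_) (by positivity) (I.eig_le L hL)
    fun z => hD.tendsto (I.smul_mem z hL) (fun n => (hF n).smul z) ?_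
  · refine ENNReal.ofReal_le_ofReal (Real.rpow_le_rpow
      (mul_nonneg hγ (I.norm'_nonneg _ (hFI n))) ?_ hp.le)
    refine mul_le_mul_of_nonneg_left ((I.norm'_le_of_sub (hFI n) hL).trans
      (mul_le_mul_of_nonneg_left ?_ hq0.le)) hγ
    have : 1 / ((n : ℝ) + 1) ≤ 1 := by
      rw [div_le_one (by positivity)]; linarith [(Nat.cast_nonneg n : (0 : ℝ) ≤ n)]
    linarith [hF1 n]
  · have : ∀ n, I.norm' (z • L - z • F n) = ‖z‖ * I.norm' (L - F n) := fun n => by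
      rw [← smul_sub, I.norm'_smul _ (I.sub_mem hL (hFI n))]
    simp only [this]
    simpa using hlim.const_mul ‖z‖

theorem Approximates.exists_growth (hD : I.Approximates D) (hp : 0 < p) {c : ℝ} (hc : 0 ≤ c)
    (hgrow : ∀ F : X →L[ℂ] X, IsFiniteRank F → ‖detp p F‖ ≤ Real.exp (c * I.norm' F ^ p))
    {ρ : ℝ} (hρ : 0 ≤ ρ) :
    ∃ A, 0 ≤ A ∧ ∀ T ∈ I.carrier, I.norm' T ≤ ρ → ∀ z : ℂ, 1 ≤ ‖z‖ →
      ‖D (z • T)‖ ≤ Real.exp (A * ‖z‖ ^ ⌈p⌉₊) := by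
  have hq0 := I.q_pos
  refine ⟨c * (I.q * (ρ + 1)) ^ p, by positivity, fun T hT hTρ z hz => ?_⟩
  have hT0 := I.norm'_nonneg T hT
  refine (hD.norm_le hp hc hgrow (I.smul_mem z hT)).trans (Real.exp_le_exp.2 ?_)
  rw [I.norm'_smul T hT, mul_assoc]
  refine mul_le_mul_of_nonneg_left ?_ hc
  calc (I.q * (‖z‖ * I.norm' T + 1)) ^ p ≤ (I.q * (ρ + 1) * ‖z‖) ^ p := by
        refine Real.rpow_le_rpow (by positivity) ?_ hp.le
        rw [mul_assoc]
        refine mul_le_mul_of_nonneg_left ?_ hq0.le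
        nlinarith
    _ = (I.q * (ρ + 1)) ^ p * ‖z‖ ^ p := Real.mul_rpow (by positivity) (by positivity)
    _ ≤ (I.q * (ρ + 1)) ^ p * ‖z‖ ^ ⌈p⌉₊ := by
        refine mul_le_mul_of_nonneg_left ?_ (by positivity)
        rw [← Real.rpow_natCast]
        exact Real.rpow_le_rpow_of_exponent_le hz (Nat.le_ceil p)

open Filter Topology in
theorem nonpos_of_forall_sq_mul_le {x C : ℝ}
    (h : ∀ R : ℝ, 0 < R → R ^ 2 * (x + C) ≤ (R + 1) ^ 2 * C) : x ≤ 0 := by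
  have hlim : Tendsto (fun n : ℕ => (1 + 1 / ((n : ℝ) + 1)) ^ 2 * C) atTop (𝓝 C) := by
    simpa using ((tendsto_one_div_add_atTop_nhds_zero_nat (𝕜 := ℝ)).const_add 1).pow 2
      |>.mul_const C
  have := ge_of_tendsto' hlim (b := x + C) fun n => by
    have hn : (0 : ℝ) < (n : ℝ) + 1 := by positivity
    have h1 := h _ hn
    have h2 : (1 + 1 / ((n : ℝ) + 1)) ^ 2 * C = ((n : ℝ) + 1 + 1) ^ 2 * C / ((n : ℝ) + 1) ^ 2 := by
      field_simp
    rw [h2, le_div_iff₀ (by positivity)]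
    linarith
  linarith

/-- The eigenvalue bound for finite rank operators passes to the whole ideal without loss. -/
theorem Approximates.norm_le_sharp [Nontrivial X] (hD : I.Approximates D) (hp : 0 < p) {Γ : ℝ}
    (hΓ : 0 ≤ Γ)
    (hΓb : ∀ F : X →L[ℂ] X, IsFiniteRank F → ‖detp p F‖ ≤ Real.exp (Γ * (eigSum p F).toReal))
    {L : X →L[ℂ] X} (hL : L ∈ I.carrier) :
    ‖D L‖ ≤ Real.exp (I.γ ^ p * Γ * I.norm' L ^ p) := by
  have hγ := I.γ_nonneg
  have hq0 := I.q_pos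
  have hL0 := I.norm'_nonneg L hL
  have hE := norm_elemFactor_le_of_detp_bound hp hΓ hΓb
  obtain ⟨cL, b, hb, hQ⟩ := hD.exists_hasFactorBound hp hL
  obtain ⟨A, hA, hgrow⟩ := hD.exists_growth hp (c := I.γ ^ p * Γ) (by positivity)
    (fun F hF => I.norm_detp_le hΓ hΓb hF) (ρ := I.q * (I.norm' L + 1)) (by positivity)
  have hcL : cL.re / 2 ≤ 0 := by
    refine nonpos_of_forall_sq_mul_le (C := A + 1) fun R hR => ?_
    obtain ⟨F, hF, hLF⟩ := I.dense_finiteRank L hL (1 / (R + 2)) (by positivity)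
    have hFI := I.finiteRank_mem F hF
    have hS : F - L ∈ I.carrier := I.sub_mem hFI hL
    have hS0 := I.norm'_nonneg _ hS
    rw [I.norm'_sub_comm hL hFI, lt_div_iff₀ (by positivity)] at hLF
    have hmem : ∀ ζ : ℂ, L + ζ • (F - L) ∈ I.carrier := fun ζ =>
      I.add_mem hL (I.smul_mem ζ hS)
    have hnorm : ∀ ζ : ℂ, ‖ζ‖ ≤ R + 2 → I.norm' (L + ζ • (F - L)) ≤ I.q * (I.norm' L + 1) := by
      intro ζ hζ
      refine (I.norm'_add_le _ hL _ (I.smul_mem ζ hS)).trans (mul_le_mul_of_nonneg_left ?_ hq0.le)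
      rw [I.norm'_smul _ hS]
      nlinarith
    have hbound : ∀ ζ : ℂ, ∃ (c : ℂ) (Φ : ℝ → ℝ), (ζ = 0 → c = cL) ∧ (ζ = 1 → c = 0) ∧
        (∀ r, 0 ≤ Φ r) ∧ Filter.Tendsto (fun r => Φ r / r ^ ⌈p⌉₊) Filter.atTop (nhds 0) ∧
        ∀ z : ℂ, ‖D (z • (L + ζ • (F - L)))‖ ≤ Real.exp ((c * z ^ ⌈p⌉₊).re + Φ ‖z‖) := by
      intro ζ
      by_cases h0 : ζ = 0
      · subst h0
        obtain ⟨Φ, h1, h2, h3⟩ := hQ.exists_littleO hp hΓ hE hb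
        exact ⟨cL, Φ, fun _ => rfl, fun h => (zero_ne_one h).elim, h1, h2, by simpa using h3⟩
      by_cases h1 : ζ = 1
      · subst h1
        obtain ⟨b', hb', hQ'⟩ := exists_hasFactorBound_of_isFiniteRank hp hF
          (Real.rpow_nonneg (mul_nonneg hγ (I.norm'_nonneg F hFI)) p) (I.eig_le F hFI)
        obtain ⟨Φ, h1, h2, h3⟩ := hQ'.exists_littleO hp hΓ hE hb'
        refine ⟨0, Φ, fun h => (one_ne_zero h).elim, fun _ => rfl, h1, h2, fun z => ?_⟩
        have h4 := h3 z
        rw [one_smul, add_sub_cancel, hD.extendsDetp _ (hF.smul z)]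
        exact h4
      · obtain ⟨c, b', hb', hQ'⟩ := hD.exists_hasFactorBound hp (hmem ζ)
        obtain ⟨Φ, h2, h3, h4⟩ := hQ'.exists_littleO hp hΓ hE hb'
        exact ⟨c, Φ, fun h => (h0 h).elim, fun h => (h1 h).elim, h2, h3, h4⟩
    choose c Φ hc0 hc1 hΦ0 hΦ hle using hbound
    have hzero : D 0 = 1 := by
      have h0 : IsFiniteRank (0 : X →L[ℂ] X) := by simpa using hF.smul 0
      have h1 := detp_smul_eq_prod p 0 h0 0
      rw [zero_smul] at h1
      rw [hD.extendsDetp 0 h0, h1]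
      simp [elemFactor_zero]
    have h := half_re_add_le_of_growth (G := fun z ζ => D (z • (L + ζ • (F - L))))
      (hD.continuous_smul_add_smul hL hS)
      (fun ζ => by
        simpa using hD.differentiable_line (I.smul_mem 0 hL) (hmem ζ))
      (fun z => by
        have := hD.differentiable_line (I.smul_mem z hL) (I.smul_mem z hS)
        simpa only [smul_add, smul_comm z] using this)
      (fun ζ => by simpa using hzero) (Nat.ceil_pos.2 hp).ne' hR hA
      (fun z ζ hz hζ => hgrow _ (hmem ζ) (hnorm ζ hζ) z hz)
      (c := c) (Φ := Φ) (fun ζ _ => hΦ0 ζ) (fun ζ _ => hΦ ζ) (fun ζ _ => hle ζ)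
      (by simp [hc1 1 rfl])
    rwa [hc0 0 rfl] at h
  have h := hQ.norm_one_le hΓ hE hb
  rw [one_smul, Real.mul_rpow hγ hL0] at h
  refine h.trans (Real.exp_le_exp.2 ?_)
  linarith

end LpIdeal

/-- Let `I` be an `l_p`-ideal in `B(X)` with eigenvalue constant `γ` and
quasi-triangle constant `q`, and let `Γ > 0` be such that
`|det_p(I-F)| ≤ exp(Γ ∑_j |λ_j(F)|^p)` for every finite rank `F`.  Then there is a unique
`‖·‖_I`-continuous function on `I` extending the `p`-regularized determinant from the finite
rank operators, and it satisfies `|det_{p,I}(I-L)| ≤ exp(γ^p Γ ‖L‖_I^p)` and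
`|det_{p,I}(I-K) - det_{p,I}(I-L)| ≤ ‖K-L‖_I exp(q^{2p} γ^p Γ (‖K‖_I + ‖L‖_I + 1)^p)`. -/
theorem exists_unique_detp_extension (p : ℝ) (hp : 0 < p) (I : LpIdeal p X)
    (Γ : ℝ) (hΓ : 0 < Γ)
    (hΓb : ∀ F : X →L[ℂ] X, IsFiniteRank F →
      ‖detp p F‖ ≤ Real.exp (Γ * (eigSum p F).toReal)) :
    ∃ D : (X →L[ℂ] X) → ℂ,
      IdealContinuous I D ∧ ExtendsDetp p D ∧
      (∀ D' : (X →L[ℂ] X) → ℂ, IdealContinuous I D' → ExtendsDetp p D' →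
        ∀ L ∈ I.carrier, D' L = D L) ∧
      (∀ L ∈ I.carrier, ‖D L‖ ≤ Real.exp (I.γ ^ p * Γ * I.norm' L ^ p)) ∧
      (∀ K ∈ I.carrier, ∀ L ∈ I.carrier,
        ‖D K - D L‖ ≤ I.norm' (K - L) *
          Real.exp (I.q ^ (2 * p) * I.γ ^ p * Γ * (I.norm' K + I.norm' L + 1) ^ p)) := by
  have hγ := I.γ_nonneg
  have hc : 0 ≤ I.γ ^ p * Γ := by positivity
  have hgrow := fun F hF => I.norm_detp_le hΓ.le hΓb (F := F) hF
  obtain ⟨D, hD⟩ := I.exists_approximates hp hc hgrow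
  have hsharp : ∀ L ∈ I.carrier, ‖D L‖ ≤ Real.exp (I.γ ^ p * Γ * I.norm' L ^ p) := by
    intro L hL
    rcases subsingleton_or_nontrivial X with hX | hX
    · have hLf : IsFiniteRank L := by
        rw [IsFiniteRank]
        infer_instance
      rw [hD.extendsDetp L hLf]
      exact hgrow L hLf
    · exact hD.norm_le_sharp hp hΓ.le hΓb hL
  refine ⟨D, hD.idealContinuous, hD.extendsDetp,
    fun D' hc' he' L hL => hD.eq_of_continuous_of_extends hc' he' hL, hsharp,
    fun K hK L hL => ?_⟩
  have h := I.norm_sub_le_of_growth (V := (· ∈ I.carrier)) (fun _ h => h)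
    (fun _ _ => I.add_mem) (fun z _ => I.smul_mem z)
    (fun S T hS hT => hD.differentiable_line hS hT) hc hp hsharp hK hL
  rwa [← mul_assoc] at h
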